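/- There exists α > 0 depending only on d and λ such that for every A ∈ Ω with associated Green function G_T, every T > 0, every fixed R ≥ 1 (constants depending also on R) and every z ∈ ℝ^d with |z| > 2R: ( ∫_{B_R(z)} |∇_{z'} G_T(z',0)|² dz' )^{1/2} ≤ C |z|^{−α} exp(−c|z|/√T) if d = 2, and ≤ C |z|^{2−d} exp(−c|z|/√T) if d > 2, where c > 0 and C < ∞ depend only on d, λ and R. -/

import Mathlib

open MeasureTheory Filter Metric Matrix ENNReal

noncomputable section

namespace GO

/-- Euclidean space `ℝ^d`. -/
abbrev E (d : ℕ) : Type := EuclideanSpace ℝ (Fin d)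

/-- The set `Ω₀` of bounded elliptic matrices: `|A₀ξ| ≤ |ξ|` and `ξ·A₀ξ ≥ λ|ξ|²`. -/
def IsEllipticMatrix (d : ℕ) (lam : ℝ) (M : Matrix (Fin d) (Fin d) ℝ) : Prop :=
  (∀ ξ : Fin d → ℝ, (M.mulVec ξ) ⬝ᵥ (M.mulVec ξ) ≤ ξ ⬝ᵥ ξ) ∧
  (∀ ξ : Fin d → ℝ, lam * (ξ ⬝ᵥ ξ) ≤ ξ ⬝ᵥ (M.mulVec ξ))

instance matrixMeasurableSpace (d : ℕ) : MeasurableSpace (Matrix (Fin d) (Fin d) ℝ) :=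
  MeasurableSpace.pi

/-- `Ω` : Lebesgue-measurable coefficient fields with values in `Ω₀`. -/
structure CoeffField (d : ℕ) (lam : ℝ) : Type where
  A : E d → Matrix (Fin d) (Fin d) ℝ
  measurable : Measurable A
  elliptic : ∀ x, IsEllipticMatrix d lam (A x)

/-- Smooth compactly supported test functions. -/
def IsTestFun (d : ℕ) (χ : E d → ℝ) : Prop :=
  ContDiff ℝ (⊤ : ℕ∞) χ ∧ HasCompactSupport χ

/-- The σ-algebra `𝓕` generated by the maps `A ↦ ∫ A_{ij} χ`. -/
def ensembleSigma (d : ℕ) (lam : ℝ) : MeasurableSpace (CoeffField d lam) :=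
  ⨆ (i : Fin d) (j : Fin d) (χ : E d → ℝ) (_ : IsTestFun d χ),
    MeasurableSpace.comap (fun W => ∫ x : E d, W.A x i j * χ x) inferInstance

instance (d : ℕ) (lam : ℝ) : MeasurableSpace (CoeffField d lam) := ensembleSigma d lam

/-- The shift `τ_z A = A(· + z)`. -/
def shift {d : ℕ} {lam : ℝ} (z : E d) (W : CoeffField d lam) : CoeffField d lam where
  A := fun x => W.A (x + z)
  measurable := W.measurable.comp (measurable_add_const z)
  elliptic := fun x => W.elliptic (x + z)

/-- Stationarity of an ensemble. -/
def IsStationary {d : ℕ} {lam : ℝ} (μ : Measure (CoeffField d lam)) : Prop :=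
  ∀ z : E d, μ.map (shift z) = μ

/-- `W'` agrees with `W` outside `U`. -/
def agreesOff {d : ℕ} {lam : ℝ} (U : Set (E d)) (W W' : CoeffField d lam) : Prop :=
  ∀ x ∉ U, W'.A x = W.A x

/-- The oscillation `osc_{A|U} X` (with values in `ℝ≥0∞`). -/
def osc {d : ℕ} {lam : ℝ} (U : Set (E d)) (X : CoeffField d lam → ℝ)
    (W : CoeffField d lam) : ℝ≥0∞ :=
  ⨆ (W₁ : CoeffField d lam) (_ : agreesOff U W W₁) (W₂ : CoeffField d lam)
    (_ : agreesOff U W W₂), ENNReal.ofReal (X W₁ - X W₂)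

/-- Outer expectation of a (possibly non-measurable) nonnegative quantity. -/
def outerE {d : ℕ} {lam : ℝ} (μ : Measure (CoeffField d lam))
    (f : CoeffField d lam → ℝ≥0∞) : ℝ≥0∞ :=
  ⨅ (g : CoeffField d lam → ℝ≥0∞) (_ : Measurable g) (_ : ∀ W, f W ≤ g W), ∫⁻ W, g W ∂μ

/-- Expectation `⟨X⟩`. -/
def ensMean {d : ℕ} {lam : ℝ} (μ : Measure (CoeffField d lam))
    (X : CoeffField d lam → ℝ) : ℝ :=
  ∫ W, X W ∂μ

/-- Variance `var[X]` (with values in `ℝ≥0∞`). -/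
def ensVar {d : ℕ} {lam : ℝ} (μ : Measure (CoeffField d lam))
    (X : CoeffField d lam → ℝ) : ℝ≥0∞ :=
  ∫⁻ W, ENNReal.ofReal ((X W - ensMean μ X) ^ 2) ∂μ

/-- The spectral gap estimate (SG) with constants `ρ` and `ℓ`. -/
def SpectralGap {d : ℕ} {lam : ℝ} (μ : Measure (CoeffField d lam)) (ρ ℓ : ℝ) : Prop :=
  ∀ X : CoeffField d lam → ℝ, Measurable X →
    ensVar μ X ≤ ENNReal.ofReal ρ⁻¹ *
      outerE μ (fun W => ∫⁻ z : E d, (osc (ball z ℓ) X W) ^ 2)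

/-- The gradient of a test function, as a vector of `ℝ^d`. -/
def gradAt {d : ℕ} (χ : E d → ℝ) (x : E d) : Fin d → ℝ :=
  fun i => fderiv ℝ χ x (EuclideanSpace.single i 1)

/-- `φ ∈ H¹_loc(ℝ^d)` with weak gradient `Dφ`. -/
def IsWeakH1Loc {d : ℕ} (φ : E d → ℝ) (Dφ : E d → Fin d → ℝ) : Prop :=
  (∀ R : ℝ, 0 < R →
    IntegrableOn (fun x => (φ x) ^ 2) (ball (0:E d) R) volume ∧
    IntegrableOn (fun x => Dφ x ⬝ᵥ Dφ x) (ball (0:E d) R) volume) ∧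
  (∀ χ : E d → ℝ, IsTestFun d χ → ∀ i : Fin d,
    ∫ x : E d, φ x * gradAt χ x i = - ∫ x : E d, Dφ x i * χ x)

/-- The uniqueness class: `limsup_{t↑∞} ⨍_{B_t} (φ² + |∇φ|²) < ∞`. -/
def GrowthClass {d : ℕ} (φ : E d → ℝ) (Dφ : E d → Fin d → ℝ) : Prop :=
  Filter.limsup (fun t : ℝ =>
      (∫⁻ x in ball (0:E d) t, ENNReal.ofReal ((φ x) ^ 2 + Dφ x ⬝ᵥ Dφ x)) /
        volume (ball (0:E d) t)) Filter.atTop < ⊤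

/-- The modified corrector: distributional solution of `T⁻¹φ_T − ∇·A(ξ+∇φ_T) = 0`
in the growth class. -/
def IsModifiedCorrector {d : ℕ} {lam : ℝ} (W : CoeffField d lam) (T : ℝ) (ξ : Fin d → ℝ)
    (φ : E d → ℝ) (Dφ : E d → Fin d → ℝ) : Prop :=
  IsWeakH1Loc φ Dφ ∧ GrowthClass φ Dφ ∧
  ∀ χ : E d → ℝ, IsTestFun d χ →
    ∫ x : E d, (T⁻¹ * φ x * χ x + gradAt χ x ⬝ᵥ (W.A x).mulVec (ξ + Dφ x)) = 0

/-- The modified adjoint corrector (with `A` replaced by its pointwise transpose `A*`). -/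
def IsModifiedAdjointCorrector {d : ℕ} {lam : ℝ} (W : CoeffField d lam) (T : ℝ)
    (ξ' : Fin d → ℝ) (φ : E d → ℝ) (Dφ : E d → Fin d → ℝ) : Prop :=
  IsWeakH1Loc φ Dφ ∧ GrowthClass φ Dφ ∧
  ∀ χ : E d → ℝ, IsTestFun d χ →
    ∫ x : E d, (T⁻¹ * φ x * χ x + gradAt χ x ⬝ᵥ ((W.A x).transpose).mulVec (ξ' + Dφ x)) = 0

/-- The solution `ψ_T` of `T⁻¹ψ_T − ∇·A∇ψ_T = φ_T` in the growth class. -/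
def IsPsiSolution {d : ℕ} {lam : ℝ} (W : CoeffField d lam) (T : ℝ) (φ : E d → ℝ)
    (ψ : E d → ℝ) (Dψ : E d → Fin d → ℝ) : Prop :=
  IsWeakH1Loc ψ Dψ ∧ GrowthClass ψ Dψ ∧
  ∀ χ : E d → ℝ, IsTestFun d χ →
    ∫ x : E d, (T⁻¹ * ψ x * χ x + gradAt χ x ⬝ᵥ (W.A x).mulVec (Dψ x)) = ∫ x : E d, φ x * χ x

/-- The pointwise bound `g_T` for the Green function. -/
def gBound (d : ℕ) (c T r : ℝ) : ℝ :=
  Real.exp (-(c * r) / Real.sqrt T) *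
    (if d = 2 then Real.log (2 + Real.sqrt T / r) else r ^ ((2:ℝ) - (d:ℝ)))

/-- `Df` is the weak gradient of `f`. -/
def HasWeakGrad {d : ℕ} (f : E d → ℝ) (Df : E d → Fin d → ℝ) : Prop :=
  ∀ χ : E d → ℝ, IsTestFun d χ → ∀ i : Fin d,
    ∫ x : E d, f x * gradAt χ x i = - ∫ x : E d, Df x i * χ x

/-- The defining properties of the Green function `G_T` (with constants `c`, `C`). -/
def GreenProps {d : ℕ} {lam : ℝ} (W : CoeffField d lam) (T : ℝ) (c C : ℝ)
    (G : E d → E d → ℝ) (DxG DyG : E d → E d → Fin d → ℝ) : Prop :=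
  (∀ x y : E d, 0 ≤ G x y) ∧
  ContinuousOn (fun p : E d × E d => G p.1 p.2) {p : E d × E d | p.1 ≠ p.2} ∧
  (∀ x y : E d, x ≠ y → G x y ≤ C * gBound d c T (dist x y)) ∧
  (∀ y : E d, HasWeakGrad (fun x => G x y) (fun x => DxG x y)) ∧
  (∀ x : E d, HasWeakGrad (fun y => G x y) (fun y => DyG x y)) ∧
  (∀ y : E d, ∀ R : ℝ, 0 < R →
    IntegrableOn (fun x => G x y) (ball (0:E d) R) volume ∧
    ∀ i : Fin d, IntegrableOn (fun x => DxG x y i) (ball (0:E d) R) volume) ∧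
  (∀ x : E d, ∀ R : ℝ, 0 < R →
    IntegrableOn (fun y => G x y) (ball (0:E d) R) volume ∧
    ∀ i : Fin d, IntegrableOn (fun y => DyG x y i) (ball (0:E d) R) volume) ∧
  (∀ y : E d, ∀ R : ℝ, 0 < R →
    (∫⁻ x in {x : E d | R < dist x y ∧ dist x y < 2*R}, ENNReal.ofReal (DxG x y ⬝ᵥ DxG x y)) ≤
      ENNReal.ofReal ((C * Real.exp (-(c*R) / Real.sqrt T) * R ^ ((1:ℝ) - (d:ℝ))) ^ 2 * R ^ d)) ∧
  (∀ x : E d, ∀ R : ℝ, 0 < R →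
    (∫⁻ y in {y : E d | R < dist y x ∧ dist y x < 2*R}, ENNReal.ofReal (DyG x y ⬝ᵥ DyG x y)) ≤
      ENNReal.ofReal ((C * Real.exp (-(c*R) / Real.sqrt T) * R ^ ((1:ℝ) - (d:ℝ))) ^ 2 * R ^ d)) ∧
  (∀ y : E d, ∀ χ : E d → ℝ, IsTestFun d χ →
    ∫ x : E d, (T⁻¹ * G x y * χ x + gradAt χ x ⬝ᵥ (W.A x).mulVec (DxG x y)) = χ y) ∧
  (∀ x : E d, ∀ χ : E d → ℝ, IsTestFun d χ →
    ∫ y : E d, (T⁻¹ * G x y * χ y + gradAt χ y ⬝ᵥ ((W.A y).transpose).mulVec (DyG x y)) = χ x)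

/-- `G` is the Green function of `W`, with gradients `DxG`, `DyG`
(for some admissible constants `c`, `C`). -/
def IsGreenFunction {d : ℕ} {lam : ℝ} (W : CoeffField d lam) (T : ℝ)
    (G : E d → E d → ℝ) (DxG DyG : E d → E d → Fin d → ℝ) : Prop :=
  ∃ c C : ℝ, 0 < c ∧ 0 < C ∧ GreenProps W T c C G DxG DyG

/-- `DDG` is the mixed second gradient `∇∇G` of the Green function. -/
def IsMixedGrad {d : ℕ} (DxG : E d → E d → Fin d → ℝ)
    (DDG : E d → E d → Fin d → Fin d → ℝ) : Prop :=
  ∀ (y : E d) (j : Fin d), HasWeakGrad (fun x => DxG y x j) (fun x => DDG y x j)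

/-- The quantity `h_T(z,x)` built from the Green function gradient. -/
def hTval (d : ℕ) (R : ℝ) (DxG : E d → E d → Fin d → ℝ) (z x : E d) : ℝ :=
  if dist z x < 2*R then 1
  else Real.sqrt ((∫⁻ y in ball z R, ENNReal.ofReal (DxG y x ⬝ᵥ DxG y x)).toReal)

/-- `ν_d(T)`. -/
def nud (d : ℕ) (T : ℝ) : ℝ :=
  if d = 2 then T * Real.log T
  else if d = 3 then Real.sqrt T
  else if d = 4 then Real.log T
  else 1

end GO

namespace GO

open scoped Convolution Topology

/-- Cauchy–Schwarz for Lebesgue integrals, in squared form. -/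
lemma lintegral_mul_sq_le {α : Type*} [MeasurableSpace α] {μ : Measure α} {f g : α → ℝ≥0∞}
    (hf : AEMeasurable f μ) (hg : AEMeasurable g μ) :
    (∫⁻ x, f x * g x ∂μ) ^ 2 ≤ (∫⁻ x, f x ^ 2 ∂μ) * ∫⁻ x, g x ^ 2 ∂μ := by
  have h := ENNReal.lintegral_mul_le_Lp_mul_Lq μ Real.HolderConjugate.two_two hf hg
  have h2 : (∫⁻ x, f x * g x ∂μ) ≤
      (∫⁻ x, f x ^ 2 ∂μ) ^ (1 / 2 : ℝ) * (∫⁻ x, g x ^ 2 ∂μ) ^ (1 / 2 : ℝ) := by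
    simpa using h
  calc (∫⁻ x, f x * g x ∂μ) ^ 2 ≤
      ((∫⁻ x, f x ^ 2 ∂μ) ^ (1 / 2 : ℝ) * (∫⁻ x, g x ^ 2 ∂μ) ^ (1 / 2 : ℝ)) ^ 2 := by gcongr
    _ = _ := by
      rw [mul_pow, ← ENNReal.rpow_natCast, ← ENNReal.rpow_natCast, ← ENNReal.rpow_mul,
        ← ENNReal.rpow_mul]
      norm_num

lemma eLpNorm_two_sq {α : Type*} [MeasurableSpace α] {μ : Measure α} (f : α → ℝ) :
    eLpNorm f 2 μ ^ 2 = ∫⁻ x, ENNReal.ofReal (f x ^ 2) ∂μ := by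
  rw [eLpNorm_eq_lintegral_rpow_enorm_toReal (by norm_num) (by norm_num)]
  simp only [ENNReal.toReal_ofNat, ENNReal.rpow_ofNat]
  rw [← ENNReal.rpow_natCast, ← ENNReal.rpow_mul]
  norm_num
  refine lintegral_congr fun x => ?_
  rw [Real.enorm_eq_ofReal_abs, ← ENNReal.ofReal_pow (abs_nonneg _), sq_abs]

/-- Mollification is a contraction on `L²`. -/
lemma eLpNorm_normed_convolution_le {d : ℕ} (φ : ContDiffBump (0 : E d)) {g : E d → ℝ}
    (hg : AEStronglyMeasurable g volume) :
    eLpNorm (φ.normed volume ⋆[ContinuousLinearMap.lsmul ℝ ℝ, volume] g) 2 volume ≤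
      eLpNorm g 2 volume := by
  set ρ : E d → ℝ := φ.normed volume with hρ
  have hρc : Continuous ρ := φ.continuous_normed
  have hρ1 : ∫⁻ t, ‖ρ t‖ₑ = 1 := by
    have h1 : ∫ t, ρ t = 1 := φ.integral_normed
    rw [← ofReal_integral_norm_eq_lintegral_enorm φ.integrable_normed]
    simp only [Real.norm_eq_abs, abs_of_nonneg (φ.nonneg_normed _)]
    rw [← hρ, h1]; simp
  have hpt : ∀ x, ‖(ρ ⋆[ContinuousLinearMap.lsmul ℝ ℝ, volume] g) x‖ₑ ^ 2 ≤
      ∫⁻ t, ‖ρ t‖ₑ * ‖g (x - t)‖ₑ ^ 2 := by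
    intro x
    have hgx : AEStronglyMeasurable (fun t => g (x - t)) volume :=
      hg.comp_quasiMeasurePreserving (quasiMeasurePreserving_sub_left_of_right_invariant volume x)
    have e1 : ‖(ρ ⋆[ContinuousLinearMap.lsmul ℝ ℝ, volume] g) x‖ₑ ≤
        ∫⁻ t, ‖ρ t‖ₑ ^ (1 / 2 : ℝ) * (‖ρ t‖ₑ ^ (1 / 2 : ℝ) * ‖g (x - t)‖ₑ) := by
      rw [convolution_def]
      refine (enorm_integral_le_lintegral_enorm _).trans (lintegral_mono fun t => ?_)
      rw [← mul_assoc, ← ENNReal.rpow_add_of_nonneg _ _ (by norm_num) (by norm_num)]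
      norm_num [enorm_mul]
    have hm : AEMeasurable (fun t => ‖ρ t‖ₑ ^ (1 / 2 : ℝ)) volume := by fun_prop
    have e2 := lintegral_mul_sq_le (μ := (volume : Measure (E d))) hm
      (hm.mul hgx.enorm)
    have e3 : ∀ a : ℝ≥0∞, (a ^ (1 / 2 : ℝ)) ^ 2 = a := by
      intro a
      rw [← ENNReal.rpow_natCast, ← ENNReal.rpow_mul]; norm_num
    simp only [Pi.mul_apply, mul_pow, e3] at e2
    rw [hρ1, one_mul] at e2
    exact (pow_le_pow_left' e1 2).trans e2
  have hpow : (∫⁻ x, ‖(ρ ⋆[ContinuousLinearMap.lsmul ℝ ℝ, volume] g) x‖ₑ ^ 2) ≤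
      ∫⁻ x, ‖g x‖ₑ ^ 2 := by
    calc _ ≤ ∫⁻ x, ∫⁻ t, ‖ρ t‖ₑ * ‖g (x - t)‖ₑ ^ 2 := lintegral_mono hpt
      _ = ∫⁻ t, ∫⁻ x, ‖ρ t‖ₑ * ‖g (x - t)‖ₑ ^ 2 := by
        refine lintegral_lintegral_swap ?_
        have : AEStronglyMeasurable (fun z : E d × E d => g (z.1 - z.2)) (volume.prod volume) :=
          hg.comp_quasiMeasurePreserving (quasiMeasurePreserving_sub volume volume)
        exact ((hρc.measurable.enorm.comp measurable_snd).aemeasurable.mul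
          (this.enorm.pow_const 2))
      _ = ∫⁻ t, ‖ρ t‖ₑ * ∫⁻ x, ‖g x‖ₑ ^ 2 := by
        refine lintegral_congr fun t => ?_
        rw [lintegral_const_mul' _ _ enorm_ne_top,
          lintegral_sub_right_eq_self (fun x => ‖g x‖ₑ ^ 2) t]
      _ = _ := by
        rw [lintegral_mul_const _ hρc.measurable.enorm, hρ1, one_mul]
  rw [eLpNorm_eq_lintegral_rpow_enorm_toReal (by norm_num) (by norm_num),
    eLpNorm_eq_lintegral_rpow_enorm_toReal (by norm_num) (by norm_num)]
  simp only [ENNReal.toReal_ofNat, ENNReal.rpow_ofNat]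
  gcongr

/-- Mollifications converge in `L²`. -/
lemma tendsto_eLpNorm_normed_convolution_sub {d : ℕ} {φ : ℕ → ContDiffBump (0 : E d)}
    (hφ : Tendsto (fun n => (φ n).rOut) atTop (𝓝 0)) {g : E d → ℝ}
    (hg : MemLp g 2 volume) :
    Tendsto (fun n => eLpNorm
      ((φ n).normed volume ⋆[ContinuousLinearMap.lsmul ℝ ℝ, volume] g - g) 2 volume)
      atTop (𝓝 0) := by
  rw [ENNReal.tendsto_atTop_zero]
  intro ε hε
  by_cases hεt : ε = ⊤
  · exact ⟨0, fun n _ => hεt ▸ le_top⟩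
  have hε3 : ε / 3 ≠ 0 := by simp [hε.ne']
  obtain ⟨h, hhc, hgh, hcont, hhL⟩ :=
    hg.exists_hasCompactSupport_eLpNorm_sub_le (by norm_num) hε3
  obtain ⟨B, hB⟩ := hhc.isCompact.isBounded.subset_closedBall (0 : E d)
  set S : Set (E d) := closedBall 0 (B + 1)
  have hSvol : volume S < ⊤ := measure_closedBall_lt_top
  obtain ⟨δ, hδ0, hδ⟩ : ∃ δ : ℝ, 0 < δ ∧
      ENNReal.ofReal δ * (volume S) ^ (1 / 2 : ℝ) ≤ ε / 3 := by
    set V := (volume S) ^ (1 / 2 : ℝ)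
    have hV : V ≠ ⊤ := (ENNReal.rpow_lt_top_of_nonneg (by norm_num) hSvol.ne).ne
    have hε3t : ε / 3 ≠ ⊤ := by
      exact (ENNReal.div_lt_top hεt (by norm_num)).ne
    refine ⟨(ε / 3).toReal / (V.toReal + 1), ?_, ?_⟩
    · have := ENNReal.toReal_pos hε3 hε3t
      positivity
    · rw [← ENNReal.ofReal_toReal hV, ← ENNReal.ofReal_mul (by positivity)]
      refine ENNReal.ofReal_le_of_le_toReal ?_
      rw [ENNReal.toReal_ofReal (by positivity), div_mul_eq_mul_div, div_le_iff₀ (by positivity)]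
      have := ENNReal.toReal_nonneg (a := ε / 3)
      nlinarith
  have huc := hhc.uniformContinuous_of_continuous hcont
  obtain ⟨η, hη0, hη⟩ := Metric.uniformContinuous_iff.1 huc δ hδ0
  have hev : ∀ᶠ n in atTop, (φ n).rOut < min η 1 :=
    hφ.eventually (gt_mem_nhds (lt_min hη0 one_pos))
  obtain ⟨N, hN⟩ := eventually_atTop.1 hev
  refine ⟨N, fun n hn => ?_⟩
  have hr := hN n hn
  set L : ℝ →L[ℝ] ℝ →L[ℝ] ℝ := ContinuousLinearMap.lsmul ℝ ℝ
  set ρ : E d → ℝ := (φ n).normed volume with hρ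
  have hρs : HasCompactSupport ρ := (φ n).hasCompactSupport_normed
  have hρc : Continuous ρ := (φ n).continuous_normed
  have hce : ∀ {k : E d → ℝ}, LocallyIntegrable k volume → ConvolutionExists ρ k L volume :=
    fun hk => hρs.convolutionExists_left L hρc hk
  have hgl : LocallyIntegrable g volume := hg.locallyIntegrable (by norm_num)
  have hhl : LocallyIntegrable h volume := hhL.locallyIntegrable (by norm_num)
  have hsplit : ρ ⋆[L, volume] g - g =
      (ρ ⋆[L, volume] (g - h)) + ((ρ ⋆[L, volume] h - h) + (h - g)) := by
    have : ρ ⋆[L, volume] g = ρ ⋆[L, volume] (g - h) + ρ ⋆[L, volume] h := by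
      rw [← (hce (hgl.sub hhl)).distrib_add (hce hhl)]; simp
    rw [this]; abel
  have m1 : AEStronglyMeasurable (ρ ⋆[L, volume] (g - h)) volume :=
    (hρs.continuous_convolution_left L hρc (hgl.sub hhl)).aestronglyMeasurable
  have m2 : AEStronglyMeasurable (ρ ⋆[L, volume] h - h) volume :=
    ((hρs.continuous_convolution_left L hρc hhl).sub hcont).aestronglyMeasurable
  have m3 : AEStronglyMeasurable (h - g) volume := hcont.aestronglyMeasurable.sub hg.1
  have b1 : eLpNorm (ρ ⋆[L, volume] (g - h)) 2 volume ≤ ε / 3 :=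
    (eLpNorm_normed_convolution_le (φ n) (hg.1.sub hcont.aestronglyMeasurable)).trans hgh
  have b3 : eLpNorm (h - g) 2 volume ≤ ε / 3 := by rwa [eLpNorm_sub_comm]
  have b2 : eLpNorm (ρ ⋆[L, volume] h - h) 2 volume ≤ ε / 3 := by
    have hsupp : ∀ x ∉ S, (ρ ⋆[L, volume] h - h) x = 0 := by
      intro x hx
      have hx' : B + 1 < ‖x‖ := by simpa [S] using hx
      have hz : ∀ y, B < ‖y‖ → h y = 0 := by
        intro y hy
        by_contra hne
        have := hB (subset_tsupport _ hne)
        simp at this; linarith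
      have h0 : h x = 0 := hz x (by linarith)
      have hh := ContDiffBump.dist_normed_convolution_le (φ := φ n) (x₀ := x) (ε := 0)
        (μ := volume) hcont.aestronglyMeasurable (by
          intro y hy
          rw [h0, hz y, dist_self]
          have h1 : dist y x < 1 := (mem_ball.1 hy).trans (hr.trans_le (min_le_right _ _))
          have h2 : ‖x‖ - ‖y‖ ≤ dist y x := by
            rw [dist_comm, dist_eq_norm]; exact norm_sub_norm_le _ _
          linarith)
      rw [Pi.sub_apply, sub_eq_zero]
      exact dist_le_zero.1 hh
    have hbd : ∀ x, ‖(ρ ⋆[L, volume] h - h) x‖ ≤ δ := by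
      intro x
      rw [Pi.sub_apply, ← dist_eq_norm]
      refine ContDiffBump.dist_normed_convolution_le hcont.aestronglyMeasurable ?_
      intro y hy
      exact (hη ((mem_ball.1 hy).trans (hr.trans_le (min_le_left _ _)))).le
    have hind : ρ ⋆[L, volume] h - h = S.indicator (ρ ⋆[L, volume] h - h) := by
      ext x
      by_cases hx : x ∈ S
      · simp [hx]
      · simp only [hx, not_false_eq_true, Set.indicator_of_notMem, hsupp x hx]
    rw [hind, eLpNorm_indicator_eq_eLpNorm_restrict measurableSet_closedBall]
    refine (eLpNorm_le_of_ae_bound (C := δ) (ae_of_all _ hbd)).trans ?_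
    rw [mul_comm]
    simpa using hδ
  rw [hsplit]
  refine (eLpNorm_add_le m1 (m2.add m3) (by norm_num)).trans ?_
  calc _ ≤ ε / 3 + (ε / 3 + ε / 3) :=
        add_le_add b1 ((eLpNorm_add_le m2 m3 (by norm_num)).trans (add_le_add b2 b3))
    _ = ε := by rw [← add_assoc, ENNReal.add_thirds]

/-- The partial derivatives of a mollification are the mollified weak derivatives. -/
lemma gradAt_normed_convolution {d : ℕ} (φ : ContDiffBump (0 : E d)) {v : E d → ℝ}
    {Dv : E d → Fin d → ℝ} (hv : LocallyIntegrable v volume) (hw : HasWeakGrad v Dv)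
    (x : E d) (i : Fin d) :
    gradAt (φ.normed volume ⋆[ContinuousLinearMap.lsmul ℝ ℝ, volume] v) x i =
      (φ.normed volume ⋆[ContinuousLinearMap.lsmul ℝ ℝ, volume] fun y => Dv y i) x := by
  set ρ : E d → ℝ := φ.normed volume with hρ
  have hρs : HasCompactSupport ρ := φ.hasCompactSupport_normed
  have hρd : ContDiff ℝ (⊤ : ℕ∞) ρ := φ.contDiff_normed
  have hρ1 : ContDiff ℝ 1 ρ := φ.contDiff_normed
  have hd := hρs.hasFDerivAt_convolution_left (ContinuousLinearMap.lsmul ℝ ℝ : ℝ →L[ℝ] ℝ →L[ℝ] ℝ)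
    hρ1 hv x
  set e : E d := EuclideanSpace.single i 1 with he
  have hsub : ContDiff ℝ (⊤ : ℕ∞) (fun y : E d => x - y) := contDiff_const.sub contDiff_id
  have hχ : IsTestFun d (fun y => ρ (x - y)) := by
    refine ⟨hρd.comp hsub, ?_⟩
    exact hρs.comp_homeomorph (Homeomorph.subLeft x)
  have hgrad : ∀ y, gradAt (fun y => ρ (x - y)) y i = -(fderiv ℝ ρ (x - y) e) := by
    intro y
    have h1 : HasFDerivAt (fun y : E d => x - y) (-(ContinuousLinearMap.id ℝ (E d))) y := by
      simpa using (hasFDerivAt_id y).const_sub x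
    have h2 := ((hρ1.differentiable one_ne_zero) (x - y)).hasFDerivAt.comp y h1
    have h3 : fderiv ℝ (fun y => ρ (x - y)) y = _ := h2.fderiv
    simp only [gradAt, h3]
    simp [he]
  have hwk := hw _ hχ i
  simp only [hgrad] at hwk
  rw [convolution_eq_swap]
  simp only [ContinuousLinearMap.lsmul_apply, smul_eq_mul]
  have hL : gradAt (ρ ⋆[ContinuousLinearMap.lsmul ℝ ℝ, volume] v) x i =
      ∫ t, fderiv ℝ ρ (x - t) e * v t := by
    simp only [gradAt, hd.fderiv]
    rw [convolution_eq_swap, ContinuousLinearMap.integral_apply]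
    · simp [ContinuousLinearMap.precompL_apply, he]
    · exact ((hρs.fderiv ℝ).convolutionExists_left _ (hρ1.continuous_fderiv one_ne_zero) hv
        x).integrable_swap
  rw [hL]
  have e1 : ∫ t, v t * -(fderiv ℝ ρ (x - t) e) = - ∫ t, fderiv ℝ ρ (x - t) e * v t := by
    rw [← integral_neg]
    congr 1; ext t; ring
  rw [e1, neg_inj] at hwk
  rw [hwk]
  congr 1; ext t; ring

/-- A continuous function with locally square integrable weak gradient is approximated, locally
uniformly and in `H¹`, by smooth functions. -/
lemma exists_smooth_approx {d : ℕ} {v : E d → ℝ} {Dv : E d → Fin d → ℝ} {U K : Set (E d)}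
    (hU : IsOpen U) (hK : IsCompact K) (hKU : K ⊆ U) (hc : ContinuousOn v U)
    (hv : LocallyIntegrable v volume)
    (hw : HasWeakGrad v Dv)
    (hL2 : ∀ K' ⊆ U, IsCompact K' → ∀ i, MemLp (fun x => Dv x i) 2 (volume.restrict K')) :
    ∃ f : ℕ → E d → ℝ, (∀ n, ContDiff ℝ (⊤ : ℕ∞) (f n)) ∧ TendstoUniformlyOn f v atTop K ∧
      ∀ i, Tendsto (fun n => eLpNorm (fun x => gradAt (f n) x i - Dv x i) 2 (volume.restrict K))
        atTop (𝓝 0) := by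
  obtain ⟨δ, hδ, hδU⟩ := hK.exists_cthickening_subset_open hU hKU
  set K' := cthickening δ K with hK'
  have hK'c : IsCompact K' := hK.cthickening
  have hball : ∀ x ∈ K, ball x δ ⊆ K' := fun x hx =>
    ball_subset_closedBall.trans (closedBall_subset_cthickening hx δ)
  let φ : ℕ → ContDiffBump (0 : E d) := fun n =>
    ⟨1 / ((n : ℝ) + 2), 1 / ((n : ℝ) + 1), by positivity,
      one_div_lt_one_div_of_lt (by positivity) (by linarith)⟩
  have hφ : Tendsto (fun n => (φ n).rOut) atTop (𝓝 0) := tendsto_one_div_add_atTop_nhds_zero_nat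
  have hr0 : ∀ n, 0 < (φ n).rOut := fun n => (φ n).rOut_pos
  refine ⟨fun n => (φ n).normed volume ⋆[ContinuousLinearMap.lsmul ℝ ℝ, volume] v,
    fun n => ?_, ?_, fun i => ?_⟩
  · exact (φ n).hasCompactSupport_normed.contDiff_convolution_left _ (φ n).contDiff_normed hv
  · rw [Metric.tendstoUniformlyOn_iff]
    intro ε hε
    have huc := hK'c.uniformContinuousOn_of_continuous (hc.mono hδU)
    obtain ⟨η, hη0, hη⟩ := Metric.uniformContinuousOn_iff.1 huc (ε / 2) (by positivity)
    filter_upwards [hφ.eventually (gt_mem_nhds (lt_min hη0 hδ))] with n hn x hx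
    rw [dist_comm]
    refine lt_of_le_of_lt (b := ε / 2) ?_ (by linarith)
    refine ContDiffBump.dist_normed_convolution_le hv.aestronglyMeasurable ?_
    intro y hy
    have hy' := mem_ball.1 hy
    refine (hη y (hball x hx ?_) x (self_subset_cthickening K hx) ?_).le
    · exact mem_ball.2 (hy'.trans (hn.trans_le (min_le_right _ _)))
    · exact hy'.trans (hn.trans_le (min_le_left _ _))
  · set g : E d → ℝ := K'.indicator (fun x => Dv x i) with hg
    have hgL : MemLp g 2 volume := by
      rw [hg, memLp_indicator_iff_restrict hK'c.measurableSet]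
      exact hL2 K' hδU hK'c i
    refine tendsto_of_tendsto_of_tendsto_of_le_of_le' tendsto_const_nhds
      (tendsto_eLpNorm_normed_convolution_sub hφ hgL) (Eventually.of_forall fun n => zero_le) ?_
    filter_upwards [hφ.eventually (gt_mem_nhds hδ)] with n hn
    have hcongr : eLpNorm (fun x => gradAt ((φ n).normed volume
        ⋆[ContinuousLinearMap.lsmul ℝ ℝ, volume] v) x i - Dv x i) 2 (volume.restrict K) =
        eLpNorm ((φ n).normed volume ⋆[ContinuousLinearMap.lsmul ℝ ℝ, volume] g - g) 2
          (volume.restrict K) := by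
      refine eLpNorm_congr_ae ?_
      filter_upwards [ae_restrict_mem hK.measurableSet] with x hx
      have hxK' : x ∈ K' := self_subset_cthickening K hx
      rw [gradAt_normed_convolution _ hv hw, Pi.sub_apply]
      congr 1
      · rw [convolution_def, convolution_def]
        congr 1
        ext t
        by_cases ht : t ∈ ball (0 : E d) (φ n).rOut
        · have : x - t ∈ K' := hball x hx (by
            rw [mem_ball, dist_eq_norm]
            have := mem_ball_zero_iff.1 ht
            simpa using this.trans hn)
          simp [hg, this]
        · have : (φ n).normed volume t = 0 := by
            rw [← Function.notMem_support, ContDiffBump.support_normed_eq]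
            exact ht
          simp [this]
      · simp [hg, hxK']
    rw [hcongr]
    exact eLpNorm_restrict_le _ _ _ _

lemma dot_self_nonneg {d : ℕ} (ξ : Fin d → ℝ) : 0 ≤ ξ ⬝ᵥ ξ := by
  exact Finset.sum_nonneg fun i _ => mul_self_nonneg _

lemma dot_sq_le {d : ℕ} (ξ η : Fin d → ℝ) : (ξ ⬝ᵥ η) ^ 2 ≤ (ξ ⬝ᵥ ξ) * (η ⬝ᵥ η) := by
  simpa [dotProduct, sq] using Finset.sum_mul_sq_le_sq_mul_sq Finset.univ ξ η

lemma sq_coord_le_dot {d : ℕ} (ξ : Fin d → ℝ) (i : Fin d) : ξ i ^ 2 ≤ ξ ⬝ᵥ ξ := by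
  rw [sq]
  exact Finset.single_le_sum (f := fun j => ξ j * ξ j) (fun j _ => mul_self_nonneg _)
    (Finset.mem_univ i)

lemma IsEllipticMatrix.transpose {d : ℕ} {lam : ℝ} {M : Matrix (Fin d) (Fin d) ℝ}
    (h : IsEllipticMatrix d lam M) : IsEllipticMatrix d lam Mᵀ := by
  refine ⟨fun ξ => ?_, fun ξ => ?_⟩
  · set η := Mᵀ.mulVec ξ with hη
    have h1 : η ⬝ᵥ η = ξ ⬝ᵥ M.mulVec η := by
      conv_lhs => rw [hη]
      rw [Matrix.mulVec_transpose, ← Matrix.dotProduct_mulVec, ← Matrix.mulVec_transpose]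
    have h2 : (ξ ⬝ᵥ M.mulVec η) ^ 2 ≤ (ξ ⬝ᵥ ξ) * (M.mulVec η ⬝ᵥ M.mulVec η) := dot_sq_le _ _
    have h3 := h.1 η
    have h4 : 0 ≤ ξ ⬝ᵥ ξ := dot_self_nonneg ξ
    have h5 : 0 ≤ η ⬝ᵥ η := dot_self_nonneg η
    rw [← h1] at h2
    by_contra hcon
    push Not at hcon
    have h6 : (ξ ⬝ᵥ ξ) * (M.mulVec η ⬝ᵥ M.mulVec η) ≤ (ξ ⬝ᵥ ξ) * (η ⬝ᵥ η) :=
      mul_le_mul_of_nonneg_left h3 h4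
    have h7 : 0 < η ⬝ᵥ η := lt_of_le_of_lt h4 hcon
    nlinarith
  · rw [Matrix.mulVec_transpose, dotProduct_comm ξ (vecMul ξ M), ← Matrix.dotProduct_mulVec]
    exact h.2 ξ

/-- The transposed coefficient field. -/
def CoeffField.transpose {d : ℕ} {lam : ℝ} (W : CoeffField d lam) : CoeffField d lam where
  A := fun x => (W.A x)ᵀ
  measurable := by
    refine measurable_pi_lambda _ fun i => measurable_pi_lambda _ fun j => ?_
    exact (measurable_pi_apply i).comp ((measurable_pi_apply j).comp W.measurable)
  elliptic := fun x => (W.elliptic x).transpose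

/-- `v` is continuous on the open set `U`, and has a weak gradient which is locally square
integrable on `U`. -/
structure H1Off {d : ℕ} (U : Set (E d)) (v : E d → ℝ) (Dv : E d → Fin d → ℝ) : Prop where
  isOpen : IsOpen U
  cont : ContinuousOn v U
  locInt : LocallyIntegrable v volume
  weak : HasWeakGrad v Dv
  memLp : ∀ K ⊆ U, IsCompact K → ∀ i, MemLp (fun x => Dv x i) 2 (volume.restrict K)

/-- `u` is a fundamental solution with pole `p` of the massive operator with coefficients `W`. -/
structure IsFund {d : ℕ} {lam : ℝ} (W : CoeffField d lam) (T : ℝ) (p : E d) (u : E d → ℝ)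
    (Du : E d → Fin d → ℝ) : Prop where
  nonneg : ∀ x, 0 ≤ u x
  h1 : H1Off {p}ᶜ u Du
  eqn : ∀ χ : E d → ℝ, IsTestFun d χ →
    ∫ x : E d, (T⁻¹ * u x * χ x + gradAt χ x ⬝ᵥ (W.A x).mulVec (Du x)) = χ p
  locInt : ∀ i, LocallyIntegrable (fun x => Du x i) volume
  bound : ∃ c C : ℝ, 0 < c ∧ 0 < C ∧ (∀ x, x ≠ p → u x ≤ C * gBound d c T (dist x p)) ∧
    ∀ R : ℝ, 0 < R →
      (∫⁻ x in {x : E d | R < dist x p ∧ dist x p < 2 * R}, ENNReal.ofReal (Du x ⬝ᵥ Du x)) ≤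
      ENNReal.ofReal ((C * Real.exp (-(c * R) / Real.sqrt T) * R ^ ((1 : ℝ) - (d : ℝ))) ^ 2 * R ^ d)

/-- A shell around `p` is covered by finitely many dyadic-type annuli. -/
lemma exists_annulus_index {a r : ℝ} (ha : 0 < a) {N : ℕ} (h1 : a ≤ r) (h2 : r < a * 2 ^ N) :
    ∃ j < 2 * N, a * (Real.sqrt 2) ^ j / Real.sqrt 2 < r ∧
      r < 2 * (a * (Real.sqrt 2) ^ j / Real.sqrt 2) := by
  have hs : 1 < Real.sqrt 2 := by
    rw [Real.lt_sqrt] <;> norm_num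
  have hs2 : Real.sqrt 2 ^ 2 = 2 := Real.sq_sqrt (by norm_num)
  have hx : 1 ≤ r / a := by rwa [le_div_iff₀ ha, one_mul]
  obtain ⟨j, hj1, hj2⟩ := exists_nat_pow_near hx hs
  rw [le_div_iff₀ ha] at hj1
  rw [div_lt_iff₀ ha] at hj2
  have hs0 : 0 < Real.sqrt 2 := by positivity
  refine ⟨j, ?_, ?_, ?_⟩
  · by_contra hcon
    push Not at hcon
    have h3 : (2 : ℝ) ^ N ≤ Real.sqrt 2 ^ j := by
      calc (2 : ℝ) ^ N = Real.sqrt 2 ^ (2 * N) := by rw [pow_mul, hs2]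
        _ ≤ _ := pow_le_pow_right₀ hs.le hcon
    nlinarith
  · rw [div_lt_iff₀ hs0]
    nlinarith [mul_pos ha (pow_pos hs0 j)]
  · rw [pow_succ] at hj2
    have : 2 * (a * Real.sqrt 2 ^ j / Real.sqrt 2) = a * Real.sqrt 2 ^ j * Real.sqrt 2 := by
      field_simp
      rw [hs2]
    rw [this]
    linarith

/-- Square integrability on compact sets avoiding `p` from bounds on annuli. -/
lemma memLp_of_annuli {d : ℕ} {p : E d} {Du : E d → Fin d → ℝ}
    (hm : ∀ i, AEStronglyMeasurable (fun x => Du x i) volume)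
    (h : ∀ R : ℝ, 0 < R →
      (∫⁻ x in {x : E d | R < dist x p ∧ dist x p < 2 * R}, ENNReal.ofReal (Du x ⬝ᵥ Du x)) < ⊤)
    {K : Set (E d)} (hKp : K ⊆ {p}ᶜ) (hK : IsCompact K) (i : Fin d) :
    MemLp (fun x => Du x i) 2 (volume.restrict K) := by
  refine ⟨(hm i).restrict, ?_⟩
  obtain ⟨a, ha, hKa⟩ : ∃ a > 0, ∀ x ∈ K, a ≤ dist x p := by
    have h1 : ∀ᶠ δ in 𝓝[>] (0 : ℝ), Metric.ball p δ ⊆ Kᶜ := by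
      have : Kᶜ ∈ 𝓝 p := hK.isClosed.isOpen_compl.mem_nhds fun hp => hKp hp rfl
      obtain ⟨ε, hε, hεK⟩ := Metric.mem_nhds_iff.1 this
      filter_upwards [Ioo_mem_nhdsGT hε] with δ hδ
      exact (ball_subset_ball hδ.2.le).trans hεK
    obtain ⟨δ, hδ, hδ0⟩ := (h1.and self_mem_nhdsWithin).exists
    refine ⟨δ, hδ0, fun x hx => ?_⟩
    by_contra hcon
    exact hδ (mem_ball.2 (not_le.1 hcon)) hx
  obtain ⟨b, hb⟩ := hK.isBounded.subset_ball p
  obtain ⟨N, hN⟩ := pow_unbounded_of_one_lt (b / a) (one_lt_two)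
  rw [div_lt_iff₀ ha] at hN
  set S : ℕ → Set (E d) := fun j =>
    {x | a * (Real.sqrt 2) ^ j / Real.sqrt 2 < dist x p ∧
      dist x p < 2 * (a * (Real.sqrt 2) ^ j / Real.sqrt 2)} with hS
  have hcov : K ⊆ ⋃ j : Fin (2 * N), S j := by
    intro x hx
    obtain ⟨j, hj, h1, h2⟩ := exists_annulus_index ha (hKa x hx)
      (N := N) (by have := mem_ball.1 (hb hx); linarith)
    simp only [Set.mem_iUnion]
    exact ⟨⟨j, hj⟩, h1, h2⟩
  have hfin : ∫⁻ x in K, ENNReal.ofReal (Du x ⬝ᵥ Du x) < ⊤ := by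
    refine lt_of_le_of_lt (lintegral_mono_set hcov) ?_
    refine lt_of_le_of_lt (lintegral_iUnion_le _ _) ?_
    rw [tsum_fintype]
    refine ENNReal.sum_lt_top.2 fun j _ => h _ (by positivity)
  have h2 : eLpNorm (fun x => Du x i) 2 (volume.restrict K) ^ 2 < ⊤ := by
    rw [eLpNorm_two_sq]
    refine lt_of_le_of_lt (lintegral_mono fun x => ?_) hfin
    exact ENNReal.ofReal_le_ofReal (sq_coord_le_dot (Du x) i)
  exact (ENNReal.pow_lt_top_iff.1 h2).resolve_right (by norm_num)

lemma locallyIntegrable_of_ball {d : ℕ} {f : E d → ℝ}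
    (h : ∀ R : ℝ, 0 < R → IntegrableOn f (ball (0 : E d) R) volume) :
    LocallyIntegrable f volume := by
  intro x
  refine ⟨ball 0 (‖x‖ + 1), isOpen_ball.mem_nhds ?_, h _ (by positivity)⟩
  rw [mem_ball_zero_iff]
  linarith

lemma GreenProps.isFund_left {d : ℕ} {lam : ℝ} {W : CoeffField d lam} {T c C : ℝ}
    {G : E d → E d → ℝ} {DxG DyG : E d → E d → Fin d → ℝ} (hc : 0 < c) (hC : 0 < C)
    (h : GreenProps W T c C G DxG DyG) (y : E d) :
    IsFund W T y (fun x => G x y) (fun x => DxG x y) := by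
  obtain ⟨h0, h1, h2, h3, -, h5, -, h7, -, h9, -⟩ := h
  have hL : ∀ i, LocallyIntegrable (fun x => DxG x y i) volume := fun i =>
    locallyIntegrable_of_ball fun R hR => (h5 y R hR).2 i
  refine ⟨fun x => h0 x y, ⟨isOpen_compl_singleton, ?_, ?_, h3 y, ?_⟩, h9 y, hL,
    c, C, hc, hC, fun x hx => h2 x y hx, h7 y⟩
  · exact h1.comp (f := fun x => (x, y)) (by fun_prop) fun x hx => hx
  · exact locallyIntegrable_of_ball fun R hR => (h5 y R hR).1
  · intro K hKp hK i
    exact memLp_of_annuli (fun i => (hL i).aestronglyMeasurable)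
      (fun R hR => (h7 y R hR).trans_lt ENNReal.ofReal_lt_top) hKp hK i

lemma GreenProps.isFund_right {d : ℕ} {lam : ℝ} {W : CoeffField d lam} {T c C : ℝ}
    {G : E d → E d → ℝ} {DxG DyG : E d → E d → Fin d → ℝ} (hc : 0 < c) (hC : 0 < C)
    (h : GreenProps W T c C G DxG DyG) (x : E d) :
    IsFund W.transpose T x (fun y => G x y) (fun y => DyG x y) := by
  obtain ⟨h0, h1, h2, -, h4, -, h6, -, h8, -, h10⟩ := h
  have hL : ∀ i, LocallyIntegrable (fun y => DyG x y i) volume := fun i =>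
    locallyIntegrable_of_ball fun R hR => (h6 x R hR).2 i
  refine ⟨fun y => h0 x y, ⟨isOpen_compl_singleton, ?_, ?_, h4 x, ?_⟩, h10 x, hL,
    c, C, hc, hC, fun y hy => ?_, h8 x⟩
  · exact h1.comp (f := fun y => (x, y)) (by fun_prop) fun y hy => Ne.symm hy
  · exact locallyIntegrable_of_ball fun R hR => (h6 x R hR).1
  · intro K hKp hK i
    exact memLp_of_annuli (fun i => (hL i).aestronglyMeasurable)
      (fun R hR => (h8 x R hR).trans_lt ENNReal.ofReal_lt_top) hKp hK i
  · rw [dist_comm]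
    exact h2 x y (Ne.symm hy)

lemma tendsto_eLpNorm_mul_of_bound {α : Type*} [MeasurableSpace α] {μ : Measure α}
    {g h : ℕ → α → ℝ} {M : ℝ} (hg : ∀ᶠ n in atTop, ∀ᵐ x ∂μ, |g n x| ≤ M)
    (hh : Tendsto (fun n => eLpNorm (h n) 2 μ) atTop (𝓝 0)) :
    Tendsto (fun n => eLpNorm (fun x => g n x * h n x) 2 μ) atTop (𝓝 0) := by
  have h1 : Tendsto (fun n => ENNReal.ofReal M * eLpNorm (h n) 2 μ) atTop (𝓝 0) := by
    simpa using ENNReal.Tendsto.const_mul hh (Or.inr ENNReal.ofReal_ne_top)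
  refine tendsto_of_tendsto_of_tendsto_of_le_of_le' tendsto_const_nhds h1
    (Eventually.of_forall fun n => zero_le) ?_
  filter_upwards [hg] with n hn
  refine eLpNorm_le_mul_eLpNorm_of_ae_le_mul ?_ 2
  filter_upwards [hn] with x hx
  rw [norm_mul]
  exact mul_le_mul_of_nonneg_right hx (norm_nonneg _)

lemma tendsto_eLpNorm_mul_of_small {α : Type*} [MeasurableSpace α] {μ : Measure α}
    {g : ℕ → α → ℝ} {h : α → ℝ} (hg : ∀ ε > 0, ∀ᶠ n in atTop, ∀ᵐ x ∂μ, |g n x| ≤ ε)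
    (hh : MemLp h 2 μ) :
    Tendsto (fun n => eLpNorm (fun x => g n x * h x) 2 μ) atTop (𝓝 0) := by
  rw [ENNReal.tendsto_atTop_zero]
  intro ε hε
  by_cases hεt : ε = ⊤
  · exact ⟨0, fun n _ => by simp [hεt]⟩
  set m := (eLpNorm h 2 μ).toReal with hm
  have hε' : 0 < ε.toReal := ENNReal.toReal_pos hε.ne' hεt
  obtain ⟨N, hN⟩ := eventually_atTop.1 (hg (ε.toReal / (m + 1)) (by positivity))
  refine ⟨N, fun n hn => ?_⟩
  have h1 : eLpNorm (fun x => g n x * h x) 2 μ ≤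
      ENNReal.ofReal (ε.toReal / (m + 1)) * eLpNorm h 2 μ := by
    refine eLpNorm_le_mul_eLpNorm_of_ae_le_mul ?_ 2
    filter_upwards [hN n hn] with x hx
    rw [norm_mul]
    exact mul_le_mul_of_nonneg_right hx (norm_nonneg _)
  refine h1.trans ?_
  rw [← ENNReal.ofReal_toReal hh.2.ne, ← hm, ← ENNReal.ofReal_mul (by positivity)]
  refine (ENNReal.ofReal_le_ofReal ?_).trans (ENNReal.ofReal_toReal hεt).le
  rw [div_mul_eq_mul_div, div_le_iff₀ (by positivity)]
  nlinarith [ENNReal.toReal_nonneg (a := eLpNorm h 2 μ)]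

lemma tendstoUniformlyOn_comp_of_continuous {d : ℕ} {K : Set (E d)} (hK : IsCompact K)
    {f : ℕ → E d → ℝ} {v : E d → ℝ} (hv : ContinuousOn v K) (hf : TendstoUniformlyOn f v atTop K)
    {F : ℝ → ℝ} (hF : Continuous F) :
    TendstoUniformlyOn (fun n x => F (f n x)) (fun x => F (v x)) atTop K := by
  obtain ⟨B, hB⟩ := hK.exists_bound_of_continuousOn hv
  have huc : UniformContinuousOn F (Set.Icc (-(B + 1)) (B + 1)) :=
    isCompact_Icc.uniformContinuousOn_of_continuous hF.continuousOn
  rw [Metric.tendstoUniformlyOn_iff] at hf ⊢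
  intro ε hε
  obtain ⟨δ, hδ, h⟩ := Metric.uniformContinuousOn_iff.1 huc ε hε
  filter_upwards [hf (min δ 1) (by positivity)] with n hn x hx
  have h1 := hn x hx
  have h2 := hB x hx
  rw [Real.norm_eq_abs, abs_le] at h2
  have h3 : |v x - f n x| < 1 := by
    rw [← Real.dist_eq]; exact h1.trans_le (min_le_right _ _)
  rw [abs_lt] at h3
  refine h _ ?_ _ ?_ (h1.trans_le (min_le_left _ _))
  · constructor <;> linarith
  · constructor <;> linarith

/-- The truncated composition `η F(v)` is a limit of test functions. -/
lemma H1Off.exists_testFun_approx {d : ℕ} {U : Set (E d)} {v : E d → ℝ} {Dv : E d → Fin d → ℝ}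
    (h : H1Off U v Dv) {η : E d → ℝ} (hη : IsTestFun d η) (hηU : tsupport η ⊆ U) {F : ℝ → ℝ}
    (hF : ContDiff ℝ (⊤ : ℕ∞) F) :
    ∃ χ : ℕ → E d → ℝ, (∀ n, IsTestFun d (χ n)) ∧ (∀ n x, x ∉ tsupport η → χ n x = 0) ∧
      (∀ n x i, x ∉ tsupport η → gradAt (χ n) x i = 0) ∧
      TendstoUniformlyOn χ (fun x => η x * F (v x)) atTop Set.univ ∧
      ∀ i, Tendsto (fun n => eLpNorm (fun x => gradAt (χ n) x i -
        (gradAt η x i * F (v x) + η x * (deriv F (v x) * Dv x i))) 2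
          (volume.restrict (tsupport η))) atTop (𝓝 0) := by
  have hK : IsCompact (tsupport η) := hη.2
  set K := tsupport η with hKdef
  obtain ⟨f, hf1, hf2, hf3⟩ := exists_smooth_approx h.isOpen hK hηU h.cont h.locInt h.weak h.memLp
  have hvK : ContinuousOn v K := h.cont.mono hηU
  have hF1 : ContDiff ℝ 1 F := hF.of_le (by norm_cast)
  have hF' : Continuous (deriv F) := hF1.continuous_deriv le_rfl
  have hη1 : ContDiff ℝ 1 η := hη.1.of_le (by norm_cast)
  have hgc : ∀ i, Continuous (fun x => gradAt η x i) := fun i =>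
    (hη1.continuous_fderiv one_ne_zero).clm_apply continuous_const
  have hzero : ∀ x, x ∉ K → η x = 0 := fun x hx => image_eq_zero_of_notMem_tsupport hx
  have hsupp : ∀ n, tsupport (fun x => η x * F (f n x)) ⊆ K := fun n =>
    tsupport_mul_subset_left
  refine ⟨fun n x => η x * F (f n x), fun n => ⟨?_, ?_⟩, fun n x hx => ?_, fun n x i hx => ?_,
    ?_, fun i => ?_⟩
  · exact hη.1.mul (hF.comp (hf1 n))
  · exact hη.2.mul_right
  · simp [hzero x hx]
  · have : x ∉ tsupport (fderiv ℝ (fun x => η x * F (f n x))) := fun hc =>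
      hx (hsupp n (tsupport_fderiv_subset ℝ hc))
    simp [gradAt, image_eq_zero_of_notMem_tsupport this]
  · have hu := tendstoUniformlyOn_comp_of_continuous hK hvK hf2 hF.continuous
    obtain ⟨B, hB⟩ := hK.exists_bound_of_continuousOn hη.1.continuous.continuousOn
    rw [Metric.tendstoUniformlyOn_iff] at hu ⊢
    intro ε hε
    filter_upwards [hu (ε / (|B| + 1)) (by positivity)] with n hn x _
    by_cases hx : x ∈ K
    · have h1 := hn x hx
      have h2 := hB x hx
      rw [Real.dist_eq, lt_div_iff₀ (by positivity)] at h1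
      rw [Real.dist_eq, ← mul_sub, abs_mul, ← Real.norm_eq_abs (η x)]
      have h3 : ‖η x‖ < |B| + 1 := by linarith [le_abs_self B]
      nlinarith [abs_nonneg (F (v x) - F (f n x)), norm_nonneg (η x)]
    · simp [hzero x hx, hε]
  · set μ := volume.restrict K with hμ
    have : IsFiniteMeasure μ := ⟨by simpa [hμ] using hK.measure_lt_top⟩
    have haeK : ∀ᵐ x ∂μ, x ∈ K := ae_restrict_mem hK.measurableSet
    have hu := Metric.tendstoUniformlyOn_iff.1
      (tendstoUniformlyOn_comp_of_continuous hK hvK hf2 hF.continuous)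
    have hu' := Metric.tendstoUniformlyOn_iff.1
      (tendstoUniformlyOn_comp_of_continuous hK hvK hf2 hF')
    have hb1 : MemLp (fun x => gradAt η x i) 2 μ := by
      obtain ⟨B, hB⟩ := hK.exists_bound_of_continuousOn (hgc i).continuousOn
      exact MemLp.of_bound (hgc i).aestronglyMeasurable B (haeK.mono hB)
    have hb2 : MemLp (fun x => η x * Dv x i) 2 μ := by
      have := (h.memLp K hηU hK i)
      obtain ⟨B, hB⟩ := hK.exists_bound_of_continuousOn hη.1.continuous.continuousOn
      refine this.of_le_mul (c := B)
        (hη.1.continuous.aestronglyMeasurable.mul this.aestronglyMeasurable) ?_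
      filter_upwards [haeK] with x hx
      rw [norm_mul]
      exact mul_le_mul_of_nonneg_right (hB x hx) (norm_nonneg _)
    have t1 : Tendsto (fun n => eLpNorm (fun x => (F (f n x) - F (v x)) * gradAt η x i) 2 μ) atTop
        (𝓝 0) := by
      refine tendsto_eLpNorm_mul_of_small (fun ε hε => ?_) hb1
      filter_upwards [hu ε hε] with n hn
      filter_upwards [haeK] with x hx
      rw [abs_sub_comm, ← Real.dist_eq]
      exact (hn x hx).le
    have t2 : Tendsto (fun n => eLpNorm (fun x => (deriv F (f n x) - deriv F (v x)) *
        (η x * Dv x i)) 2 μ) atTop (𝓝 0) := by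
      refine tendsto_eLpNorm_mul_of_small (fun ε hε => ?_) hb2
      filter_upwards [hu' ε hε] with n hn
      filter_upwards [haeK] with x hx
      rw [abs_sub_comm, ← Real.dist_eq]
      exact (hn x hx).le
    have t3 : Tendsto (fun n => eLpNorm (fun x => (η x * deriv F (f n x)) *
        (gradAt (f n) x i - Dv x i)) 2 μ) atTop (𝓝 0) := by
      obtain ⟨B, hB⟩ := hK.exists_bound_of_continuousOn
        (hη.1.continuous.continuousOn.mul (hF'.comp_continuousOn hvK))
      obtain ⟨B', hB'⟩ := hK.exists_bound_of_continuousOn hη.1.continuous.continuousOn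
      refine tendsto_eLpNorm_mul_of_bound (M := B + B') ?_ (hf3 i)
      filter_upwards [hu' 1 one_pos] with n hn
      filter_upwards [haeK] with x hx
      have h1 := hn x hx
      have h2 := hB x hx
      have h3 := hB' x hx
      rw [Real.dist_eq] at h1
      have h4 : η x * deriv F (f n x) = η x * deriv F (v x) - η x * (deriv F (v x) - deriv F (f n x)) :=
        by ring
      rw [h4]
      refine (abs_sub _ _).trans (add_le_add h2 ?_)
      rw [abs_mul]
      refine le_trans ?_ h3
      rw [Real.norm_eq_abs]
      exact mul_le_of_le_one_right (abs_nonneg _) h1.le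
    have hsum := (t1.add t2).add t3
    simp only [add_zero] at hsum
    refine tendsto_of_tendsto_of_tendsto_of_le_of_le tendsto_const_nhds hsum
      (fun n => zero_le) fun n => ?_
    have hgrad : ∀ x, gradAt (fun x => η x * F (f n x)) x i =
        gradAt η x i * F (f n x) + η x * (deriv F (f n x) * gradAt (f n) x i) := by
      intro x
      have hfd := ((hf1 n).differentiable (by simp)) x
      have hFd := (hF.differentiable (by simp)) (f n x)
      have e1 := (((hη.1.differentiable (by simp)) x).hasFDerivAt.mul
        (hFd.hasDerivAt.comp_hasFDerivAt x hfd.hasFDerivAt)).fderiv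
      have e2 : fderiv ℝ (fun x => η x * F (f n x)) x = _ := e1
      simp only [gradAt, e2]
      simp
      ring
    have hmv : AEStronglyMeasurable v μ := hvK.aestronglyMeasurable hK.measurableSet
    have m1 : AEStronglyMeasurable (fun x => (F (f n x) - F (v x)) * gradAt η x i) μ :=
      (((hF.continuous.comp (hf1 n).continuous).aestronglyMeasurable).sub
        (hF.continuous.comp_aestronglyMeasurable hmv)).mul hb1.aestronglyMeasurable
    have m2 : AEStronglyMeasurable (fun x => (deriv F (f n x) - deriv F (v x)) *
        (η x * Dv x i)) μ :=
      (((hF'.comp (hf1 n).continuous).aestronglyMeasurable).sub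
        (hF'.comp_aestronglyMeasurable hmv)).mul hb2.aestronglyMeasurable
    have hgf : Continuous (fun x => gradAt (f n) x i) :=
      ((hf1 n).continuous_fderiv (by simp)).clm_apply continuous_const
    have m3 : AEStronglyMeasurable (fun x => (η x * deriv F (f n x)) *
        (gradAt (f n) x i - Dv x i)) μ :=
      ((hη.1.continuous.mul (hF'.comp (hf1 n).continuous)).aestronglyMeasurable).mul
        (hgf.aestronglyMeasurable.sub (h.memLp K hηU hK i).aestronglyMeasurable)
    refine le_trans (le_of_eq ?_) ((eLpNorm_add_le (m1.add m2) m3 (by norm_num)).trans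
      (add_le_add_left (eLpNorm_add_le m1 m2 (by norm_num)) _))
    congr 1
    ext x
    simp only [Pi.add_apply, hgrad]
    ring

/-- The flux `A Du`. -/
def flux {d : ℕ} {lam : ℝ} (W : CoeffField d lam) (Du : E d → Fin d → ℝ) (x : E d) : Fin d → ℝ :=
  (W.A x).mulVec (Du x)

lemma flux_memLp {d : ℕ} {lam : ℝ} (W : CoeffField d lam) {Du : E d → Fin d → ℝ} {μ : Measure (E d)}
    (h : ∀ i, MemLp (fun x => Du x i) 2 μ) (i : Fin d) : MemLp (fun x => flux W Du x i) 2 μ := by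
  have hA : ∀ i j, Measurable fun x => W.A x i j := fun i j =>
    (measurable_pi_apply j).comp ((measurable_pi_apply i).comp W.measurable)
  have hm : AEStronglyMeasurable (fun x => flux W Du x i) μ := by
    have : (fun x => flux W Du x i) = fun x => ∑ j, W.A x i j * Du x j := by
      ext x; rfl
    rw [this]
    exact Finset.aestronglyMeasurable_fun_sum _ fun j _ =>
      (hA i j).aestronglyMeasurable.mul (h j).aestronglyMeasurable
  have hs : MemLp (fun x => ∑ j, ‖Du x j‖) 2 μ := memLp_finsetSum _ fun j _ => (h j).norm
  refine hs.mono hm (Eventually.of_forall fun x => ?_)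
  rw [Real.norm_of_nonneg (Finset.sum_nonneg fun j _ => norm_nonneg _), Real.norm_eq_abs]
  refine abs_le_of_sq_le_sq ?_ (Finset.sum_nonneg fun j _ => norm_nonneg _)
  refine (sq_coord_le_dot (flux W Du x) i).trans ?_
  refine ((W.elliptic x).1 (Du x)).trans ?_
  have : Du x ⬝ᵥ Du x = ∑ j, ‖Du x j‖ ^ 2 := by
    simp [dotProduct, sq]
  rw [this]
  exact Finset.sum_sq_le_sq_sum_of_nonneg fun j _ => norm_nonneg _

lemma integrable_mul_of_zero_off {d : ℕ} {K : Set (E d)} (hK : IsCompact K) {f h : E d → ℝ}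
    (hf : ContinuousOn f K) (hh : IntegrableOn h K volume) (h0 : ∀ x, x ∉ K → f x = 0) :
    Integrable (fun x => f x * h x) volume := by
  have h1 : IntegrableOn (fun x => f x * h x) K volume := hh.continuousOn_mul hf hK
  refine (integrableOn_iff_integrable_of_support_subset fun x hx => ?_).1 h1
  by_contra hc
  exact hx (by simp [h0 x hc])

lemma IsTestFun.gradAt_continuous {d : ℕ} {η : E d → ℝ} (hη : IsTestFun d η) (i : Fin d) :
    Continuous fun x => gradAt η x i :=
  (hη.1.continuous_fderiv (by simp)).clm_apply continuous_const

lemma gradAt_eq_zero {d : ℕ} {η : E d → ℝ} {x : E d} (hx : x ∉ tsupport η) (i : Fin d) :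
    gradAt η x i = 0 := by
  have : x ∉ tsupport (fderiv ℝ η) := fun hc => hx (tsupport_fderiv_subset ℝ hc)
  simp [gradAt, image_eq_zero_of_notMem_tsupport this]

/-- The equation tested with `η F(v)`, the support of `η` avoiding the pole and the singularities
of `v`. -/
lemma IsFund.tested {d : ℕ} {lam : ℝ} {W : CoeffField d lam} {T : ℝ} {p : E d} {u : E d → ℝ}
    {Du : E d → Fin d → ℝ} (hu : IsFund W T p u Du) {U : Set (E d)} {v : E d → ℝ}
    {Dv : E d → Fin d → ℝ} (hv : H1Off U v Dv) {η : E d → ℝ} (hη : IsTestFun d η)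
    (hηp : tsupport η ⊆ {p}ᶜ) (hηU : tsupport η ⊆ U) {F : ℝ → ℝ}
    (hF : ContDiff ℝ (⊤ : ℕ∞) F) :
    ∫ x, (T⁻¹ * (η x * F (v x) * u x) + (F (v x) * (gradAt η x ⬝ᵥ flux W Du x)
      + η x * deriv F (v x) * (Dv x ⬝ᵥ flux W Du x))) = 0 := by
  obtain ⟨χ, h1, h2, h3, h4, h5⟩ := hv.exists_testFun_approx hη hηU hF
  have hK : IsCompact (tsupport η) := hη.2
  set K := tsupport η with hKdef
  set μ := volume.restrict K with hμ
  have : IsFiniteMeasure μ := ⟨by simpa [hμ] using hK.measure_lt_top⟩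
  have hJ : ∀ i, MemLp (fun x => flux W Du x i) 2 μ := flux_memLp W (hu.h1.memLp K hηp hK)
  have huK : IntegrableOn u K volume := hu.h1.locInt.integrableOn_isCompact hK
  set Φ : E d → Fin d → ℝ := fun x i => gradAt η x i * F (v x) + η x * (deriv F (v x) * Dv x i)
    with hΦ
  have hvK : ContinuousOn v K := hv.cont.mono hηU
  have hF' : Continuous (deriv F) := hF.continuous_deriv (by simp)
  have hΦL : ∀ i, MemLp (fun x => Φ x i) 2 μ := by
    intro i
    refine MemLp.add ?_ ?_
    · have hc : ContinuousOn (fun x => gradAt η x i * F (v x)) K :=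
        (hη.gradAt_continuous i).continuousOn.mul (hF.continuous.comp_continuousOn hvK)
      obtain ⟨B, hB⟩ := hK.exists_bound_of_continuousOn hc
      exact MemLp.of_bound (hc.aestronglyMeasurable hK.measurableSet) B
        ((ae_restrict_mem hK.measurableSet).mono hB)
    · have hc : ContinuousOn (fun x => η x * deriv F (v x)) K :=
        hη.1.continuous.continuousOn.mul (hF'.comp_continuousOn hvK)
      obtain ⟨B, hB⟩ := hK.exists_bound_of_continuousOn hc
      have hD := hv.memLp K hηU hK i
      have : (fun x => η x * (deriv F (v x) * Dv x i)) =
          fun x => (η x * deriv F (v x)) * Dv x i := by ext x; ring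
      rw [this]
      refine hD.of_le_mul (c := B)
        ((hc.aestronglyMeasurable hK.measurableSet).mul hD.aestronglyMeasurable) ?_
      filter_upwards [ae_restrict_mem hK.measurableSet] with x hx
      rw [norm_mul]
      exact mul_le_mul_of_nonneg_right (hB x hx) (norm_nonneg _)
  have hbd : ContinuousOn (fun x => η x * F (v x)) K :=
    hη.1.continuous.continuousOn.mul (hF.continuous.comp_continuousOn hvK)
  have hlim1 : Tendsto (fun n => ∫ x, T⁻¹ * u x * χ n x ∂μ) atTop
      (𝓝 (∫ x, T⁻¹ * u x * (η x * F (v x)) ∂μ)) := by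
    obtain ⟨B, hB⟩ := hK.exists_bound_of_continuousOn hbd
    refine tendsto_integral_filter_of_dominated_convergence (fun x => ‖T⁻¹ * u x‖ * (B + 1))
      (Eventually.of_forall fun n => ?_) ?_ ?_ ?_
    · exact (huK.aestronglyMeasurable.const_mul _).mul
        (h1 n).1.continuous.aestronglyMeasurable
    · filter_upwards [Metric.tendstoUniformlyOn_iff.1 h4 1 one_pos] with n hn
      filter_upwards [ae_restrict_mem hK.measurableSet] with x hx
      rw [norm_mul]
      refine mul_le_mul_of_nonneg_left ?_ (norm_nonneg _)
      have := hn x trivial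
      rw [dist_eq_norm] at this
      have h6 := hB x hx
      have h7 := norm_sub_le (η x * F (v x)) (η x * F (v x) - χ n x)
      rw [_root_.sub_sub_cancel] at h7
      linarith
    · exact ((huK.const_mul T⁻¹).norm.mul_const (B + 1))
    · refine Eventually.of_forall fun x => ?_
      exact (h4.tendsto_at (Set.mem_univ x)).const_mul _
  have hχL : ∀ n i, MemLp (fun x => gradAt (χ n) x i) 2 μ := by
    intro n i
    have hc := (h1 n).gradAt_continuous i
    obtain ⟨B, hB⟩ := hK.exists_bound_of_continuousOn hc.continuousOn
    exact MemLp.of_bound hc.aestronglyMeasurable B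
      ((ae_restrict_mem hK.measurableSet).mono hB)
  have hi1 : ∀ n i, Integrable (fun x => gradAt (χ n) x i * flux W Du x i) μ := fun n i =>
    (hχL n i).integrable_mul (hJ i)
  have hi2 : ∀ i, Integrable (fun x => Φ x i * flux W Du x i) μ := fun i =>
    (hΦL i).integrable_mul (hJ i)
  have hlim2 : ∀ i, Tendsto (fun n => ∫ x, gradAt (χ n) x i * flux W Du x i ∂μ) atTop
      (𝓝 (∫ x, Φ x i * flux W Du x i ∂μ)) := by
    intro i
    refine tendsto_integral_of_L1 _ (hi2 i).aestronglyMeasurable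
      (Eventually.of_forall fun n => hi1 n i) ?_
    have hb : ∀ n, ∫⁻ x, ‖gradAt (χ n) x i * flux W Du x i - Φ x i * flux W Du x i‖ₑ ∂μ ≤
        eLpNorm (fun x => gradAt (χ n) x i - Φ x i) 2 μ * eLpNorm (fun x => flux W Du x i) 2 μ := by
      intro n
      rw [← eLpNorm_one_eq_lintegral_enorm]
      have := eLpNorm_smul_le_mul_eLpNorm (p := 2) (q := 2) (r := 1) (μ := μ)
        (hJ i).aestronglyMeasurable ((hχL n i).sub (hΦL i)).aestronglyMeasurable
      refine le_trans (le_of_eq ?_) this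
      congr 1
      ext x
      simp only [Pi.smul_apply', Pi.sub_apply, smul_eq_mul]
      ring
    refine tendsto_of_tendsto_of_tendsto_of_le_of_le tendsto_const_nhds ?_ (fun n => zero_le) hb
    simpa using ENNReal.Tendsto.mul_const (h5 i) (Or.inr (hJ i).2.ne)
  have hint1 : ∀ {f : E d → ℝ}, ContinuousOn f K → Integrable (fun x => T⁻¹ * u x * f x) μ :=
    fun hf => IntegrableOn.mul_continuousOn (huK.const_mul T⁻¹) hf hK
  have heq : ∀ n, ∫ x, T⁻¹ * u x * χ n x ∂μ + ∑ i, ∫ x, gradAt (χ n) x i * flux W Du x i ∂μ = 0 := by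
    intro n
    rw [← integral_finsetSum _ fun i _ => hi1 n i]
    rw [← integral_add (hint1 (h1 n).1.continuous.continuousOn)
      (integrable_finsetSum _ fun i _ => hi1 n i)]
    have e0 := hu.eqn (χ n) (h1 n)
    rw [h2 n p fun hc => hηp hc rfl] at e0
    rw [hμ, ← e0]
    refine setIntegral_eq_integral_of_forall_compl_eq_zero fun x hx => ?_
    simp [h2 n x hx, h3 n x _ hx]
  have hlim := (hlim1.add (tendsto_finsetSum Finset.univ fun i _ => hlim2 i)).congr heq
  have h0 := tendsto_nhds_unique hlim tendsto_const_nhds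
  rw [← integral_finsetSum _ fun i _ => hi2 i,
    ← integral_add (hint1 hbd) (integrable_finsetSum _ fun i _ => hi2 i)] at h0
  rw [← h0, hμ]
  rw [← setIntegral_eq_integral_of_forall_compl_eq_zero (s := K)]
  · congr 1
    ext x
    simp only [hΦ, dotProduct, Finset.mul_sum, add_mul, Finset.sum_add_distrib]
    have e1 : ∀ a b c e : ℝ, T⁻¹ * (a * b * c) + e = T⁻¹ * c * (a * b) + e := by intros; ring
    rw [e1]
    congr 2
    · exact Finset.sum_congr rfl fun i _ => by ring
    · exact Finset.sum_congr rfl fun i _ => by ring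
  · intro x hx
    simp [image_eq_zero_of_notMem_tsupport hx, dotProduct, gradAt_eq_zero hx]

lemma integrableOn_dot {d : ℕ} {K : Set (E d)} {v w : E d → Fin d → ℝ}
    (hv : ∀ i, MemLp (fun x => v x i) 2 (volume.restrict K))
    (hw : ∀ i, MemLp (fun x => w x i) 2 (volume.restrict K)) :
    IntegrableOn (fun x => v x ⬝ᵥ w x) K volume :=
  integrable_finsetSum _ fun i _ => (hv i).integrable_mul (hw i)

lemma gradAt_dot_le {d : ℕ} (χ : E d → ℝ) (x : E d) :
    gradAt χ x ⬝ᵥ gradAt χ x ≤ ‖fderiv ℝ χ x‖ ^ 2 := by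
  set w : E d := WithLp.toLp 2 (gradAt χ x) with hw
  have h1 : ‖w‖ ^ 2 = gradAt χ x ⬝ᵥ gradAt χ x := by
    rw [EuclideanSpace.norm_sq_eq]
    simp [dotProduct, hw, sq]
  have h2 : fderiv ℝ χ x w = ‖w‖ ^ 2 := by
    have : w = ∑ i, w i • EuclideanSpace.single i (1 : ℝ) := by
      ext j
      simp [Finset.sum_apply, Pi.single_apply]
    conv_lhs => rw [this]
    rw [map_sum, h1]
    simp [dotProduct, hw, gradAt]
  have h3 : ‖w‖ ^ 2 ≤ ‖fderiv ℝ χ x‖ * ‖w‖ := by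
    rw [← h2]
    exact (le_abs_self _).trans ((fderiv ℝ χ x).le_opNorm w)
  rw [← h1]
  by_cases h0 : ‖w‖ = 0
  · rw [h0]; nlinarith [sq_nonneg ‖fderiv ℝ χ x‖]
  · have h4 : 0 < ‖w‖ := lt_of_le_of_ne (norm_nonneg _) (Ne.symm h0)
    have h5 : ‖w‖ ≤ ‖fderiv ℝ χ x‖ := by nlinarith
    exact pow_le_pow_left₀ (norm_nonneg _) h5 2

lemma exists_lipschitz_smoothTransition : ∃ K : NNReal, LipschitzWith K Real.smoothTransition := by
  have hc : Continuous (deriv Real.smoothTransition) :=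
    (Real.smoothTransition.contDiff (n := 1)).continuous_deriv le_rfl
  obtain ⟨B, hB⟩ := (isCompact_Icc (a := (0 : ℝ)) (b := 1)).exists_bound_of_continuousOn
    hc.continuousOn
  refine ⟨B.toNNReal, lipschitzWith_of_nnnorm_deriv_le
    ((Real.smoothTransition.contDiff (n := 1)).differentiable one_ne_zero) fun x => ?_⟩
  rw [← NNReal.coe_le_coe, coe_nnnorm]
  by_cases hx : x ∈ Set.Icc (0 : ℝ) 1
  · exact (hB x hx).trans (Real.le_coe_toNNReal B)
  · have : deriv Real.smoothTransition x = 0 := by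
      rw [Set.mem_Icc, not_and_or, not_le, not_le] at hx
      rcases hx with hx | hx
      · refine IsLocalMin.deriv_eq_zero (Eventually.of_forall fun y => ?_)
        rw [Real.smoothTransition.zero_of_nonpos hx.le]
        exact Real.smoothTransition.nonneg y
      · refine IsLocalMax.deriv_eq_zero (Eventually.of_forall fun y => ?_)
        rw [Real.smoothTransition.one_of_one_le hx.le]
        exact Real.smoothTransition.le_one y
    rw [this, norm_zero]
    positivity

/-- A positive Lipschitz constant of `Real.smoothTransition`. -/
def cutK : ℝ := (exists_lipschitz_smoothTransition.choose : ℝ) + 1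

lemma cutK_pos : 0 < cutK := by unfold cutK; positivity

/-- A radial cutoff, equal to `1` on `closedBall p a` and to `0` off `ball p b`. -/
def cutoff {d : ℕ} (p : E d) (a b : ℝ) (x : E d) : ℝ :=
  Real.smoothTransition ((b - dist x p) / (b - a))

section cutoff

variable {d : ℕ} {p : E d} {a b : ℝ}

lemma cutoff_nonneg (x : E d) : 0 ≤ cutoff p a b x := Real.smoothTransition.nonneg _

lemma cutoff_le_one (x : E d) : cutoff p a b x ≤ 1 := Real.smoothTransition.le_one _

lemma cutoff_eq_one (hab : a < b) {x : E d} (hx : dist x p ≤ a) : cutoff p a b x = 1 := by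
  refine Real.smoothTransition.one_of_one_le ?_
  rw [le_div_iff₀ (by linarith)]
  linarith

lemma cutoff_eq_zero (hab : a < b) {x : E d} (hx : b ≤ dist x p) : cutoff p a b x = 0 := by
  refine Real.smoothTransition.zero_of_nonpos ?_
  exact div_nonpos_of_nonpos_of_nonneg (by linarith) (by linarith)

lemma cutoff_tsupport (hab : a < b) : tsupport (cutoff p a b) ⊆ closedBall p b := by
  refine closure_minimal (fun x hx => ?_) isClosed_closedBall
  rw [mem_closedBall]
  by_contra hc
  exact hx (cutoff_eq_zero hab (not_le.1 hc).le)

lemma cutoff_isTestFun (ha : 0 < a) (hab : a < b) : IsTestFun d (cutoff p a b) := by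
  refine ⟨contDiff_iff_contDiffAt.2 fun x => ?_,
    (isCompact_closedBall p b).of_isClosed_subset isClosed_closure (cutoff_tsupport hab)⟩
  by_cases hx : x = p
  · have : cutoff p a b =ᶠ[𝓝 x] fun _ => 1 := by
      filter_upwards [ball_mem_nhds x ha] with y hy
      exact cutoff_eq_one hab (by rw [← hx]; exact (mem_ball.1 hy).le)
    exact contDiffAt_const.congr_of_eventuallyEq this
  · unfold cutoff
    refine Real.smoothTransition.contDiffAt.comp x ?_
    refine ContDiffAt.div_const (contDiffAt_const.sub ?_) _
    exact contDiffAt_id.dist ℝ contDiffAt_const hx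

lemma cutoff_gradAt_eq_zero (hab : a < b) {x : E d} (hx : dist x p ≤ a ∨ b ≤ dist x p) :
    gradAt (cutoff p a b) x = 0 := by
  have : fderiv ℝ (cutoff p a b) x = 0 := by
    rcases hx with hx | hx
    · refine IsLocalMax.fderiv_eq_zero (Eventually.of_forall fun y => ?_)
      rw [cutoff_eq_one hab hx]
      exact cutoff_le_one y
    · refine IsLocalMin.fderiv_eq_zero (Eventually.of_forall fun y => ?_)
      rw [cutoff_eq_zero hab hx]
      exact cutoff_nonneg y
  ext i
  simp [gradAt, this]

lemma cutoff_gradAt_le (hab : a < b) (x : E d) :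
    gradAt (cutoff p a b) x ⬝ᵥ gradAt (cutoff p a b) x ≤ (cutK / (b - a)) ^ 2 := by
  refine (gradAt_dot_le _ x).trans (pow_le_pow_left₀ (norm_nonneg _) ?_ 2)
  have hba : 0 < b - a := by linarith
  set K := exists_lipschitz_smoothTransition.choose with hK
  have h1 : LipschitzWith K Real.smoothTransition := exists_lipschitz_smoothTransition.choose_spec
  have h2 : LipschitzWith (Real.toNNReal (b - a)⁻¹) fun x : E d => (b - dist x p) / (b - a) := by
    refine LipschitzWith.of_dist_le_mul fun x y => ?_
    rw [Real.coe_toNNReal _ (by positivity), Real.dist_eq, ← sub_div, abs_div, abs_of_pos hba,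
      div_eq_inv_mul]
    refine mul_le_mul_of_nonneg_left ?_ (by positivity)
    have := abs_dist_sub_le y x p
    rw [dist_comm y x] at this
    refine le_trans (le_of_eq ?_) this
    congr 1
    ring
  have h3 := norm_fderiv_le_of_lipschitz ℝ (h1.comp h2) (x₀ := x)
  refine h3.trans ?_
  rw [NNReal.coe_mul, Real.coe_toNNReal _ (by positivity), div_eq_mul_inv]
  refine mul_le_mul_of_nonneg_right ?_ (by positivity)
  unfold cutK
  linarith

end cutoff

lemma abs_dot_flux_le {d : ℕ} {lam : ℝ} (W : CoeffField d lam) (Du : E d → Fin d → ℝ)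
    (ξ : Fin d → ℝ) (x : E d) : (ξ ⬝ᵥ flux W Du x) ^ 2 ≤ (ξ ⬝ᵥ ξ) * (Du x ⬝ᵥ Du x) :=
  (dot_sq_le _ _).trans (mul_le_mul_of_nonneg_left ((W.elliptic x).1 (Du x)) (dot_self_nonneg _))

lemma IsTestFun.gradAt_sq {d : ℕ} {η : E d → ℝ} (hη : IsTestFun d η) (x : E d) :
    gradAt (fun y => η y ^ 2) x = (2 * η x) • gradAt η x := by
  ext i
  have h := (((hη.1.differentiable (by simp)) x).hasFDerivAt.pow 2).fderiv
  have h' : fderiv ℝ (fun y => η y ^ 2) x = _ := h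
  simp [gradAt, h']

lemma IsTestFun.sq {d : ℕ} {η : E d → ℝ} (hη : IsTestFun d η) :
    IsTestFun d (fun y => η y ^ 2) := by
  refine ⟨hη.1.pow 2, ?_⟩
  have : (fun y => η y ^ 2) = fun y => η y * η y := by ext; ring
  rw [this]
  exact hη.2.mul_right

lemma tsupport_sq {d : ℕ} (η : E d → ℝ) : tsupport (fun y => η y ^ 2) ⊆ tsupport η := by
  have : (fun y => η y ^ 2) = fun y => η y * η y := by ext; ring
  rw [this]
  exact tsupport_mul_subset_left

lemma IsTestFun.gradDot_continuous {d : ℕ} {η : E d → ℝ} (hη : IsTestFun d η) :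
    Continuous fun x => gradAt η x ⬝ᵥ gradAt η x :=
  continuous_finsetSum _ fun i _ => (hη.gradAt_continuous i).mul (hη.gradAt_continuous i)

section Cacc

variable {d : ℕ} {lam : ℝ} {W : CoeffField d lam} {T : ℝ} {p : E d} {u : E d → ℝ}
  {Du : E d → Fin d → ℝ}

lemma IsFund.integrable_sq_mul_dot (hu : IsFund W T p u Du) {η : E d → ℝ}
    (hη : IsTestFun d η) (hηp : tsupport η ⊆ {p}ᶜ) :
    Integrable (fun x => η x ^ 2 * (Du x ⬝ᵥ Du x)) :=
  integrable_mul_of_zero_off hη.2 (hη.1.continuous.continuousOn.pow 2)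
    (integrableOn_dot (hu.h1.memLp _ hηp hη.2) (hu.h1.memLp _ hηp hη.2))
    fun x hx => by simp [image_eq_zero_of_notMem_tsupport hx]

lemma IsFund.integrable_of_continuousOn (hu : IsFund W T p u Du) {η : E d → ℝ}
    (hη : IsTestFun d η) (hηp : tsupport η ⊆ {p}ᶜ) {f : E d → ℝ} {F : ℝ → ℝ}
    (hF : Continuous F) (hf : Continuous f) (h0 : ∀ x, x ∉ tsupport η → f x = 0) :
    Integrable (fun x => f x * F (u x)) := by
  have hone : IntegrableOn (fun _ : E d => (1 : ℝ)) (tsupport η) volume :=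
    integrableOn_const hη.2.measure_lt_top.ne
  have := integrable_mul_of_zero_off hη.2 (hf.continuousOn.mul
    (hF.comp_continuousOn (hu.h1.cont.mono hηp))) hone fun x hx => by simp [h0 x hx]
  simpa using this

/-- Caccioppoli's inequality away from the pole. -/
lemma IsFund.caccioppoli (hu : IsFund W T p u Du) (hlam : 0 < lam) (hT : 0 < T) {η : E d → ℝ}
    (hη : IsTestFun d η) (hηp : tsupport η ⊆ {p}ᶜ) (c : ℝ) :
    lam / 2 * (∫ x, η x ^ 2 * (Du x ⬝ᵥ Du x)) + T⁻¹ / 2 * (∫ x, η x ^ 2 * u x ^ 2) ≤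
      T⁻¹ * c ^ 2 / 2 * (∫ x, η x ^ 2) +
        2 / lam * ∫ x, (u x - c) ^ 2 * (gradAt η x ⬝ᵥ gradAt η x) := by
  have hK : IsCompact (tsupport η) := hη.2
  have h0 : ∀ x, x ∉ tsupport η → η x = 0 := fun x => image_eq_zero_of_notMem_tsupport
  have huK : ContinuousOn u (tsupport η) := hu.h1.cont.mono hηp
  have hηc : ContinuousOn η (tsupport η) := hη.1.continuous.continuousOn
  have hDu := hu.h1.memLp _ hηp hK
  have hJ := flux_memLp W hDu
  have hone : IntegrableOn (fun _ : E d => (1 : ℝ)) (tsupport η) volume :=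
    integrableOn_const hK.measure_lt_top.ne
  have key := hu.tested hu.h1 hη.sq ((tsupport_sq η).trans hηp) ((tsupport_sq η).trans hηp)
    (F := fun s => s - c) (contDiff_id.sub contDiff_const)
  simp only [hη.gradAt_sq, deriv_sub_const, deriv_id'', smul_dotProduct, smul_eq_mul] at key
  have i1 := hu.integrable_sq_mul_dot hη hηp
  have i2 : Integrable (fun x => η x ^ 2 * u x ^ 2) :=
    hu.integrable_of_continuousOn hη hηp (continuous_pow 2) (hη.1.continuous.pow 2)
      fun x hx => by simp [h0 x hx]
  have i3 : Integrable (fun x => η x ^ 2) := by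
    simpa using hu.integrable_of_continuousOn hη hηp (continuous_const (y := (1 : ℝ)))
      (hη.1.continuous.pow 2) fun x hx => by simp [h0 x hx]
  have i4 : Integrable (fun x => (u x - c) ^ 2 * (gradAt η x ⬝ᵥ gradAt η x)) := by
    have := hu.integrable_of_continuousOn hη hηp
      (F := fun s => (s - c) ^ 2) (by fun_prop) hη.gradDot_continuous
      fun x hx => by simp [dotProduct, gradAt_eq_zero hx]
    simpa [mul_comm] using this
  have i5 : Integrable (fun x => η x ^ 2 * (u x - c) * u x) :=  by
    have := integrable_mul_of_zero_off hK (((hηc.pow 2).mul (huK.sub (continuousOn_const (c := c)))).mul huK)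
      hone fun x hx => by simp [h0 x hx]
    simpa using this
  have i6 : Integrable (fun x => (u x - c) * (2 * η x * (gradAt η x ⬝ᵥ flux W Du x))) := by
    have hgJ : IntegrableOn (fun x => gradAt η x ⬝ᵥ flux W Du x) (tsupport η) volume := by
      refine integrable_finsetSum _ fun i _ => ?_
      have hJi : IntegrableOn (fun x => flux W Du x i) (tsupport η) volume := by
        have : IsFiniteMeasure (volume.restrict (tsupport η)) :=
          ⟨by simpa using hK.measure_lt_top⟩
        exact (hJ i).integrable (by norm_num)
      exact hJi.continuousOn_mul (hη.gradAt_continuous i).continuousOn hK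
    have := integrable_mul_of_zero_off hK ((huK.sub (continuousOn_const (c := c))).mul
      (hηc.const_mul 2)) hgJ fun x hx => by simp [h0 x hx]
    refine this.congr (Eventually.of_forall fun x => ?_)
    simp only [Pi.mul_apply, Pi.sub_apply]
    ring
  have i7 : Integrable (fun x => η x ^ 2 * 1 * (Du x ⬝ᵥ flux W Du x)) := by
    have := integrable_mul_of_zero_off hK (hηc.pow 2) (integrableOn_dot hDu hJ)
      fun x hx => by simp [h0 x hx]
    simpa using this
  have i8 : Integrable (fun x => T⁻¹ * (η x ^ 2 * (u x - c) * u x) +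
      ((u x - c) * (2 * η x * (gradAt η x ⬝ᵥ flux W Du x)) +
        η x ^ 2 * 1 * (Du x ⬝ᵥ flux W Du x))) := (i5.const_mul _).add (i6.add i7)
  have hpt : ∀ x, lam / 2 * (η x ^ 2 * (Du x ⬝ᵥ Du x)) + T⁻¹ / 2 * (η x ^ 2 * u x ^ 2) ≤
      (T⁻¹ * (η x ^ 2 * (u x - c) * u x) + ((u x - c) * (2 * η x * (gradAt η x ⬝ᵥ flux W Du x)) +
        η x ^ 2 * 1 * (Du x ⬝ᵥ flux W Du x))) + (T⁻¹ * c ^ 2 / 2 * η x ^ 2 +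
        2 / lam * ((u x - c) ^ 2 * (gradAt η x ⬝ᵥ gradAt η x))) := by
    intro x
    have e1 : lam * (Du x ⬝ᵥ Du x) ≤ Du x ⬝ᵥ flux W Du x := (W.elliptic x).2 (Du x)
    have e2 := abs_dot_flux_le W Du (gradAt η x) x
    have e3 : 0 ≤ T⁻¹ * η x ^ 2 * (u x - c) ^ 2 := by positivity
    have hD := dot_self_nonneg (Du x)
    have hG := dot_self_nonneg (gradAt η x)
    set D := Du x ⬝ᵥ Du x
    set G := gradAt η x ⬝ᵥ gradAt η x
    set P := gradAt η x ⬝ᵥ flux W Du x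
    set w := u x - c
    have e4 : -(w * (2 * η x * P)) ≤ lam / 2 * (η x ^ 2 * D) + 2 / lam * (w ^ 2 * G) := by
      have h1 : (2 * (η x * w * P)) ^ 2 ≤
          (lam / 2 * (η x ^ 2 * D) + 2 / lam * (w ^ 2 * G)) ^ 2 := by
        have h2 : (η x * w) ^ 2 * P ^ 2 ≤ (η x * w) ^ 2 * (G * D) :=
          mul_le_mul_of_nonneg_left e2 (by positivity)
        have h3 : (lam / 2 * (η x ^ 2 * D)) * (2 / lam * (w ^ 2 * G)) =
            (η x * w) ^ 2 * (G * D) := by field_simp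
        nlinarith [sq_nonneg (lam / 2 * (η x ^ 2 * D) - 2 / lam * (w ^ 2 * G))]
      have h4 : 0 ≤ lam / 2 * (η x ^ 2 * D) + 2 / lam * (w ^ 2 * G) := by positivity
      have := abs_le_of_sq_le_sq h1 h4
      have := (abs_le.1 this).1
      linarith
    have e5 : η x ^ 2 * (lam * D) ≤ η x ^ 2 * (Du x ⬝ᵥ flux W Du x) :=
      mul_le_mul_of_nonneg_left e1 (sq_nonneg _)
    have hw : c = u x - w := by simp [w]
    have e6 : T⁻¹ * (η x ^ 2 * w * u x) + T⁻¹ * c ^ 2 / 2 * η x ^ 2 - T⁻¹ / 2 * (η x ^ 2 * u x ^ 2)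
        = T⁻¹ * η x ^ 2 * w ^ 2 / 2 := by
      rw [hw]; ring
    linarith
  have i9 : Integrable (fun x => T⁻¹ * c ^ 2 / 2 * η x ^ 2 +
      2 / lam * ((u x - c) ^ 2 * (gradAt η x ⬝ᵥ gradAt η x))) :=
    (i3.const_mul _).add (i4.const_mul _)
  have hinteg := integral_mono ((i1.const_mul (lam / 2)).add (i2.const_mul (T⁻¹ / 2)))
    (i8.add i9) hpt
  simp only [Pi.add_apply] at hinteg
  rw [integral_add (i1.const_mul _) (i2.const_mul _), integral_add i8 i9,
    integral_add (i3.const_mul _) (i4.const_mul _), key, zero_add, integral_const_mul,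
    integral_const_mul, integral_const_mul, integral_const_mul] at hinteg
  exact hinteg

end Cacc

/-- The open spherical shell `a < |x - p| < b`. -/
def shell {d : ℕ} (p : E d) (a b : ℝ) : Set (E d) := {x | a < dist x p ∧ dist x p < b}

lemma measurableSet_shell {d : ℕ} (p : E d) (a b : ℝ) : MeasurableSet (shell p a b) :=
  ((isOpen_lt continuous_const (continuous_id.dist continuous_const)).inter
    (isOpen_lt (continuous_id.dist continuous_const) continuous_const)).measurableSet

/-- The Dirichlet energy on `S`. -/
def DE {d : ℕ} (Du : E d → Fin d → ℝ) (S : Set (E d)) : ℝ≥0∞ :=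
  ∫⁻ x in S, ENNReal.ofReal (Du x ⬝ᵥ Du x)

/-- The squared `L²` norm on `S`. -/
def UE {d : ℕ} (u : E d → ℝ) (S : Set (E d)) : ℝ≥0∞ :=
  ∫⁻ x in S, ENNReal.ofReal (u x ^ 2)

lemma DE_mono {d : ℕ} {Du : E d → Fin d → ℝ} {S S' : Set (E d)} (h : S ⊆ S') :
    DE Du S ≤ DE Du S' := lintegral_mono_set h

lemma UE_mono {d : ℕ} {u : E d → ℝ} {S S' : Set (E d)} (h : S ⊆ S') :
    UE u S ≤ UE u S' := lintegral_mono_set h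

section Cacc

variable {d : ℕ} {lam : ℝ} {W : CoeffField d lam} {T : ℝ} {p : E d} {u : E d → ℝ}
  {Du : E d → Fin d → ℝ}

lemma IsFund.aemeasurable (hu : IsFund W T p u Du) : AEMeasurable u volume :=
  hu.h1.locInt.aestronglyMeasurable.aemeasurable

lemma IsFund.cacc_lint (hu : IsFund W T p u Du) (hlam : 0 < lam) (hT : 0 < T) {η : E d → ℝ}
    (hη : IsTestFun d η) (hηp : tsupport η ⊆ {p}ᶜ) (c : ℝ) :
    ENNReal.ofReal (lam / 2) * (∫⁻ x, ENNReal.ofReal (η x ^ 2 * (Du x ⬝ᵥ Du x))) +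
      ENNReal.ofReal (T⁻¹ / 2) * (∫⁻ x, ENNReal.ofReal (η x ^ 2 * u x ^ 2)) ≤
      ENNReal.ofReal (T⁻¹ * c ^ 2 / 2) * (∫⁻ x, ENNReal.ofReal (η x ^ 2)) +
      ENNReal.ofReal (2 / lam) *
        ∫⁻ x, ENNReal.ofReal ((u x - c) ^ 2 * (gradAt η x ⬝ᵥ gradAt η x)) := by
  have h0 : ∀ x, x ∉ tsupport η → η x = 0 := fun x => image_eq_zero_of_notMem_tsupport
  have i1 := hu.integrable_sq_mul_dot hη hηp
  have i2 : Integrable (fun x => η x ^ 2 * u x ^ 2) :=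
    hu.integrable_of_continuousOn hη hηp (continuous_pow 2) (hη.1.continuous.pow 2)
      fun x hx => by simp [h0 x hx]
  have i3 : Integrable (fun x => η x ^ 2) := by
    simpa using hu.integrable_of_continuousOn hη hηp (continuous_const (y := (1 : ℝ)))
      (hη.1.continuous.pow 2) fun x hx => by simp [h0 x hx]
  have i4 : Integrable (fun x => (u x - c) ^ 2 * (gradAt η x ⬝ᵥ gradAt η x)) := by
    have := hu.integrable_of_continuousOn hη hηp
      (F := fun s => (s - c) ^ 2) (by fun_prop) hη.gradDot_continuous
      fun x hx => by simp [dotProduct, gradAt_eq_zero hx]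
    simpa [mul_comm] using this
  have n1 : ∀ x, 0 ≤ η x ^ 2 * (Du x ⬝ᵥ Du x) := fun x =>
    mul_nonneg (sq_nonneg _) (dot_self_nonneg _)
  have n2 : ∀ x, 0 ≤ η x ^ 2 * u x ^ 2 := fun x => by positivity
  have n3 : ∀ x, 0 ≤ η x ^ 2 := fun x => by positivity
  have n4 : ∀ x, 0 ≤ (u x - c) ^ 2 * (gradAt η x ⬝ᵥ gradAt η x) := fun x =>
    mul_nonneg (sq_nonneg _) (dot_self_nonneg _)
  have m1 := integral_nonneg_of_ae (μ := volume) (Eventually.of_forall n1)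
  have m2 := integral_nonneg_of_ae (μ := volume) (Eventually.of_forall n2)
  have m3 := integral_nonneg_of_ae (μ := volume) (Eventually.of_forall n3)
  have m4 := integral_nonneg_of_ae (μ := volume) (Eventually.of_forall n4)
  rw [← ofReal_integral_eq_lintegral_ofReal i1 (Eventually.of_forall n1),
    ← ofReal_integral_eq_lintegral_ofReal i2 (Eventually.of_forall n2),
    ← ofReal_integral_eq_lintegral_ofReal i3 (Eventually.of_forall n3),
    ← ofReal_integral_eq_lintegral_ofReal i4 (Eventually.of_forall n4),
    ← ENNReal.ofReal_mul (by positivity), ← ENNReal.ofReal_mul (by positivity),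
    ← ENNReal.ofReal_mul (by positivity), ← ENNReal.ofReal_mul (by positivity),
    ← ENNReal.ofReal_add (by positivity) (by positivity),
    ← ENNReal.ofReal_add (by positivity) (by positivity)]
  exact ENNReal.ofReal_le_ofReal (hu.caccioppoli hlam hT hη hηp c)

lemma DE_le_of_one {η : E d → ℝ} {S : Set (E d)} (hS : MeasurableSet S) (h : ∀ x ∈ S, η x = 1) :
    DE Du S ≤ ∫⁻ x, ENNReal.ofReal (η x ^ 2 * (Du x ⬝ᵥ Du x)) := by
  refine le_trans (le_of_eq ?_) (setLIntegral_le_lintegral S _)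
  refine setLIntegral_congr_fun hS fun x hx => ?_
  simp [h x hx]

lemma UE_le_of_one {η : E d → ℝ} {S : Set (E d)} (hS : MeasurableSet S) (h : ∀ x ∈ S, η x = 1) :
    UE u S ≤ ∫⁻ x, ENNReal.ofReal (η x ^ 2 * u x ^ 2) := by
  refine le_trans (le_of_eq ?_) (setLIntegral_le_lintegral S _)
  refine setLIntegral_congr_fun hS fun x hx => ?_
  simp [h x hx]

/-- Caccioppoli's inequality on balls away from the pole. -/
lemma IsFund.cacc_ball (hu : IsFund W T p u Du) (hlam : 0 < lam) (hT : 0 < T) {z : E d} {a b : ℝ}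
    (ha : 0 < a) (hab : a < b) (hb : b < dist z p) (c : ℝ) :
    ENNReal.ofReal (lam / 2) * DE Du (closedBall z a) +
      ENNReal.ofReal (T⁻¹ / 2) * UE u (closedBall z a) ≤
      ENNReal.ofReal (T⁻¹ * c ^ 2 / 2) * volume (closedBall z b) +
      ENNReal.ofReal (2 / lam * (cutK / (b - a)) ^ 2) * UE (fun x => u x - c) (shell z a b) := by
  have hp : tsupport (cutoff z a b) ⊆ {p}ᶜ := by
    refine (cutoff_tsupport hab).trans fun x hx => ?_
    rintro rfl
    rw [mem_closedBall, dist_comm] at hx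
    linarith
  have hm : MeasurableSet (closedBall z a) := isClosed_closedBall.measurableSet
  have h1 : ∀ x ∈ closedBall z a, cutoff z a b x = 1 := fun x hx => cutoff_eq_one hab hx
  refine (add_le_add (mul_le_mul_right (DE_le_of_one hm h1) _)
    (mul_le_mul_right (UE_le_of_one hm h1) _)).trans
    ((hu.cacc_lint hlam hT (cutoff_isTestFun ha hab) hp c).trans (add_le_add
      (mul_le_mul_right ?_ _) ?_))
  · rw [← setLIntegral_one, ← lintegral_indicator isClosed_closedBall.measurableSet]
    refine lintegral_mono fun x => ?_
    by_cases hx : x ∈ closedBall z b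
    · rw [Set.indicator_of_mem hx, ← ENNReal.ofReal_one]
      exact ENNReal.ofReal_le_ofReal (pow_le_one₀ (cutoff_nonneg x) (cutoff_le_one x))
    · rw [cutoff_eq_zero hab (not_le.1 hx).le]
      simp
  · rw [ENNReal.ofReal_mul (by positivity), mul_assoc]
    refine mul_le_mul_right ?_ _
    unfold UE
    rw [← lintegral_const_mul' _ _ ENNReal.ofReal_ne_top,
      ← lintegral_indicator (measurableSet_shell z a b)]
    refine lintegral_mono fun x => ?_
    by_cases hx : x ∈ shell z a b
    · rw [Set.indicator_of_mem hx, ← ENNReal.ofReal_mul (by positivity), mul_comm]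
      exact ENNReal.ofReal_le_ofReal (mul_le_mul_of_nonneg_right (cutoff_gradAt_le hab x)
        (sq_nonneg _))
    · rw [cutoff_gradAt_eq_zero hab]
      · simp
      · simp only [shell, Set.mem_ofPred_eq, not_and_or, not_lt] at hx
        exact hx

/-- A two-sided radial cutoff. -/
def annCut (p : E d) (a b c e : ℝ) (x : E d) : ℝ := cutoff p c e x - cutoff p a b x

section annCut

variable {a b c e : ℝ}

lemma annCut_nonneg (hab : a < b) (hbc : b ≤ c) (hce : c < e) (x : E d) :
    0 ≤ annCut p a b c e x := by
  unfold annCut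
  rcases le_or_gt b (dist x p) with hx | hx
  · rw [cutoff_eq_zero hab hx, sub_zero]; exact cutoff_nonneg x
  · rw [cutoff_eq_one hce (by linarith)]; linarith [cutoff_le_one (p := p) (a := a) (b := b) x]

lemma annCut_le_one (x : E d) : annCut p a b c e x ≤ 1 := by
  unfold annCut
  linarith [cutoff_le_one (p := p) (a := c) (b := e) x, cutoff_nonneg (p := p) (a := a) (b := b) x]

lemma annCut_eq_one (hab : a < b) (hce : c < e) {x : E d} (h1 : b ≤ dist x p)
    (h2 : dist x p ≤ c) : annCut p a b c e x = 1 := by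
  unfold annCut
  rw [cutoff_eq_zero hab h1, cutoff_eq_one hce h2, sub_zero]

lemma annCut_eq_zero (hab : a < b) (hbc : b ≤ c) (hce : c < e) {x : E d}
    (h : dist x p ≤ a ∨ e ≤ dist x p) : annCut p a b c e x = 0 := by
  unfold annCut
  rcases h with h | h
  · rw [cutoff_eq_one hab h, cutoff_eq_one hce (by linarith), sub_self]
  · rw [cutoff_eq_zero hab (by linarith), cutoff_eq_zero hce h, sub_self]

lemma annCut_isTestFun (ha : 0 < a) (hab : a < b) (hbc : b ≤ c) (hce : c < e) :
    IsTestFun d (annCut p a b c e) :=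
  ⟨(cutoff_isTestFun (by linarith) hce).1.sub (cutoff_isTestFun ha hab).1,
    (cutoff_isTestFun (by linarith) hce).2.sub (cutoff_isTestFun ha hab).2⟩

lemma annCut_tsupport (hab : a < b) (hbc : b ≤ c) (hce : c < e) :
    tsupport (annCut p a b c e) ⊆ {x | a ≤ dist x p ∧ dist x p ≤ e} := by
  refine closure_minimal (fun x hx => ?_) ?_
  · by_contra hc
    refine hx (annCut_eq_zero hab hbc hce ?_)
    simp only [Set.mem_ofPred_eq, not_and_or, not_le] at hc
    exact hc.imp le_of_lt le_of_lt
  · exact (isClosed_le continuous_const (continuous_id.dist continuous_const)).inter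
      (isClosed_le (continuous_id.dist continuous_const) continuous_const)

lemma annCut_gradAt (ha : 0 < a) (hab : a < b) (hbc : b ≤ c) (hce : c < e) (x : E d) :
    gradAt (annCut p a b c e) x = gradAt (cutoff p c e) x - gradAt (cutoff p a b) x := by
  ext i
  have h1 := (cutoff_isTestFun (p := p) ha hab).1.differentiable (by simp) x
  have h2 := (cutoff_isTestFun (p := p) (a := c) (by linarith) hce).1.differentiable (by simp) x
  have h3 : fderiv ℝ (annCut p a b c e) x = _ := fderiv_sub h2 h1
  simp [gradAt, h3]

lemma annCut_gradDot (ha : 0 < a) (hab : a < b) (hbc : b ≤ c) (hce : c < e) (x : E d) :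
    gradAt (annCut p a b c e) x ⬝ᵥ gradAt (annCut p a b c e) x ≤
      (shell p a b).indicator (fun _ => (cutK / (b - a)) ^ 2) x +
      (shell p c e).indicator (fun _ => (cutK / (e - c)) ^ 2) x := by
  rw [annCut_gradAt ha hab hbc hce]
  have key : ∀ {a b : ℝ}, a < b → gradAt (cutoff p a b) x ⬝ᵥ gradAt (cutoff p a b) x ≤
      (shell p a b).indicator (fun _ => (cutK / (b - a)) ^ 2) x := by
    intro a b hab
    by_cases hx : x ∈ shell p a b
    · rw [Set.indicator_of_mem hx]; exact cutoff_gradAt_le hab x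
    · rw [Set.indicator_of_notMem hx, cutoff_gradAt_eq_zero hab]
      · simp
      · simp only [shell, Set.mem_ofPred_eq, not_and_or, not_lt] at hx
        exact hx
  rcases le_or_gt b (dist x p) with hx | hx
  · rw [cutoff_gradAt_eq_zero hab (Or.inr hx), sub_zero]
    have h1 : x ∉ shell p a b := fun h => absurd h.2 (not_lt.2 hx)
    rw [Set.indicator_of_notMem h1, zero_add]
    exact key hce
  · rw [cutoff_gradAt_eq_zero hce (Or.inl (by linarith)), zero_sub, neg_dotProduct_neg]
    have h1 : x ∉ shell p c e := fun h => absurd h.1 (not_lt.2 (by linarith))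
    rw [Set.indicator_of_notMem h1, add_zero]
    exact key hab

end annCut

/-- Caccioppoli's inequality on shells around the pole. -/
lemma IsFund.cacc_shell (hu : IsFund W T p u Du) (hlam : 0 < lam) (hT : 0 < T) {a b c e : ℝ}
    (ha : 0 < a) (hab : a < b) (hbc : b ≤ c) (hce : c < e) :
    ENNReal.ofReal (lam / 2) * DE Du (shell p b c) +
      ENNReal.ofReal (T⁻¹ / 2) * UE u (shell p b c) ≤
      ENNReal.ofReal (2 / lam * (cutK / (b - a)) ^ 2) * UE u (shell p a b) +
      ENNReal.ofReal (2 / lam * (cutK / (e - c)) ^ 2) * UE u (shell p c e) := by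
  have hp : tsupport (annCut p a b c e) ⊆ {p}ᶜ := by
    refine (annCut_tsupport hab hbc hce).trans fun x hx => ?_
    rintro rfl
    have := hx.1
    rw [dist_self] at this
    linarith
  have h1 : ∀ x ∈ shell p b c, annCut p a b c e x = 1 := fun x hx =>
    annCut_eq_one hab hce hx.1.le hx.2.le
  have hm := measurableSet_shell p b c
  refine (add_le_add (mul_le_mul_right (DE_le_of_one hm h1) _)
    (mul_le_mul_right (UE_le_of_one hm h1) _)).trans
    ((hu.cacc_lint hlam hT (annCut_isTestFun ha hab hbc hce) hp 0).trans ?_)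
  simp only [ne_eq, OfNat.ofNat_ne_zero, not_false_eq_true, zero_pow, mul_zero, zero_div,
    ENNReal.ofReal_zero, zero_mul, zero_add, sub_zero]
  rw [ENNReal.ofReal_mul (by positivity), ENNReal.ofReal_mul (by positivity), mul_assoc, mul_assoc,
    ← mul_add]
  refine mul_le_mul_right ?_ _
  have hi : ∀ a b : ℝ, ENNReal.ofReal ((cutK / (b - a)) ^ 2) * UE u (shell p a b) =
      ∫⁻ x, (shell p a b).indicator
        (fun x => ENNReal.ofReal ((cutK / (b - a)) ^ 2) * ENNReal.ofReal (u x ^ 2)) x := by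
    intro a b
    rw [lintegral_indicator (measurableSet_shell p a b), lintegral_const_mul' _ _
      ENNReal.ofReal_ne_top, UE]
  rw [hi, hi, ← lintegral_add_left' (((hu.aemeasurable.pow_const 2).ennreal_ofReal.const_mul
    _).indicator (measurableSet_shell p a b))]
  refine lintegral_mono fun x => ?_
  refine (ENNReal.ofReal_le_ofReal (mul_le_mul_of_nonneg_left
    (annCut_gradDot ha hab hbc hce x) (sq_nonneg _))).trans ?_
  rw [mul_add]
  refine ENNReal.ofReal_add_le.trans (add_le_add (le_of_eq ?_) (le_of_eq ?_))
  · by_cases hx : x ∈ shell p a b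
    · rw [Set.indicator_of_mem hx, Set.indicator_of_mem hx, mul_comm,
        ENNReal.ofReal_mul (by positivity)]
    · simp [Set.indicator_of_notMem hx]
  · by_cases hx : x ∈ shell p c e
    · rw [Set.indicator_of_mem hx, Set.indicator_of_mem hx, mul_comm,
        ENNReal.ofReal_mul (by positivity)]
    · simp [Set.indicator_of_notMem hx]

end Cacc

lemma integrable_exp_neg_dist {d : ℕ} {k : ℝ} (hk : 0 < k) (p : E d) :
    Integrable (fun x : E d => Real.exp (-(k * dist x p))) := by
  have h0 : Integrable (fun x : E d => Real.exp (-(k * ‖x‖))) := by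
    have h1 : Integrable (fun x : E d => (1 + ‖x‖) ^ (-((d + 1 : ℕ) : ℝ))) := by
      refine integrable_one_add_norm ?_
      rw [finrank_euclideanSpace_fin]
      push_cast
      linarith
    refine (h1.const_mul (Real.exp k * (d + 1).factorial / k ^ (d + 1))).mono' (by fun_prop)
      (Eventually.of_forall fun x => ?_)
    rw [Real.norm_of_nonneg (Real.exp_pos _).le]
    have h2 := Real.pow_div_factorial_le_exp (x := k * (1 + ‖x‖)) (by positivity) (d + 1)
    have h3 : Real.exp (k * (1 + ‖x‖)) = Real.exp k * Real.exp (k * ‖x‖) := by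
      rw [← Real.exp_add]; ring_nf
    rw [h3, mul_pow, div_le_iff₀ (by positivity)] at h2
    rw [Real.rpow_neg (by positivity), Real.rpow_natCast, Real.exp_neg, ← div_eq_mul_inv,
      div_div, inv_eq_one_div, div_le_div_iff₀ (by positivity) (by positivity), one_mul]
    linarith
  simpa [dist_eq_norm] using h0.comp_sub_right p

/-- The exterior of a ball. -/
def ext {d : ℕ} (p : E d) (b : ℝ) : Set (E d) := {x | b < dist x p}

lemma measurableSet_ext {d : ℕ} (p : E d) (b : ℝ) : MeasurableSet (ext p b) :=
  (isOpen_lt continuous_const (continuous_id.dist continuous_const)).measurableSet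

lemma ext_eq_iUnion {d : ℕ} (p : E d) (b : ℝ) : ext p b = ⋃ n : ℕ, shell p b n := by
  ext x
  simp only [ext, shell, Set.mem_iUnion, Set.mem_ofPred_eq]
  constructor
  · intro h
    obtain ⟨n, hn⟩ := exists_nat_gt (dist x p)
    exact ⟨n, h, hn⟩
  · rintro ⟨n, h, -⟩
    exact h

lemma directed_shell {d : ℕ} (p : E d) (b : ℝ) : Directed (· ⊆ ·) fun n : ℕ => shell p b n := by
  refine Monotone.directed_le (f := fun n : ℕ => shell p b n) fun m n hmn x hx => ⟨hx.1, hx.2.trans_le ?_⟩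
  exact_mod_cast hmn

section Ext

variable {d : ℕ} {lam : ℝ} {W : CoeffField d lam} {T : ℝ} {p : E d} {u : E d → ℝ}
  {Du : E d → Fin d → ℝ}

lemma IsFund.exists_ext_bound (hu : IsFund W T p u Du) (hd : 2 ≤ d) (hT : 0 < T) {a : ℝ}
    (ha : 0 < a) :
    ∃ B k : ℝ, 0 < B ∧ 0 < k ∧ ∀ x, a ≤ dist x p → u x ≤ B * Real.exp (-(k * dist x p)) := by
  obtain ⟨c, C, hc, hC, h, -⟩ := hu.bound
  have hsT : 0 < Real.sqrt T := Real.sqrt_pos.2 hT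
  set b0 : ℝ := if d = 2 then Real.log (2 + Real.sqrt T / a) else a ^ ((2 : ℝ) - (d : ℝ)) with hb0
  have hb0p : 0 < b0 := by
    rw [hb0]
    split_ifs
    · refine Real.log_pos ?_
      have : 0 < Real.sqrt T / a := by positivity
      linarith
    · positivity
  refine ⟨C * b0, c / Real.sqrt T, by positivity, by positivity, fun x hx => ?_⟩
  have hxp : x ≠ p := by
    rintro rfl
    rw [dist_self] at hx
    linarith
  refine (h x hxp).trans ?_
  rw [mul_assoc]
  refine mul_le_mul_of_nonneg_left ?_ hC.le
  have e1 : -(c * dist x p) / Real.sqrt T = -(c / Real.sqrt T * dist x p) := by ring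
  rw [gBound, e1, mul_comm]
  refine mul_le_mul_of_nonneg_right ?_ (Real.exp_pos _).le
  rw [hb0]
  split_ifs with h2
  · refine Real.log_le_log (by positivity) ?_
    gcongr
  · refine Real.rpow_le_rpow_of_nonpos ha hx ?_
    have : (2 : ℝ) ≤ d := by exact_mod_cast hd
    linarith

lemma IsFund.UE_ext_lt_top (hu : IsFund W T p u Du) (hd : 2 ≤ d) (hT : 0 < T) {a : ℝ}
    (ha : 0 < a) : UE u (ext p a) < ⊤ := by
  obtain ⟨B, k, hB, hk, h⟩ := hu.exists_ext_bound hd hT ha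
  have hi := (integrable_exp_neg_dist (by positivity : 0 < 2 * k) p).const_mul (B ^ 2)
  refine lt_of_le_of_lt ?_ hi.lintegral_lt_top
  refine le_trans (setLIntegral_mono' (measurableSet_ext p a) fun x hx => ?_)
    (setLIntegral_le_lintegral (ext p a) _)
  refine ENNReal.ofReal_le_ofReal ?_
  have h1 := h x (le_of_lt hx)
  have h2 : B ^ 2 * Real.exp (-(2 * k * dist x p)) = (B * Real.exp (-(k * dist x p))) ^ 2 := by
    rw [mul_pow, ← Real.exp_nat_mul]
    congr 2
    push_cast
    ring
  rw [h2]
  exact pow_le_pow_left₀ (hu.nonneg x) h1 2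

/-- Caccioppoli's inequality in the exterior of a ball around the pole. -/
lemma IsFund.cacc_ext (hu : IsFund W T p u Du) (hd : 2 ≤ d) (hlam : 0 < lam) (hT : 0 < T) {a b : ℝ}
    (ha : 0 < a) (hab : a < b) :
    ENNReal.ofReal (lam / 2) * DE Du (ext p b) + ENNReal.ofReal (T⁻¹ / 2) * UE u (ext p b) ≤
      ENNReal.ofReal (2 / lam * (cutK / (b - a)) ^ 2) * UE u (shell p a b) := by
  have hfin := hu.UE_ext_lt_top hd hT ha
  have hD : DE Du (ext p b) = ⨆ n : ℕ, DE Du (shell p b n) := by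
    rw [ext_eq_iUnion]
    exact setLIntegral_iUnion_of_directed _ (directed_shell p b)
  have hU : UE u (ext p b) = ⨆ n : ℕ, UE u (shell p b n) := by
    rw [ext_eq_iUnion]
    exact setLIntegral_iUnion_of_directed _ (directed_shell p b)
  have hmono : Monotone fun n : ℕ => shell p b n := fun m n hmn x hx =>
    ⟨hx.1, hx.2.trans_le (by exact_mod_cast hmn)⟩
  have t1 : Tendsto (fun n : ℕ => DE Du (shell p b n)) atTop (𝓝 (DE Du (ext p b))) := by
    rw [hD]
    exact tendsto_atTop_iSup fun m n hmn => DE_mono (hmono hmn)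
  have t2 : Tendsto (fun n : ℕ => UE u (shell p b n)) atTop (𝓝 (UE u (ext p b))) := by
    rw [hU]
    exact tendsto_atTop_iSup fun m n hmn => UE_mono (hmono hmn)
  have t3 := (ENNReal.Tendsto.const_mul t1 (Or.inr (ENNReal.ofReal_ne_top (r := lam / 2)))).add
    (ENNReal.Tendsto.const_mul t2 (Or.inr (ENNReal.ofReal_ne_top (r := T⁻¹ / 2))))
  have t4 : Tendsto (fun n : ℕ => ENNReal.ofReal (2 / lam * (cutK / (b - a)) ^ 2) *
      UE u (shell p a b) + ENNReal.ofReal (2 / lam * (cutK / n) ^ 2) * UE u (ext p a)) atTop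
      (𝓝 (ENNReal.ofReal (2 / lam * (cutK / (b - a)) ^ 2) * UE u (shell p a b) +
        ENNReal.ofReal (2 / lam * 0 ^ 2) * UE u (ext p a))) := by
    refine tendsto_const_nhds.add (ENNReal.Tendsto.mul_const ?_ (Or.inr hfin.ne))
    refine ENNReal.tendsto_ofReal (((tendsto_const_div_atTop_nhds_zero_nat cutK).pow 2).const_mul _)
  simp only [ne_eq, OfNat.ofNat_ne_zero, not_false_eq_true, zero_pow, mul_zero,
    ENNReal.ofReal_zero, zero_mul, add_zero] at t4
  refine le_of_tendsto_of_tendsto t3 t4 ?_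
  filter_upwards [eventually_gt_atTop ⌈b⌉₊] with n hn
  have hbn : b < n := Nat.lt_of_ceil_lt hn
  have := hu.cacc_shell hlam hT ha hab hbn.le (e := 2 * n) (by linarith)
  refine this.trans (add_le_add le_rfl ?_)
  have e1 : (2 * (n : ℝ) - n) = n := by ring
  rw [e1]
  refine mul_le_mul_right (UE_mono fun x hx => ?_) _
  exact lt_trans (hab.trans hbn) hx.1

/-- The length scale of exponential decay, in units of `√T`. -/
def decK (lam : ℝ) : ℝ := cutK * Real.sqrt (8 / lam)

lemma decK_pos (hlam : 0 < lam) : 0 < decK lam := by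
  unfold decK
  have := cutK_pos
  positivity

lemma IsFund.UE_ext_half (hu : IsFund W T p u Du) (hd : 2 ≤ d) (hlam : 0 < lam) (hT : 0 < T) {a : ℝ}
    (ha : 0 < a) : UE u (ext p (a + decK lam * Real.sqrt T)) ≤ ENNReal.ofReal (1 / 2) * UE u (ext p a) := by
  have hk := decK_pos hlam
  have hsT : 0 < Real.sqrt T := Real.sqrt_pos.2 hT
  have h := hu.cacc_ext hd hlam hT ha (b := a + decK lam * Real.sqrt T) (by linarith [mul_pos hk hsT])
  have h1 : ENNReal.ofReal (T⁻¹ / 2) * UE u (ext p (a + decK lam * Real.sqrt T)) ≤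
      ENNReal.ofReal (T⁻¹ / 2) * (ENNReal.ofReal (1 / 2) * UE u (ext p a)) := by
    refine (le_trans le_add_self h).trans ?_
    rw [← mul_assoc, ← ENNReal.ofReal_mul (by positivity)]
    refine mul_le_mul' (ENNReal.ofReal_le_ofReal (le_of_eq ?_)) (UE_mono fun x hx => hx.1)
    have e1 : (decK lam * Real.sqrt T) ^ 2 = cutK ^ 2 * (8 / lam) * T := by
      unfold decK
      rw [mul_pow, mul_pow, Real.sq_sqrt (by positivity), Real.sq_sqrt hT.le]
    rw [add_sub_cancel_left, div_pow, e1]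
    have := cutK_pos
    field_simp
    ring
  have h0 : ENNReal.ofReal (T⁻¹ / 2) ≠ 0 := by
    rw [ne_eq, ENNReal.ofReal_eq_zero, not_le]; positivity
  exact (ENNReal.mul_le_mul_iff_right h0 ENNReal.ofReal_ne_top).1 h1

/-- Exponential decay of the exterior mass. -/
lemma IsFund.UE_ext_decay (hu : IsFund W T p u Du) (hd : 2 ≤ d) (hlam : 0 < lam) (hT : 0 < T)
    {a b : ℝ} (ha : 0 < a) (hab : a ≤ b) :
    UE u (ext p b) ≤ ENNReal.ofReal (2 * Real.exp (-(Real.log 2 / decK lam * ((b - a) / Real.sqrt T))))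
      * UE u (ext p a) := by
  have hk := decK_pos hlam
  have hsT : 0 < Real.sqrt T := Real.sqrt_pos.2 hT
  have hρ : 0 < decK lam * Real.sqrt T := mul_pos hk hsT
  have hind : ∀ n : ℕ, UE u (ext p (a + n * (decK lam * Real.sqrt T))) ≤
      ENNReal.ofReal ((1 / 2) ^ n) * UE u (ext p a) := by
    intro n
    induction n with
    | zero => simp
    | succ n ih =>
      have e1 : a + ((n + 1 : ℕ) : ℝ) * (decK lam * Real.sqrt T) =
          (a + n * (decK lam * Real.sqrt T)) + decK lam * Real.sqrt T := by
        push_cast; ring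
      rw [e1]
      refine (hu.UE_ext_half hd hlam hT (by positivity)).trans ?_
      rw [pow_succ', ENNReal.ofReal_mul (by positivity), mul_assoc]
      exact mul_le_mul_right ih _
  set n := ⌊(b - a) / (decK lam * Real.sqrt T)⌋₊ with hn
  have h1 : (n : ℝ) ≤ (b - a) / (decK lam * Real.sqrt T) :=
    Nat.floor_le (div_nonneg (by linarith) hρ.le)
  have h2 : (b - a) / (decK lam * Real.sqrt T) < n + 1 := Nat.lt_floor_add_one _
  rw [le_div_iff₀ hρ] at h1
  refine (UE_mono (fun x hx => ?_)).trans ((hind n).trans (mul_le_mul_left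
    (ENNReal.ofReal_le_ofReal ?_) _))
  · simp only [ext, Set.mem_ofPred_eq] at hx ⊢
    linarith
  · have e2 : Real.log 2 / decK lam * ((b - a) / Real.sqrt T) =
        Real.log 2 * ((b - a) / (decK lam * Real.sqrt T)) := by
      field_simp
    have e3 : (1 / 2 : ℝ) ^ n = Real.exp (-(Real.log 2 * n)) := by
      rw [Real.exp_neg, mul_comm, Real.exp_nat_mul, Real.exp_log (by norm_num)]
      simp
    have e4 : (2 : ℝ) * Real.exp (-(Real.log 2 * ((b - a) / (decK lam * Real.sqrt T)))) =
        Real.exp (Real.log 2 + -(Real.log 2 * ((b - a) / (decK lam * Real.sqrt T)))) := by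
      rw [Real.exp_add, Real.exp_log (by norm_num)]
    rw [e2, e3, e4, Real.exp_le_exp]
    have := Real.log_pos (by norm_num : (1 : ℝ) < 2)
    nlinarith

end Ext

/-! ### Testing with bounded functions of the solution -/

lemma ofReal_abs_integral_sq_le {d : ℕ} {S : Set (E d)} (hS : MeasurableSet S) {h a b : E d → ℝ}
    (hab : ∀ x ∈ S, h x ^ 2 ≤ a x * b x) (ha : ∀ x ∈ S, 0 ≤ a x)
    (h0 : ∀ x, x ∉ S → h x = 0)
    (ham : AEMeasurable a (volume.restrict S)) (hbm : AEMeasurable b (volume.restrict S)) :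
    ENNReal.ofReal |∫ x, h x| ^ 2 ≤
      (∫⁻ x in S, ENNReal.ofReal (a x)) * ∫⁻ x in S, ENNReal.ofReal (b x) := by
  have e1 : ENNReal.ofReal |∫ x, h x| ≤ ∫⁻ x in S, ENNReal.ofReal |h x| := by
    have := enorm_integral_le_lintegral_enorm (μ := volume) h
    rw [← lintegral_indicator hS]
    simp only [Real.enorm_eq_ofReal_abs] at this
    refine this.trans (lintegral_mono fun x => ?_)
    by_cases hx : x ∈ S
    · rw [Set.indicator_of_mem hx]
    · rw [Set.indicator_of_notMem hx, h0 x hx]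
      simp
  have e2 : (∫⁻ x in S, ENNReal.ofReal |h x|) ≤
      ∫⁻ x in S, ENNReal.ofReal (Real.sqrt (a x)) * ENNReal.ofReal (Real.sqrt (b x)) := by
    refine setLIntegral_mono' hS fun x hx => ?_
    rw [← ENNReal.ofReal_mul (Real.sqrt_nonneg _), ← Real.sqrt_mul (ha x hx)]
    refine ENNReal.ofReal_le_ofReal ?_
    exact Real.abs_le_sqrt (hab x hx)
  have e4 : ∀ t : ℝ, ENNReal.ofReal (Real.sqrt t) ^ 2 = ENNReal.ofReal t := by
    intro t
    rw [← ENNReal.ofReal_pow (Real.sqrt_nonneg _)]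
    rcases le_total 0 t with ht | ht
    · rw [Real.sq_sqrt ht]
    · rw [Real.sqrt_eq_zero_of_nonpos ht, ENNReal.ofReal_of_nonpos ht]
      simp
  have e3 := lintegral_mul_sq_le (μ := volume.restrict S)
    (f := fun x => ENNReal.ofReal (Real.sqrt (a x)))
    (g := fun x => ENNReal.ofReal (Real.sqrt (b x)))
    ham.sqrt.ennreal_ofReal hbm.sqrt.ennreal_ofReal
  simp only [e4] at e3
  exact (pow_le_pow_left₀ (zero_le) (e1.trans e2) 2).trans e3

section BoundedTest

variable {d : ℕ} {lam : ℝ} {W : CoeffField d lam} {T : ℝ} {p : E d} {u : E d → ℝ}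
  {Du : E d → Fin d → ℝ}

lemma IsFund.aemeasurable_dot (hu : IsFund W T p u Du) :
    AEMeasurable (fun x => Du x ⬝ᵥ Du x) volume := by
  have : ∀ i, AEMeasurable (fun x => Du x i) volume := fun i =>
    (hu.locInt i).aestronglyMeasurable.aemeasurable
  simp only [dotProduct]
  exact Finset.aemeasurable_fun_sum _ fun i _ => (this i).mul (this i)

lemma volume_shell_le (p : E d) (a : ℝ) {b : ℝ} (hb : 0 ≤ b) :
    volume (shell p a b) ≤ ENNReal.ofReal (b ^ d) * volume (ball (0 : E d) 1) := by
  have h1 : shell p a b ⊆ ball p b := fun x hx => hx.2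
  refine (measure_mono h1).trans ?_
  rcases Nat.eq_zero_or_pos d with rfl | hd
  · simp only [pow_zero, ENNReal.ofReal_one, one_mul]
    refine measure_mono fun x _ => ?_
    rw [mem_ball, Subsingleton.elim x 0, dist_self]
    exact one_pos
  have : Nonempty (Fin d) := ⟨⟨0, hd⟩⟩
  rw [Measure.addHaar_ball _ _ hb, finrank_euclideanSpace_fin]

lemma IsFund.exists_shell_bound (hu : IsFund W T p u Du) (hT : 0 < T) :
    ∃ B k : ℝ, 0 < B ∧ 0 < k ∧ ∀ R : ℝ, 0 < R →
      (∫⁻ _ in shell p R (2 * R), ENNReal.ofReal ((cutK / R) ^ 2)) * DE Du (shell p R (2 * R)) ≤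
        ENNReal.ofReal (B * Real.exp (-(k * R))) := by
  obtain ⟨c, C, hc, hC, -, h⟩ := hu.bound
  have hsT : 0 < Real.sqrt T := Real.sqrt_pos.2 hT
  set v : ℝ := (volume (ball (0 : E d) 1)).toReal with hv
  have hv' : volume (ball (0 : E d) 1) = ENNReal.ofReal v :=
    (ENNReal.ofReal_toReal measure_ball_lt_top.ne).symm
  have hvp : 0 < v := ENNReal.toReal_pos (measure_ball_pos _ _ one_pos).ne' measure_ball_lt_top.ne
  have hK := cutK_pos
  refine ⟨cutK ^ 2 * 2 ^ d * v * C ^ 2, 2 * c / Real.sqrt T, by positivity, by positivity,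
    fun R hR => ?_⟩
  have h1 := volume_shell_le p R (by positivity : 0 ≤ 2 * R)
  rw [setLIntegral_const]
  refine (mul_le_mul' (mul_le_mul' le_rfl h1) (h R hR)).trans (le_of_eq ?_)
  rw [hv', ← ENNReal.ofReal_mul (by positivity), ← ENNReal.ofReal_mul (by positivity),
    ← ENNReal.ofReal_mul (by positivity)]
  congr 1
  have e1 : Real.exp (-(2 * c / Real.sqrt T * R)) = Real.exp (-(c * R) / Real.sqrt T) ^ 2 := by
    rw [← Real.exp_nat_mul]
    congr 1
    push_cast
    ring
  have e2 : R ^ ((1 : ℝ) - (d : ℝ)) = R / R ^ d := by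
    rw [Real.rpow_sub hR, Real.rpow_one, Real.rpow_natCast]
  rw [e1, e2, mul_pow]
  field_simp

lemma IsFund.integrable_mul_dot_flux (hu : IsFund W T p u Du) {η χ : E d → ℝ}
    (hη : IsTestFun d η) (hχ : IsTestFun d χ) (hχp : ∀ x, gradAt χ x ≠ 0 → x ∈ tsupport η)
    (hηp : tsupport η ⊆ {p}ᶜ) {F : ℝ → ℝ} (hF : Continuous F) :
    Integrable (fun x => F (u x) * (gradAt χ x ⬝ᵥ flux W Du x)) := by
  have hK : IsCompact (tsupport η) := hη.2
  have hD := hu.h1.memLp _ hηp hK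
  have hfin : IsFiniteMeasure (volume.restrict (tsupport η)) :=
    ⟨by simpa using hK.measure_lt_top⟩
  have hinteg : ∀ i, Integrable fun x => F (u x) * gradAt χ x i * flux W Du x i := by
    intro i
    refine integrable_mul_of_zero_off hK ?_ ?_ ?_
    · exact (hF.comp_continuousOn (hu.h1.cont.mono hηp)).mul (hχ.gradAt_continuous i).continuousOn
    · exact (flux_memLp W hD i).integrable one_le_two
    · intro x hx
      have : gradAt χ x = 0 := by
        by_contra hne
        exact hx (hχp x hne)
      simp [this]
  have := integrable_finsetSum (Finset.univ) fun i _ => hinteg i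
  refine this.congr (Eventually.of_forall fun x => ?_)
  simp only [dotProduct, Finset.mul_sum]
  exact Finset.sum_congr rfl fun i _ => by ring

/-- The energy inequality obtained by testing with `F (u)` times an annular cutoff. -/
lemma IsFund.bounded_test_shell (hu : IsFund W T p u Du) (hlam : 0 < lam) (hT : 0 < T) {F : ℝ → ℝ}
    (hF : ContDiff ℝ (⊤ : ℕ∞) F) {K : ℝ} (h0 : ∀ s, 0 ≤ s → 0 ≤ F s)
    (hK : ∀ s, 0 ≤ s → F s ≤ K) (hF' : ∀ s, 0 ≤ s → 0 ≤ deriv F s) {ε L : ℝ} (hε : 0 < ε)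
    (hεL : 2 * ε ≤ L) :
    ∫⁻ x in shell p (2 * ε) L,
        ENNReal.ofReal (lam * (deriv F (u x) * (Du x ⬝ᵥ Du x)) + T⁻¹ * (u x * F (u x))) ≤
      ENNReal.ofReal (K +
        |∫ x, (K - F (u x)) * (gradAt (cutoff p ε (2 * ε)) x ⬝ᵥ flux W Du x)| +
        |∫ x, F (u x) * (gradAt (cutoff p L (2 * L)) x ⬝ᵥ flux W Du x)|) := by
  have hL : 0 < L := by linarith
  have hε2 : ε < 2 * ε := by linarith
  have hL2 : L < 2 * L := by linarith
  set η := annCut p ε (2 * ε) L (2 * L) with hηdef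
  have hη : IsTestFun d η := annCut_isTestFun hε hε2 hεL hL2
  have hηp : tsupport η ⊆ {p}ᶜ := by
    intro x hx hxp
    have := (annCut_tsupport hε2 hεL hL2 hx).1
    rw [Set.mem_singleton_iff.1 hxp, dist_self] at this
    linarith
  set η' := annCut p (ε / 2) ε (2 * L) (3 * L) with hη'def
  have hη' : IsTestFun d η' :=
    annCut_isTestFun (by linarith) (by linarith) (by linarith) (by linarith)
  have hη'p : tsupport η' ⊆ {p}ᶜ := by
    intro x hx hxp
    have := (annCut_tsupport (by linarith) (by linarith) (by linarith) hx).1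
    rw [Set.mem_singleton_iff.1 hxp, dist_self] at this
    linarith
  have hη'1 : ∀ x, ε ≤ dist x p → dist x p ≤ 2 * L → x ∈ tsupport η' := by
    intro x h1 h2
    refine subset_tsupport _ ?_
    rw [Function.mem_support, hη'def, annCut_eq_one (by linarith) (by linarith) h1 h2]
    exact one_ne_zero
  have hζ : IsTestFun d (cutoff p ε (2 * ε)) := cutoff_isTestFun hε hε2
  have hχ : IsTestFun d (cutoff p L (2 * L)) := cutoff_isTestFun hL hL2
  have hζs : ∀ x, gradAt (cutoff p ε (2 * ε)) x ≠ 0 → x ∈ tsupport η' := by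
    intro x hx
    by_contra hne
    refine hx (cutoff_gradAt_eq_zero hε2 ?_)
    by_contra! hcon
    exact hne (hη'1 x hcon.1.le (by linarith))
  have hχs : ∀ x, gradAt (cutoff p L (2 * L)) x ≠ 0 → x ∈ tsupport η' := by
    intro x hx
    by_contra hne
    refine hx (cutoff_gradAt_eq_zero hL2 ?_)
    by_contra! hcon
    exact hne (hη'1 x (by linarith) hcon.2.le)
  have hFc : Continuous F := hF.continuous
  have hF'c : Continuous (deriv F) := hF.continuous_deriv (by simp)
  have hT' : 0 < T⁻¹ := inv_pos.2 hT
  have i1 := hu.integrable_mul_dot_flux hη' hζ hζs hη'p hFc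
  have i2 := hu.integrable_mul_dot_flux hη' hχ hχs hη'p hFc
  have i3 := hu.integrable_mul_dot_flux hη' hζ hζs hη'p (continuous_const (y := (1 : ℝ)))
  have i4 : Integrable fun x => T⁻¹ * (η x * F (u x) * u x) := by
    have := hu.integrable_of_continuousOn hη hηp (F := fun s => F s * s) (hFc.mul continuous_id)
      hη.1.continuous (fun x hx => image_eq_zero_of_notMem_tsupport hx)
    refine (this.const_mul T⁻¹).congr (Eventually.of_forall fun x => ?_)
    simp only
    ring
  have i5 : ∀ J : E d → Fin d → ℝ, (∀ i, MemLp (fun x => J x i) 2 (volume.restrict (tsupport η))) →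
      Integrable fun x => η x * deriv F (u x) * (Du x ⬝ᵥ J x) := by
    intro J hJ
    refine integrable_mul_of_zero_off hη.2 ?_ (integrableOn_dot (hu.h1.memLp _ hηp hη.2) hJ) ?_
    · exact hη.1.continuous.continuousOn.mul
        (hF'c.comp_continuousOn (hu.h1.cont.mono hηp))
    · intro x hx
      rw [image_eq_zero_of_notMem_tsupport hx, zero_mul]
  have i6 := i5 _ (flux_memLp W (hu.h1.memLp _ hηp hη.2))
  have i7 := i5 _ (hu.h1.memLp _ hηp hη.2)
  have hgrad : ∀ x, gradAt η x ⬝ᵥ flux W Du x =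
      gradAt (cutoff p L (2 * L)) x ⬝ᵥ flux W Du x -
        gradAt (cutoff p ε (2 * ε)) x ⬝ᵥ flux W Du x := by
    intro x
    rw [hηdef, annCut_gradAt hε hε2 hεL hL2, sub_dotProduct]
  have key := hu.tested hu.h1 hη hηp hηp hF
  have hsplit : ∫ x, (T⁻¹ * (η x * F (u x) * u x) +
        η x * deriv F (u x) * (Du x ⬝ᵥ flux W Du x)) =
      (∫ x, F (u x) * (gradAt (cutoff p ε (2 * ε)) x ⬝ᵥ flux W Du x)) -
        ∫ x, F (u x) * (gradAt (cutoff p L (2 * L)) x ⬝ᵥ flux W Du x) := by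
    have i46 : Integrable fun x => T⁻¹ * (η x * F (u x) * u x) +
        η x * deriv F (u x) * (Du x ⬝ᵥ flux W Du x) := i4.add i6
    have i12 : Integrable fun x => F (u x) * (gradAt (cutoff p ε (2 * ε)) x ⬝ᵥ flux W Du x) -
        F (u x) * (gradAt (cutoff p L (2 * L)) x ⬝ᵥ flux W Du x) := i1.sub i2
    rw [← integral_sub i1 i2, ← sub_eq_zero, ← integral_sub i46 i12, ← key]
    refine integral_congr_ae (Eventually.of_forall fun x => ?_)
    simp only [hgrad]
    ring
  have hmass : (∫ x, gradAt (cutoff p ε (2 * ε)) x ⬝ᵥ flux W Du x) ≤ 1 := by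
    have he := hu.eqn _ hζ
    rw [cutoff_eq_one hε2 (by rw [dist_self]; exact hε.le)] at he
    rw [← he]
    have i3' : Integrable fun x => gradAt (cutoff p ε (2 * ε)) x ⬝ᵥ flux W Du x := by
      simpa using i3
    have i8 : Integrable fun x => T⁻¹ * u x * cutoff p ε (2 * ε) x := by
      have := hu.h1.locInt.integrable_smul_left_of_hasCompactSupport hζ.1.continuous hζ.2
      refine (this.const_mul T⁻¹).congr (Eventually.of_forall fun x => ?_)
      simp only [smul_eq_mul]
      ring
    refine integral_mono i3' (i8.add i3') fun x => ?_
    have := mul_nonneg (mul_nonneg hT'.le (hu.nonneg x)) (cutoff_nonneg (p := p) (a := ε) (b := 2 * ε) x)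
    simp only [flux] at this ⊢
    linarith
  have hK0 : 0 ≤ K := (h0 0 le_rfl).trans (hK 0 le_rfl)
  have hKF : (∫ x, F (u x) * (gradAt (cutoff p ε (2 * ε)) x ⬝ᵥ flux W Du x)) =
      K * (∫ x, gradAt (cutoff p ε (2 * ε)) x ⬝ᵥ flux W Du x) -
        ∫ x, (K - F (u x)) * (gradAt (cutoff p ε (2 * ε)) x ⬝ᵥ flux W Du x) := by
    have i3' : Integrable fun x => gradAt (cutoff p ε (2 * ε)) x ⬝ᵥ flux W Du x := by
      simpa using i3
    rw [← integral_const_mul]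
    have : (fun x => (K - F (u x)) * (gradAt (cutoff p ε (2 * ε)) x ⬝ᵥ flux W Du x)) =
        fun x => K * (gradAt (cutoff p ε (2 * ε)) x ⬝ᵥ flux W Du x) -
          F (u x) * (gradAt (cutoff p ε (2 * ε)) x ⬝ᵥ flux W Du x) := by
      funext x
      ring
    rw [this, integral_sub (i3'.const_mul K) i1]
    ring
  have hell : ∀ x, lam * (Du x ⬝ᵥ Du x) ≤ Du x ⬝ᵥ flux W Du x := fun x =>
    (W.elliptic x).2 (Du x)
  have hη0 : ∀ x, 0 ≤ η x := annCut_nonneg hε2 hεL hL2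
  have i9 : Integrable fun x =>
      η x * (lam * (deriv F (u x) * (Du x ⬝ᵥ Du x)) + T⁻¹ * (u x * F (u x))) := by
    refine ((i7.const_mul lam).add i4).congr (Eventually.of_forall fun x => ?_)
    simp only [Pi.add_apply]
    ring
  have hle : ∫ x, η x * (lam * (deriv F (u x) * (Du x ⬝ᵥ Du x)) + T⁻¹ * (u x * F (u x))) ≤
      K + |∫ x, (K - F (u x)) * (gradAt (cutoff p ε (2 * ε)) x ⬝ᵥ flux W Du x)| +
        |∫ x, F (u x) * (gradAt (cutoff p L (2 * L)) x ⬝ᵥ flux W Du x)| := by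
    have h1 : ∫ x, η x * (lam * (deriv F (u x) * (Du x ⬝ᵥ Du x)) + T⁻¹ * (u x * F (u x))) ≤
        ∫ x, (T⁻¹ * (η x * F (u x) * u x) +
          η x * deriv F (u x) * (Du x ⬝ᵥ flux W Du x)) := by
      refine integral_mono i9 (i4.add i6) fun x => ?_
      have := mul_le_mul_of_nonneg_left (hell x)
        (mul_nonneg (hη0 x) (hF' _ (hu.nonneg x)))
      simp only
      nlinarith
    rw [hsplit, hKF] at h1
    have h2 := mul_le_mul_of_nonneg_left hmass hK0
    have h3 := neg_abs_le (∫ x, (K - F (u x)) * (gradAt (cutoff p ε (2 * ε)) x ⬝ᵥ flux W Du x))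
    have h4 := neg_abs_le (∫ x, F (u x) * (gradAt (cutoff p L (2 * L)) x ⬝ᵥ flux W Du x))
    linarith
  refine le_trans ?_ (ENNReal.ofReal_le_ofReal hle)
  have hΨ : ∀ x, 0 ≤ lam * (deriv F (u x) * (Du x ⬝ᵥ Du x)) + T⁻¹ * (u x * F (u x)) := by
    intro x
    have a1 := mul_nonneg hlam.le (mul_nonneg (hF' _ (hu.nonneg x)) (dot_self_nonneg (Du x)))
    have a2 := mul_nonneg hT'.le (mul_nonneg (hu.nonneg x) (h0 _ (hu.nonneg x)))
    exact add_nonneg a1 a2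
  rw [ofReal_integral_eq_lintegral_ofReal i9
    (Eventually.of_forall fun x => mul_nonneg (hη0 x) (hΨ x))]
  refine le_trans (setLIntegral_mono' (measurableSet_shell p _ _) fun x hx => ?_)
    (setLIntegral_le_lintegral (shell p (2 * ε) L) _)
  rw [hηdef, annCut_eq_one hε2 hL2 hx.1.le hx.2.le, one_mul]

/-- Testing the equation with a bounded function of the solution itself. -/
lemma IsFund.bounded_test (hu : IsFund W T p u Du) (hd : 2 ≤ d) (hlam : 0 < lam) (hT : 0 < T)
    {F : ℝ → ℝ} (hF : ContDiff ℝ (⊤ : ℕ∞) F) {K B : ℝ} (h0 : ∀ s, 0 ≤ s → 0 ≤ F s)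
    (hK : ∀ s, 0 ≤ s → F s ≤ K) (hF' : ∀ s, 0 ≤ s → 0 ≤ deriv F s)
    (hB0 : 0 ≤ B) (hB : ∀ s, 0 ≤ s → (K - F s) ^ 2 ≤ B * deriv F s) :
    ∫⁻ x, ENNReal.ofReal (lam * (deriv F (u x) * (Du x ⬝ᵥ Du x)) + T⁻¹ * (u x * F (u x))) ≤
      ENNReal.ofReal K := by
  have hK0 : 0 ≤ K := (h0 0 le_rfl).trans (hK 0 le_rfl)
  have hT' : 0 < T⁻¹ := inv_pos.2 hT
  have hcK := cutK_pos
  obtain ⟨D, k, hD, hk, hDk⟩ := hu.exists_shell_bound hT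
  set Ψ : E d → ℝ≥0∞ := fun x =>
    ENNReal.ofReal (lam * (deriv F (u x) * (Du x ⬝ᵥ Du x)) + T⁻¹ * (u x * F (u x))) with hΨ
  set N : ℕ → ℝ := fun n => (n : ℝ) + 2 with hN
  have hNpos : ∀ n, 0 < N n := fun n => by positivity
  have hN2 : ∀ n, 2 ≤ N n := fun n => by simp [hN]
  set A1 : ℕ → ℝ := fun n =>
    |∫ x, (K - F (u x)) * (gradAt (cutoff p (N n)⁻¹ (2 * (N n)⁻¹)) x ⬝ᵥ flux W Du x)| with hA1
  set A2 : ℕ → ℝ := fun n =>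
    |∫ x, F (u x) * (gradAt (cutoff p (N n) (2 * N n)) x ⬝ᵥ flux W Du x)| with hA2
  set S : ℕ → Set (E d) := fun n => shell p (2 * (N n)⁻¹) (N n) with hS
  have hmain : ∀ n, ∫⁻ x in S n, Ψ x ≤ ENNReal.ofReal (K + A1 n + A2 n) := by
    intro n
    refine hu.bounded_test_shell hlam hT hF h0 hK hF' (inv_pos.2 (hNpos n)) ?_
    have h1 : (N n)⁻¹ ≤ 2⁻¹ := inv_anti₀ (by norm_num) (hN2 n)
    have := hN2 n
    linarith
  have hSmono : Monotone S := by
    intro m n hmn x hx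
    have h1 : N m ≤ N n := by
      simp only [hN]
      have : (m : ℝ) ≤ n := by exact_mod_cast hmn
      linarith
    have h2 : (N n)⁻¹ ≤ (N m)⁻¹ := inv_anti₀ (hNpos m) h1
    exact ⟨lt_of_le_of_lt (by linarith) hx.1, lt_of_lt_of_le hx.2 h1⟩
  have hSun : (⋃ n, S n) = {p}ᶜ := by
    ext x
    simp only [Set.mem_iUnion, Set.mem_compl_iff, Set.mem_singleton_iff]
    constructor
    · rintro ⟨n, hn⟩ rfl
      have h1 := hn.1
      rw [dist_self] at h1
      have := inv_pos.2 (hNpos n)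
      linarith
    · intro hx
      have hx' : 0 < dist x p := dist_pos.2 hx
      obtain ⟨n, hn⟩ := exists_nat_gt (max (2 / dist x p) (dist x p))
      refine ⟨n, ?_, ?_⟩
      · have h1 : 2 / dist x p < N n := by
          have := (le_max_left (2 / dist x p) (dist x p)).trans_lt hn
          simp only [hN]
          linarith
        rw [div_lt_iff₀ hx'] at h1
        rw [← div_eq_mul_inv, div_lt_iff₀ (hNpos n)]
        linarith
      · have := (le_max_right (2 / dist x p) (dist x p)).trans_lt hn
        simp only [hN]
        linarith
  have htot : ∫⁻ x, Ψ x = ⨆ n, ∫⁻ x in S n, Ψ x := by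
    rw [← setLIntegral_iUnion_of_directed _ (directed_of_isDirected_le hSmono), hSun]
    rw [← setLIntegral_univ]
    refine setLIntegral_congr ?_
    refine (ae_eq_univ.2 ?_).symm
    have hne : Nonempty (Fin d) := ⟨⟨0, by omega⟩⟩
    rw [compl_compl]
    exact measure_singleton p
  have hsq : ∀ {f : ℝ → ℝ} {a : ℝ}, 0 < a → ∀ x, (f (u x) * (gradAt (cutoff p a (2 * a)) x ⬝ᵥ flux W Du x)) ^ 2 ≤
      (cutK / a) ^ 2 * (f (u x) ^ 2 * (Du x ⬝ᵥ Du x)) := by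
    intro f a ha x
    rw [mul_pow]
    have h1 := abs_dot_flux_le W Du (gradAt (cutoff p a (2 * a)) x) x
    have h2 := cutoff_gradAt_le (p := p) (by linarith : a < 2 * a) x
    have h3 : 2 * a - a = a := by ring
    rw [h3] at h2
    have h4 := h1.trans (mul_le_mul_of_nonneg_right h2 (dot_self_nonneg (Du x)))
    nlinarith [mul_le_mul_of_nonneg_left h4 (sq_nonneg (f (u x)))]
  have hoff : ∀ {f : ℝ → ℝ} {a : ℝ}, 0 < a → ∀ x, x ∉ shell p a (2 * a) →
      f (u x) * (gradAt (cutoff p a (2 * a)) x ⬝ᵥ flux W Du x) = 0 := by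
    intro f a ha x hx
    rw [cutoff_gradAt_eq_zero (by linarith) (by
      by_contra! hcon
      exact hx ⟨hcon.1, hcon.2⟩)]
    simp
  have hdm := hu.aemeasurable_dot
  have hum := hu.aemeasurable
  have hcrude : ∀ {f : ℝ → ℝ} {a : ℝ}, 0 < a → (∀ s, 0 ≤ s → 0 ≤ f s ∧ f s ≤ K) →
      ENNReal.ofReal |∫ x, f (u x) * (gradAt (cutoff p a (2 * a)) x ⬝ᵥ flux W Du x)| ^ 2 ≤
        ENNReal.ofReal (K ^ 2 * (D * Real.exp (-(k * a)))) := by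
    intro f a ha hf
    have h1 := ofReal_abs_integral_sq_le (measurableSet_shell p a (2 * a))
      (h := fun x => f (u x) * (gradAt (cutoff p a (2 * a)) x ⬝ᵥ flux W Du x))
      (a := fun _ => (cutK / a) ^ 2) (b := fun x => K ^ 2 * (Du x ⬝ᵥ Du x)) (fun x _ => by
        refine (hsq ha x).trans ?_
        have := dot_self_nonneg (Du x)
        obtain ⟨g1, g2⟩ := hf _ (hu.nonneg x)
        gcongr) (fun _ _ => by positivity) (hoff ha) aemeasurable_const
        ((hdm.const_mul _).restrict)
    refine h1.trans ?_
    have h2 : ∫⁻ x in shell p a (2 * a), ENNReal.ofReal (K ^ 2 * (Du x ⬝ᵥ Du x)) =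
        ENNReal.ofReal (K ^ 2) * DE Du (shell p a (2 * a)) := by
      simp only [ENNReal.ofReal_mul (sq_nonneg K)]
      rw [lintegral_const_mul' _ _ ENNReal.ofReal_ne_top]
      rfl
    rw [h2, ENNReal.ofReal_mul (sq_nonneg K), mul_left_comm]
    exact mul_le_mul' le_rfl (hDk a ha)
  have hA2le : ∀ n, A2 n ^ 2 ≤ K ^ 2 * (D * Real.exp (-(k * N n))) := by
    intro n
    have := hcrude (hNpos n) (fun s hs => ⟨h0 s hs, hK s hs⟩)
    rw [← ENNReal.ofReal_pow (abs_nonneg _), ENNReal.ofReal_le_ofReal_iff (by positivity)] at this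
    exact this
  have hA1le : ∀ n, A1 n ^ 2 ≤ K ^ 2 * (D * Real.exp (-(k * (N n)⁻¹))) := by
    intro n
    have := hcrude (f := fun s => K - F s) (inv_pos.2 (hNpos n))
      (fun s hs => ⟨by linarith [hK s hs], by linarith [h0 s hs]⟩)
    rw [← ENNReal.ofReal_pow (abs_nonneg _), ENNReal.ofReal_le_ofReal_iff (by positivity)] at this
    exact this
  have hNtop : Tendsto N atTop atTop :=
    tendsto_atTop_add_const_right _ _ tendsto_natCast_atTop_atTop
  have hexp1 : ∀ {a : ℝ}, 0 < a → Real.exp (-(k * a)) ≤ 1 := fun ha => by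
    rw [Real.exp_le_one_iff]
    have := mul_pos hk ha
    linarith
  have hA2t : Tendsto A2 atTop (𝓝 0) := by
    have h1 : Tendsto (fun n => Real.sqrt (K ^ 2 * (D * Real.exp (-(k * N n))))) atTop (𝓝 0) := by
      have h2 : Tendsto (fun n => Real.exp (-(k * N n))) atTop (𝓝 0) :=
        Real.tendsto_exp_neg_atTop_nhds_zero.comp (hNtop.const_mul_atTop hk)
      have h3 := ((h2.const_mul D).const_mul (K ^ 2)).sqrt
      simpa using h3
    exact squeeze_zero (fun n => abs_nonneg _) (fun n => Real.le_sqrt_of_sq_le (hA2le n)) h1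
  have hfin : ∫⁻ x, Ψ x < ⊤ := by
    rw [htot]
    refine lt_of_le_of_lt (iSup_le fun n => (hmain n).trans (ENNReal.ofReal_le_ofReal
      (?_ : _ ≤ K + Real.sqrt (K ^ 2 * D) + Real.sqrt (K ^ 2 * D)))) ENNReal.ofReal_lt_top
    have g1 : A1 n ≤ Real.sqrt (K ^ 2 * D) := by
      refine Real.le_sqrt_of_sq_le ((hA1le n).trans ?_)
      have := hexp1 (inv_pos.2 (hNpos n))
      have := mul_le_mul_of_nonneg_left this hD.le
      rw [mul_one] at this
      exact mul_le_mul_of_nonneg_left this (sq_nonneg K)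
    have g2 : A2 n ≤ Real.sqrt (K ^ 2 * D) := by
      refine Real.le_sqrt_of_sq_le ((hA2le n).trans ?_)
      have := hexp1 (hNpos n)
      have := mul_le_mul_of_nonneg_left this hD.le
      rw [mul_one] at this
      exact mul_le_mul_of_nonneg_left this (sq_nonneg K)
    linarith
  set v : ℝ≥0∞ := volume (ball (0 : E d) 1) with hv
  have hvtop : v ≠ ⊤ := measure_ball_lt_top.ne
  set Z : ℕ → Set (E d) := fun n => shell p (N n)⁻¹ (2 * (N n)⁻¹) with hZ
  have hNinv : Tendsto (fun n => (N n)⁻¹) atTop (𝓝 0) := tendsto_inv_atTop_zero.comp hNtop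
  have hvol : Tendsto (fun n => volume (Z n)) atTop (𝓝 0) := by
    have h1 : Tendsto (fun n => ENNReal.ofReal ((2 * (N n)⁻¹) ^ d) * v) atTop (𝓝 0) := by
      have h2 : Tendsto (fun n => (2 * (N n)⁻¹) ^ d) atTop (𝓝 0) := by
        have := (hNinv.const_mul 2).pow d
        rwa [mul_zero, zero_pow (by omega)] at this
      have h3 := ENNReal.Tendsto.mul_const (ENNReal.tendsto_ofReal h2) (Or.inr hvtop)
      simpa using h3
    refine tendsto_of_tendsto_of_tendsto_of_le_of_le tendsto_const_nhds h1
      (fun n => zero_le) (fun n => volume_shell_le p _ ?_)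
    have := inv_pos.2 (hNpos n)
    positivity
  have hZΨ : Tendsto (fun n => ∫⁻ x in Z n, Ψ x) atTop (𝓝 0) :=
    tendsto_setLIntegral_zero hfin.ne hvol
  have hA1b : ∀ n, ENNReal.ofReal (A1 n) ^ 2 ≤
      (ENNReal.ofReal (B * cutK ^ 2 * 2 ^ d) * v) * (ENNReal.ofReal lam⁻¹ * ∫⁻ x in Z n, Ψ x) := by
    intro n
    have ha : 0 < (N n)⁻¹ := inv_pos.2 (hNpos n)
    have ha1 : (N n)⁻¹ ≤ 1 := inv_le_one_of_one_le₀ (by linarith [hN2 n])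
    generalize hae : (N n)⁻¹ = a at ha ha1
    have hF'c : Continuous (deriv F) := hF.continuous_deriv (by simp)
    have h1 := ofReal_abs_integral_sq_le (measurableSet_shell p a (2 * a))
      (h := fun x => (K - F (u x)) * (gradAt (cutoff p a (2 * a)) x ⬝ᵥ flux W Du x))
      (a := fun _ => B * (cutK / a) ^ 2) (b := fun x => deriv F (u x) * (Du x ⬝ᵥ Du x))
      (fun x _ => by
        refine (hsq (f := fun s => K - F s) ha x).trans ?_
        have g1 := dot_self_nonneg (Du x)
        have g2 := mul_le_mul_of_nonneg_left (mul_le_mul_of_nonneg_right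
          (hB _ (hu.nonneg x)) g1) (sq_nonneg (cutK / a))
        refine g2.trans (le_of_eq ?_)
        ring) (fun _ _ => by positivity) (hoff (f := fun s => K - F s) ha) aemeasurable_const
        (((hF'c.measurable.comp_aemeasurable hum).mul hdm).restrict)
    simp only [hA1, hae, hZ]
    refine h1.trans (mul_le_mul' ?_ ?_)
    · rw [setLIntegral_const]
      refine (mul_le_mul' le_rfl (volume_shell_le p a (by positivity : 0 ≤ 2 * a))).trans ?_
      rw [← mul_assoc, ← ENNReal.ofReal_mul (by positivity)]
      refine mul_le_mul' (ENNReal.ofReal_le_ofReal ?_) le_rfl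
      have e1 : B * (cutK / a) ^ 2 * (2 * a) ^ d = B * cutK ^ 2 * 2 ^ d * (a ^ d / a ^ 2) := by
        rw [mul_pow]
        field_simp
      rw [e1]
      refine mul_le_of_le_one_right (by positivity) ?_
      rw [div_le_one (by positivity)]
      exact pow_le_pow_of_le_one ha.le ha1 hd
    · rw [← lintegral_const_mul' _ _ ENNReal.ofReal_ne_top]
      refine lintegral_mono fun x => ?_
      rw [hΨ, ← ENNReal.ofReal_mul (inv_nonneg.2 hlam.le)]
      refine ENNReal.ofReal_le_ofReal ?_
      rw [mul_add, inv_mul_cancel_left₀ hlam.ne']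
      have := mul_nonneg (inv_nonneg.2 hlam.le)
        (mul_nonneg hT'.le (mul_nonneg (hu.nonneg x) (h0 _ (hu.nonneg x))))
      linarith
  have hA1t : Tendsto A1 atTop (𝓝 0) := by
    have h1 : Tendsto (fun n => (ENNReal.ofReal (B * cutK ^ 2 * 2 ^ d) * v) *
        (ENNReal.ofReal lam⁻¹ * ∫⁻ x in Z n, Ψ x)) atTop (𝓝 0) := by
      have h2 := ENNReal.Tendsto.const_mul (a := ENNReal.ofReal lam⁻¹) hZΨ
        (Or.inr ENNReal.ofReal_ne_top)
      rw [mul_zero] at h2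
      have h3 := ENNReal.Tendsto.const_mul (a := ENNReal.ofReal (B * cutK ^ 2 * 2 ^ d) * v) h2
        (Or.inr (ENNReal.mul_ne_top ENNReal.ofReal_ne_top hvtop))
      rwa [mul_zero] at h3
    have h4 : Tendsto (fun n => ENNReal.ofReal (A1 n ^ 2)) atTop (𝓝 0) := by
      refine tendsto_of_tendsto_of_tendsto_of_le_of_le tendsto_const_nhds h1
        (fun n => zero_le) (fun n => ?_)
      simp only
      rw [ENNReal.ofReal_pow (abs_nonneg _)]
      exact hA1b n
    have h5 : Tendsto (fun n => A1 n ^ 2) atTop (𝓝 0) := by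
      have := (ENNReal.tendsto_toReal ENNReal.zero_ne_top).comp h4
      refine this.congr fun n => ?_
      exact ENNReal.toReal_ofReal (sq_nonneg _)
    have h6 := h5.sqrt
    rw [Real.sqrt_zero] at h6
    exact h6.congr fun n => Real.sqrt_sq (abs_nonneg _)
  have hR : Tendsto (fun n => ENNReal.ofReal (K + A1 n + A2 n)) atTop (𝓝 (ENNReal.ofReal K)) := by
    have := (hA1t.const_add K).add hA2t
    simp only [add_zero] at this
    exact ENNReal.tendsto_ofReal this
  have hLt : Tendsto (fun n => ∫⁻ x in S n, Ψ x) atTop (𝓝 (∫⁻ x, Ψ x)) := by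
    rw [htot]
    exact tendsto_atTop_iSup fun m n hmn => lintegral_mono_set (hSmono hmn)
  exact le_of_tendsto_of_tendsto' hLt hR hmain

end BoundedTest

/-! ### Truncated energies and the Sobolev inequality -/

/-- A bounded, increasing function vanishing at the origin, with slope of order one near `c`. -/
def arcF (c k s : ℝ) : ℝ := k * (Real.arctan ((s - c) / k) + Real.arctan (c / k))

lemma arcF_contDiff (c k : ℝ) : ContDiff ℝ (⊤ : ℕ∞) (arcF c k) := by
  unfold arcF
  have h : ContDiff ℝ (⊤ : ℕ∞) fun s : ℝ => (s - c) / k := by fun_prop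
  exact contDiff_const.mul ((Real.contDiff_arctan.comp h).add contDiff_const)

lemma arcF_deriv (c : ℝ) {k : ℝ} (hk : 0 < k) (s : ℝ) :
    deriv (arcF c k) s = (1 + ((s - c) / k) ^ 2)⁻¹ := by
  have h1 : HasDerivAt (fun s : ℝ => (s - c) / k) (1 / k) s :=
    ((hasDerivAt_id s).sub_const c).div_const k
  have h2 := ((h1.arctan).add_const (Real.arctan (c / k))).const_mul k
  have h3 : deriv (arcF c k) s = k * (1 / (1 + ((s - c) / k) ^ 2) * (1 / k)) := h2.deriv
  rw [h3]
  field_simp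

lemma arctan_le_self {t : ℝ} (ht : 0 ≤ t) : Real.arctan t ≤ t := by
  have h := Real.le_tan (Real.arctan_nonneg.2 ht) (Real.arctan_lt_pi_div_two t)
  rwa [Real.tan_arctan] at h

lemma sq_sub_arctan_le {t t0 : ℝ} (ht : -t0 ≤ t) :
    (Real.pi / 2 - Real.arctan t) ^ 2 ≤ Real.pi ^ 2 * (2 + t0 ^ 2) * (1 + t ^ 2)⁻¹ := by
  have hpi := Real.pi_gt_three
  rw [← div_eq_mul_inv, le_div_iff₀ (by positivity)]
  have hu := Real.arctan_lt_pi_div_two t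
  have hl := Real.neg_pi_div_two_lt_arctan t
  rcases le_total 1 t with h | h
  · have h1 : Real.pi / 2 - Real.arctan t ≤ t⁻¹ := by
      rw [← Real.arctan_inv_of_pos (by linarith)]
      exact arctan_le_self (by positivity)
    have h2 : (Real.pi / 2 - Real.arctan t) ^ 2 ≤ (t⁻¹) ^ 2 :=
      pow_le_pow_left₀ (by linarith) h1 2
    have h3 : (t⁻¹) ^ 2 * (1 + t ^ 2) ≤ 2 := by
      have : (t⁻¹) ^ 2 * (1 + t ^ 2) = (t⁻¹) ^ 2 + 1 := by field_simp
      rw [this]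
      have : (t⁻¹) ^ 2 ≤ 1 := pow_le_one₀ (by positivity) (inv_le_one_of_one_le₀ h)
      linarith
    have h4 : (Real.pi / 2 - Real.arctan t) ^ 2 * (1 + t ^ 2) ≤ 2 :=
      (mul_le_mul_of_nonneg_right h2 (by positivity)).trans h3
    nlinarith [sq_nonneg t0, mul_nonneg (sq_nonneg Real.pi) (sq_nonneg t0)]
  · have h1 : (Real.pi / 2 - Real.arctan t) ^ 2 ≤ Real.pi ^ 2 :=
      pow_le_pow_left₀ (by linarith) (by linarith) 2
    have h2 : 1 + t ^ 2 ≤ 2 + t0 ^ 2 := by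
      rcases le_total 0 t with h' | h'
      · nlinarith [sq_nonneg t0]
      · nlinarith
    exact mul_le_mul h1 h2 (by positivity) (by positivity)

section Truncated

variable {d : ℕ} {lam : ℝ} {W : CoeffField d lam} {T : ℝ} {p : E d} {u : E d → ℝ}
  {Du : E d → Fin d → ℝ}

lemma IsFund.arc_test (hu : IsFund W T p u Du) (hd : 2 ≤ d) (hlam : 0 < lam) (hT : 0 < T)
    (c : ℝ) {k : ℝ} (hk : 0 < k) :
    ∫⁻ x, ENNReal.ofReal (lam * ((1 + ((u x - c) / k) ^ 2)⁻¹ * (Du x ⬝ᵥ Du x)) +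
      T⁻¹ * (u x * arcF c k (u x))) ≤ ENNReal.ofReal (k * Real.pi) := by
  have h := hu.bounded_test hd hlam hT (arcF_contDiff c k)
    (K := k * (Real.pi / 2 + Real.arctan (c / k))) (B := k ^ 2 * (Real.pi ^ 2 * (2 + (c / k) ^ 2)))
    (fun s hs => ?_) (fun s hs => ?_) (fun s hs => ?_) (by positivity) (fun s hs => ?_)
  · simp only [arcF_deriv c hk] at h
    refine h.trans (ENNReal.ofReal_le_ofReal ?_)
    have := Real.arctan_lt_pi_div_two (c / k)
    gcongr
    linarith
  · have h1 : Real.arctan (-(c / k)) ≤ Real.arctan ((s - c) / k) := by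
      apply Real.arctan_mono
      rw [← neg_div]
      gcongr
      linarith
    rw [Real.arctan_neg] at h1
    exact mul_nonneg hk.le (by linarith)
  · have := Real.arctan_lt_pi_div_two ((s - c) / k)
    unfold arcF
    gcongr
  · rw [arcF_deriv c hk]
    positivity
  · rw [arcF_deriv c hk]
    have h1 : k * (Real.pi / 2 + Real.arctan (c / k)) - arcF c k s =
        k * (Real.pi / 2 - Real.arctan ((s - c) / k)) := by
      unfold arcF
      ring
    rw [h1, mul_pow, mul_assoc (k ^ 2)]
    refine mul_le_mul_of_nonneg_left ?_ (by positivity)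
    refine sq_sub_arctan_le ?_
    rw [← neg_div]
    gcongr
    linarith

/-- The truncated energy is bounded in terms of the truncation level. -/
lemma IsFund.energy_arc (hu : IsFund W T p u Du) (hd : 2 ≤ d) (hlam : 0 < lam) (hT : 0 < T)
    {c : ℝ} {k : ℝ} (hk : 0 < k) :
    ∫⁻ x, ENNReal.ofReal ((1 + ((u x - c) / k) ^ 2)⁻¹ * (Du x ⬝ᵥ Du x)) ≤
      ENNReal.ofReal (k * Real.pi / lam) := by
  have h := hu.arc_test hd hlam hT c hk
  have hT' : 0 < T⁻¹ := inv_pos.2 hT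
  have h1 : ENNReal.ofReal lam *
      (∫⁻ x, ENNReal.ofReal ((1 + ((u x - c) / k) ^ 2)⁻¹ * (Du x ⬝ᵥ Du x))) ≤
      ENNReal.ofReal (k * Real.pi) := by
    refine le_trans ?_ h
    rw [← lintegral_const_mul' _ _ ENNReal.ofReal_ne_top]
    refine lintegral_mono fun x => ?_
    rw [← ENNReal.ofReal_mul hlam.le]
    refine ENNReal.ofReal_le_ofReal ?_
    have h1 : Real.arctan (-(c / k)) ≤ Real.arctan ((u x - c) / k) := by
      apply Real.arctan_mono
      rw [← neg_div]
      gcongr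
      linarith [hu.nonneg x]
    rw [Real.arctan_neg] at h1
    have : 0 ≤ arcF c k (u x) := mul_nonneg hk.le (by linarith)
    have := mul_nonneg hT'.le (mul_nonneg (hu.nonneg x) this)
    linarith
  rw [ENNReal.ofReal_div_of_pos hlam, ENNReal.le_div_iff_mul_le (by simp [hlam]) (by simp), mul_comm]
  exact h1

/-- A bound on the mass of the solution. -/
lemma IsFund.mass_arc (hu : IsFund W T p u Du) (hd : 2 ≤ d) (hlam : 0 < lam) (hT : 0 < T)
    {k : ℝ} (hk : 0 < k) :
    ∫⁻ x, ENNReal.ofReal (u x * Real.arctan (u x / k)) ≤ ENNReal.ofReal (T * Real.pi) := by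
  have h := hu.arc_test hd hlam hT 0 hk
  have hT' : 0 < T⁻¹ := inv_pos.2 hT
  have h1 : ENNReal.ofReal (T⁻¹ * k) * (∫⁻ x, ENNReal.ofReal (u x * Real.arctan (u x / k))) ≤
      ENNReal.ofReal (k * Real.pi) := by
    refine le_trans ?_ h
    rw [← lintegral_const_mul' _ _ ENNReal.ofReal_ne_top]
    refine lintegral_mono fun x => ?_
    rw [← ENNReal.ofReal_mul (by positivity)]
    refine ENNReal.ofReal_le_ofReal ?_
    have h2 : T⁻¹ * k * (u x * Real.arctan (u x / k)) = T⁻¹ * (u x * arcF 0 k (u x)) := by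
      simp only [arcF, sub_zero, zero_div, Real.arctan_zero, add_zero]
      ring
    rw [h2]
    have : 0 ≤ lam * ((1 + ((u x - 0) / k) ^ 2)⁻¹ * (Du x ⬝ᵥ Du x)) :=
      mul_nonneg hlam.le (mul_nonneg (by positivity) (dot_self_nonneg _))
    linarith
  have h3 : T * Real.pi = k * Real.pi / (T⁻¹ * k) := by
    field_simp
  rw [h3, ENNReal.ofReal_div_of_pos (by positivity),
    ENNReal.le_div_iff_mul_le (by simp only [ne_eq, ENNReal.ofReal_eq_zero, not_le]; left; positivity)
      (by simp), mul_comm]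
  exact h1

end Truncated

lemma enorm_fderiv_le_sum {d : ℕ} (χ : E d → ℝ) (x : E d) :
    ‖fderiv ℝ χ x‖ ≤ ∑ i, |gradAt χ x i| := by
  refine ContinuousLinearMap.opNorm_le_bound _ (Finset.sum_nonneg fun i _ => abs_nonneg _) fun y => ?_
  have hy : y = ∑ i, y i • EuclideanSpace.single i (1 : ℝ) := by
    ext j
    simp [Finset.sum_apply, Pi.single_apply]
  conv_lhs => rw [hy]
  rw [map_sum, Finset.sum_mul]
  refine (norm_sum_le _ _).trans (Finset.sum_le_sum fun i _ => ?_)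
  rw [map_smul, norm_smul, mul_comm]
  refine mul_le_mul_of_nonneg_left ?_ (abs_nonneg _)
  exact PiLp.norm_apply_le y i

/-- The Gagliardo–Nirenberg–Sobolev inequality for localised functions of class `H¹`. -/
lemma H1Off.sobolev {d : ℕ} (hd : 0 < d) {U : Set (E d)} {v : E d → ℝ} {Dv : E d → Fin d → ℝ}
    (h : H1Off U v Dv) {η : E d → ℝ} (hη : IsTestFun d η) (hηU : tsupport η ⊆ U) {F : ℝ → ℝ}
    (hF : ContDiff ℝ (⊤ : ℕ∞) F) {q q' : NNReal} (hq : 1 ≤ q) (hq2 : q ≤ 2)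
    (hq' : (q' : ℝ)⁻¹ = (q : ℝ)⁻¹ - (d : ℝ)⁻¹) :
    eLpNorm (fun x => η x * F (v x)) q' volume ≤
      eLpNormLESNormFDerivOfEqInnerConst (volume : Measure (E d)) q *
        ∑ i, eLpNorm (fun x => gradAt η x i * F (v x) + η x * (deriv F (v x) * Dv x i)) q volume := by
  obtain ⟨χ, hχ, hχ0, hχ0', hχu, hχg⟩ := h.exists_testFun_approx hη hηU hF
  set C := eLpNormLESNormFDerivOfEqInnerConst (volume : Measure (E d)) q
  set K := tsupport η with hKdef
  have hK : IsCompact K := hη.2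
  have hKm : MeasurableSet K := (isClosed_tsupport η).measurableSet
  set g : Fin d → E d → ℝ := fun i x => gradAt η x i * F (v x) + η x * (deriv F (v x) * Dv x i)
    with hg
  have hg0 : ∀ i x, x ∉ K → g i x = 0 := fun i x hx => by
    simp only [hg, gradAt_eq_zero hx, image_eq_zero_of_notMem_tsupport hx, zero_mul, add_zero]
  have hgm : ∀ i, AEStronglyMeasurable (g i) volume := by
    intro i
    have h1 : AEStronglyMeasurable (g i) (volume.restrict K) := by
      have hv : ContinuousOn v K := h.cont.mono hηU
      have a1 : AEStronglyMeasurable (fun x => F (v x)) (volume.restrict K) :=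
        (hF.continuous.comp_continuousOn hv).aestronglyMeasurable hKm
      have a2 : AEStronglyMeasurable (fun x => deriv F (v x)) (volume.restrict K) :=
        ((hF.continuous_deriv (by simp)).comp_continuousOn hv).aestronglyMeasurable hKm
      have a3 := (h.memLp K hηU hK i).aestronglyMeasurable
      exact ((hη.gradAt_continuous i).aestronglyMeasurable.mul a1).add
        (hη.1.continuous.aestronglyMeasurable.mul (a2.mul a3))
    have h2 : g i = K.indicator (g i) := by
      funext x
      by_cases hx : x ∈ K
      · rw [Set.indicator_of_mem hx]
      · rw [Set.indicator_of_notMem hx, hg0 i x hx]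
    rw [h2]
    exact (aestronglyMeasurable_indicator_iff hKm).2 h1
  have hfin : IsFiniteMeasure (volume.restrict K) := ⟨by simpa using hK.measure_lt_top⟩
  have hdiff : ∀ i, Tendsto (fun n => eLpNorm (fun x => gradAt (χ n) x i - g i x) q volume)
      atTop (𝓝 0) := by
    intro i
    have h1 : ∀ n, eLpNorm (fun x => gradAt (χ n) x i - g i x) q volume ≤
        eLpNorm (fun x => gradAt (χ n) x i - g i x) 2 (volume.restrict K) *
          (volume.restrict K) Set.univ ^ (1 / (q : ℝ≥0∞).toReal - 1 / (2 : ℝ≥0∞).toReal) := by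
      intro n
      have h2 : (fun x => gradAt (χ n) x i - g i x) =
          K.indicator (fun x => gradAt (χ n) x i - g i x) := by
        funext x
        by_cases hx : x ∈ K
        · rw [Set.indicator_of_mem hx]
        · rw [Set.indicator_of_notMem hx, hg0 i x hx, hχ0' n x i hx, sub_zero]
      conv_lhs => rw [h2, eLpNorm_indicator_eq_eLpNorm_restrict hKm]
      exact eLpNorm_le_eLpNorm_mul_rpow_measure_univ (by exact_mod_cast hq2)
        (((hχ n).gradAt_continuous i).aestronglyMeasurable.sub (hgm i)).restrict
    have h3 := ENNReal.Tendsto.mul_const (b := (volume.restrict K) Set.univ ^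
      (1 / (q : ℝ≥0∞).toReal - 1 / (2 : ℝ≥0∞).toReal)) (hχg i) (Or.inr (by
        refine ENNReal.rpow_ne_top_of_nonneg ?_ (measure_ne_top _ _)
        have g1 : (q : ℝ) ≤ 2 := by exact_mod_cast hq2
        have g2 : (1 : ℝ) ≤ q := by exact_mod_cast hq
        have g3 : (1 : ℝ) / 2 ≤ 1 / q := one_div_le_one_div_of_le (by linarith) g1
        simp only [ENNReal.coe_toReal, ENNReal.toReal_ofNat]
        linarith))
    rw [zero_mul] at h3
    exact tendsto_of_tendsto_of_tendsto_of_le_of_le tendsto_const_nhds h3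
      (fun n => zero_le) h1
  have hn : ∀ n, eLpNorm (χ n) q' volume ≤
      C * ∑ i, (eLpNorm (fun x => gradAt (χ n) x i - g i x) q volume + eLpNorm (g i) q volume) := by
    intro n
    have h1 := eLpNorm_le_eLpNorm_fderiv_of_eq_inner (volume : Measure (E d)) (u := χ n)
      ((hχ n).1.of_le (by norm_cast)) (hχ n).2 hq (by rw [finrank_euclideanSpace_fin]; exact hd)
      (by rw [finrank_euclideanSpace_fin]; exact_mod_cast hq')
    refine h1.trans (mul_le_mul' le_rfl ?_)
    have h2 : eLpNorm (fderiv ℝ (χ n)) q volume ≤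
        eLpNorm (∑ i, fun x => |gradAt (χ n) x i|) q volume := by
      refine eLpNorm_mono_real fun x => ?_
      rw [Finset.sum_apply]
      exact enorm_fderiv_le_sum (χ n) x
    have hq1 : (1 : ℝ≥0∞) ≤ q := by exact_mod_cast hq
    refine h2.trans ((eLpNorm_sum_le (fun i _ =>
      ((hχ n).gradAt_continuous i).abs.aestronglyMeasurable) hq1).trans ?_)
    refine Finset.sum_le_sum fun i _ => ?_
    have h3 : eLpNorm (fun x => |gradAt (χ n) x i|) q volume =
        eLpNorm ((fun x => gradAt (χ n) x i - g i x) + g i) q volume := by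
      refine eLpNorm_congr_norm_ae (Eventually.of_forall fun x => ?_)
      simp
    rw [h3]
    exact eLpNorm_add_le (((hχ n).gradAt_continuous i).aestronglyMeasurable.sub (hgm i)) (hgm i) hq1
  have hlim : Tendsto (fun n => C * ∑ i, (eLpNorm (fun x => gradAt (χ n) x i - g i x) q volume +
      eLpNorm (g i) q volume)) atTop (𝓝 (C * ∑ i, eLpNorm (g i) q volume)) := by
    refine ENNReal.Tendsto.const_mul ?_ (Or.inr ENNReal.coe_ne_top)
    refine tendsto_finsetSum _ fun i _ => ?_
    have := (hdiff i).add_const (eLpNorm (g i) q volume)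
    rwa [zero_add] at this
  have hfatou := Lp.eLpNorm_lim_le_liminf_eLpNorm (p := (q' : ℝ≥0∞)) (μ := (volume : Measure (E d)))
    (f := χ) (fun n => (hχ n).1.continuous.aestronglyMeasurable) (fun x => η x * F (v x))
    (Eventually.of_forall fun x => hχu.tendsto_at (Set.mem_univ x))
  refine hfatou.trans ?_
  rw [← hlim.liminf_eq]
  exact liminf_le_liminf (Eventually.of_forall hn)

/-! ### Integrability of the fundamental solution in dimension at least three -/

/-- The Sobolev exponent `2 d / (d - 2)`. -/
def sobExp (d : ℕ) : NNReal := (2 * d / (d - 2) : ℝ).toNNReal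

lemma sobExp_coe {d : ℕ} (hd : 3 ≤ d) : (sobExp d : ℝ) = 2 * d / (d - 2) := by
  have : (3 : ℝ) ≤ d := by exact_mod_cast hd
  exact Real.coe_toNNReal _ (div_nonneg (by linarith) (by linarith))

lemma sobExp_inv {d : ℕ} (hd : 3 ≤ d) :
    ((sobExp d : NNReal) : ℝ)⁻¹ = ((2 : NNReal) : ℝ)⁻¹ - (d : ℝ)⁻¹ := by
  have : (3 : ℝ) ≤ d := by exact_mod_cast hd
  rw [sobExp_coe hd]
  have h2 : (d : ℝ) - 2 ≠ 0 := by linarith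
  push_cast
  field_simp

lemma arcF_zero_nonneg {k : ℝ} (hk : 0 < k) {s : ℝ} (hs : 0 ≤ s) : 0 ≤ arcF 0 k s := by
  have : 0 ≤ Real.arctan (s / k) := Real.arctan_nonneg.2 (by positivity)
  simp only [arcF, sub_zero, zero_div, Real.arctan_zero, add_zero]
  positivity

lemma arcF_zero_le {k : ℝ} (hk : 0 < k) {s : ℝ} (hs : 0 ≤ s) : arcF 0 k s ≤ s := by
  have : Real.arctan (s / k) ≤ s / k := arctan_le_self (by positivity)
  simp only [arcF, sub_zero, zero_div, Real.arctan_zero, add_zero]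
  calc k * Real.arctan (s / k) ≤ k * (s / k) := by gcongr
    _ = s := by field_simp

lemma arcF_zero_le_const {k : ℝ} (hk : 0 < k) (s : ℝ) : arcF 0 k s ≤ 2 * k := by
  have := Real.arctan_lt_pi_div_two (s / k)
  have h4 := Real.pi_lt_four
  simp only [arcF, sub_zero, zero_div, Real.arctan_zero, add_zero]
  nlinarith

lemma half_le_arctan {t : ℝ} (h0 : 0 ≤ t) (h1 : t ≤ 1) : t / 2 ≤ Real.arctan t := by
  have hm : MonotoneOn (fun s => Real.arctan s - s / 2) (Set.Icc 0 1) := by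
    refine monotoneOn_of_deriv_nonneg (convex_Icc 0 1) (by fun_prop) ?_ ?_
    · exact fun s _ => ((Real.differentiableAt_arctan s).sub (by fun_prop)).differentiableWithinAt
    · intro s hs
      rw [interior_Icc] at hs
      have h2 : HasDerivAt (fun s : ℝ => Real.arctan s - s / 2) (1 / (1 + s ^ 2) - 1 / 2) s :=
        (Real.hasDerivAt_arctan s).sub ((hasDerivAt_id s).div_const 2)
      rw [h2.deriv, sub_nonneg]
      exact one_div_le_one_div_of_le (by positivity) (by nlinarith [hs.1, hs.2])
  have := hm (Set.left_mem_Icc.2 zero_le_one) ⟨h0, h1⟩ h0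
  simp only [Real.arctan_zero, zero_div, sub_zero] at this
  linarith

lemma min_half_le_arcF {k : ℝ} (hk : 0 < k) {s : ℝ} (hs : 0 ≤ s) : min s k / 2 ≤ arcF 0 k s := by
  have h := half_le_arctan (t := min s k / k) (by positivity)
    ((div_le_one hk).2 (min_le_right _ _))
  have h2 : Real.arctan (min s k / k) ≤ Real.arctan (s / k) :=
    Real.arctan_mono (by gcongr; exact min_le_left _ _)
  simp only [arcF, sub_zero, zero_div, Real.arctan_zero, add_zero]
  calc min s k / 2 = k * (min s k / k / 2) := by field_simp
    _ ≤ k * Real.arctan (s / k) := by gcongr; exact h.trans h2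

section HighDim

variable {d : ℕ} {lam : ℝ} {W : CoeffField d lam} {T : ℝ} {p : E d} {u : E d → ℝ}
  {Du : E d → Fin d → ℝ}

lemma eLpNorm_two_le {μ : Measure (E d)} {f : E d → ℝ} {B : ℝ≥0∞}
    (h : ∫⁻ x, ENNReal.ofReal (f x ^ 2) ∂μ ≤ B) : eLpNorm f 2 μ ≤ B ^ (1 / 2 : ℝ) := by
  rw [← eLpNorm_two_sq] at h
  calc eLpNorm f 2 μ = (eLpNorm f 2 μ ^ 2) ^ (1 / 2 : ℝ) := by
        rw [← ENNReal.rpow_natCast, ← ENNReal.rpow_mul]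
        norm_num
    _ ≤ _ := ENNReal.rpow_le_rpow h (by norm_num)

lemma IsFund.arc_sobolev (hu : IsFund W T p u Du) (hd : 3 ≤ d) (hlam : 0 < lam) (hT : 0 < T)
    {k : ℝ} (hk : 0 < k) :
    eLpNorm (fun x => arcF 0 k (u x)) (sobExp d) volume ≤
      eLpNormLESNormFDerivOfEqInnerConst (volume : Measure (E d)) (2 : NNReal) *
        (d * ENNReal.ofReal (k * Real.pi / lam) ^ (1 / 2 : ℝ)) := by
  set C := eLpNormLESNormFDerivOfEqInnerConst (volume : Measure (E d)) (2 : NNReal) with hC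
  set N : ℕ → ℝ := fun n => (n : ℝ) + 2 with hN
  have hNpos : ∀ n, 0 < N n := fun n => by positivity
  have hN2 : ∀ n, 2 ≤ N n := fun n => by simp [hN]
  have hNtop : Tendsto N atTop atTop :=
    tendsto_atTop_add_const_right _ _ tendsto_natCast_atTop_atTop
  have hNinv : Tendsto (fun n => (N n)⁻¹) atTop (𝓝 0) := tendsto_inv_atTop_zero.comp hNtop
  have hinv : ∀ n, (N n)⁻¹ ≤ 2⁻¹ := fun n => inv_anti₀ (by norm_num) (hN2 n)
  have hipos : ∀ n, 0 < (N n)⁻¹ := fun n => inv_pos.2 (hNpos n)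
  have hcK := cutK_pos
  set η : ℕ → E d → ℝ := fun n => annCut p (N n)⁻¹ (2 * (N n)⁻¹) (N n) (2 * N n) with hη
  have c1 : ∀ n, (N n)⁻¹ < 2 * (N n)⁻¹ := fun n => by linarith [hipos n]
  have c2 : ∀ n, 2 * (N n)⁻¹ ≤ N n := fun n => by linarith [hinv n, hN2 n]
  have c3 : ∀ n, N n < 2 * N n := fun n => by linarith [hNpos n]
  have hηt : ∀ n, IsTestFun d (η n) := fun n => annCut_isTestFun (hipos n) (c1 n) (c2 n) (c3 n)
  have hηp : ∀ n, tsupport (η n) ⊆ {p}ᶜ := by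
    intro n x hx hxp
    have := (annCut_tsupport (c1 n) (c2 n) (c3 n) hx).1
    rw [Set.mem_singleton_iff.1 hxp, dist_self] at this
    linarith [hipos n]
  set v : ℝ≥0∞ := volume (ball (0 : E d) 1) with hv
  have hvtop : v ≠ ⊤ := measure_ball_lt_top.ne
  have hdm := hu.aemeasurable_dot
  have hum := hu.aemeasurable
  have hFc : Continuous (arcF 0 k) := (arcF_contDiff 0 k).continuous
  have hF'c : Continuous (deriv (arcF 0 k)) := (arcF_contDiff 0 k).continuous_deriv (by simp)
  set e : ℕ → ℝ≥0∞ := fun n => ENNReal.ofReal ((cutK / (N n)⁻¹) ^ 2 * (2 * k) ^ 2) *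
    (ENNReal.ofReal ((2 * (N n)⁻¹) ^ d) * v) +
      ENNReal.ofReal ((cutK / N n) ^ 2) * UE u (ext p 1) with he
  have het : Tendsto e atTop (𝓝 0) := by
    have h1 : Tendsto (fun n => ENNReal.ofReal ((cutK / (N n)⁻¹) ^ 2 * (2 * k) ^ 2) *
        (ENNReal.ofReal ((2 * (N n)⁻¹) ^ d) * v)) atTop (𝓝 0) := by
      have g1 : ∀ n, ENNReal.ofReal ((cutK / (N n)⁻¹) ^ 2 * (2 * k) ^ 2) *
          (ENNReal.ofReal ((2 * (N n)⁻¹) ^ d) * v) =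
          ENNReal.ofReal (cutK ^ 2 * (2 * k) ^ 2 * 2 ^ d * (N n)⁻¹ ^ (d - 2)) * v := by
        intro n
        rw [← mul_assoc, ← ENNReal.ofReal_mul (by positivity)]
        congr 2
        obtain ⟨m, rfl⟩ : ∃ m, d = m + 2 := ⟨d - 2, by omega⟩
        have := (hNpos n).ne'
        simp only [Nat.add_sub_cancel]
        rw [mul_pow 2 (N n)⁻¹ (m + 2), pow_add (N n)⁻¹ m 2]
        field_simp
      simp only [g1]
      have g2 : Tendsto (fun n => cutK ^ 2 * (2 * k) ^ 2 * 2 ^ d * (N n)⁻¹ ^ (d - 2)) atTop (𝓝 0) := by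
        have := (hNinv.pow (d - 2)).const_mul (cutK ^ 2 * (2 * k) ^ 2 * 2 ^ d)
        rwa [zero_pow (by omega), mul_zero] at this
      have g3 := ENNReal.Tendsto.mul_const (ENNReal.tendsto_ofReal g2) (Or.inr hvtop)
      simpa using g3
    have h2 : Tendsto (fun n => ENNReal.ofReal ((cutK / N n) ^ 2) * UE u (ext p 1)) atTop (𝓝 0) := by
      have g2 : Tendsto (fun n => (cutK / N n) ^ 2) atTop (𝓝 0) := by
        have := (hNinv.const_mul cutK).pow 2
        simp only [mul_zero, ne_eq, OfNat.ofNat_ne_zero, not_false_eq_true, zero_pow] at this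
        simpa [div_eq_mul_inv] using this
      have g3 := ENNReal.Tendsto.mul_const (ENNReal.tendsto_ofReal g2)
        (Or.inr (hu.UE_ext_lt_top (by omega) hT one_pos).ne)
      simpa using g3
    have h3 := h1.add h2
    rw [add_zero] at h3
    exact h3
  have hcut : ∀ n i, eLpNorm (fun x => gradAt (η n) x i * arcF 0 k (u x)) 2 volume ≤
      e n ^ (1 / 2 : ℝ) := by
    intro n i
    refine eLpNorm_two_le ?_
    have h1 : ∀ x, ENNReal.ofReal ((gradAt (η n) x i * arcF 0 k (u x)) ^ 2) ≤
        (shell p (N n)⁻¹ (2 * (N n)⁻¹)).indicator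
          (fun _ => ENNReal.ofReal ((cutK / (N n)⁻¹) ^ 2 * (2 * k) ^ 2)) x +
        (shell p (N n) (2 * N n)).indicator
          (fun x => ENNReal.ofReal ((cutK / N n) ^ 2) * ENNReal.ofReal (u x ^ 2)) x := by
      intro x
      have g1 := annCut_gradDot (p := p) (hipos n) (c1 n) (c2 n) (c3 n) x
      have g2 := (sq_coord_le_dot (gradAt (η n) x) i).trans g1
      have g3 := arcF_zero_nonneg hk (hu.nonneg x)
      have g4 := arcF_zero_le hk (hu.nonneg x)
      have g5 := arcF_zero_le_const hk (u x)
      have g6 : 2 * (N n)⁻¹ - (N n)⁻¹ = (N n)⁻¹ := by ring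
      have g7 : 2 * N n - N n = N n := by ring
      rw [g6, g7] at g2
      have g8 : arcF 0 k (u x) ^ 2 ≤ (2 * k) ^ 2 := pow_le_pow_left₀ g3 g5 2
      have g9 : arcF 0 k (u x) ^ 2 ≤ u x ^ 2 := pow_le_pow_left₀ g3 g4 2
      rw [mul_pow]
      by_cases hx1 : x ∈ shell p (N n)⁻¹ (2 * (N n)⁻¹)
      · have hx2 : x ∉ shell p (N n) (2 * N n) := fun h => by
          linarith [hx1.2, h.1, c2 n]
        rw [Set.indicator_of_mem hx1, Set.indicator_of_notMem hx2, add_zero] at g2 ⊢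
        refine ENNReal.ofReal_le_ofReal ?_
        exact mul_le_mul g2 g8 (sq_nonneg _) (by positivity)
      · rw [Set.indicator_of_notMem hx1, zero_add] at g2 ⊢
        by_cases hx2 : x ∈ shell p (N n) (2 * N n)
        · rw [Set.indicator_of_mem hx2] at g2 ⊢
          rw [← ENNReal.ofReal_mul (by positivity)]
          refine ENNReal.ofReal_le_ofReal ?_
          exact mul_le_mul g2 g9 (sq_nonneg _) (by positivity)
        · rw [Set.indicator_of_notMem hx2] at g2 ⊢
          have : gradAt (η n) x i ^ 2 = 0 := le_antisymm g2 (sq_nonneg _)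
          rw [this]
          simp
    refine (lintegral_mono h1).trans ?_
    rw [lintegral_add_left ((measurable_const).indicator (measurableSet_shell _ _ _)),
      lintegral_indicator (measurableSet_shell _ _ _), lintegral_indicator (measurableSet_shell _ _ _),
      setLIntegral_const, lintegral_const_mul' _ _ ENNReal.ofReal_ne_top]
    refine add_le_add (mul_le_mul' le_rfl (volume_shell_le p _ (by linarith [hipos n])))
      (mul_le_mul' le_rfl (UE_mono fun x hx => ?_))
    exact lt_trans (by linarith [hN2 n]) hx.1
  have hgr : ∀ n i, eLpNorm (fun x => η n x * (deriv (arcF 0 k) (u x) * Du x i)) 2 volume ≤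
      ENNReal.ofReal (k * Real.pi / lam) ^ (1 / 2 : ℝ) := by
    intro n i
    refine eLpNorm_two_le (le_trans (lintegral_mono fun x => ?_)
      (hu.energy_arc (by omega) hlam hT (c := 0) hk))
    refine ENNReal.ofReal_le_ofReal ?_
    have g1 : 0 ≤ η n x := annCut_nonneg (c1 n) (c2 n) (c3 n) x
    have g2 : η n x ≤ 1 := annCut_le_one x
    rw [arcF_deriv 0 hk]
    have g3 : (1 + ((u x - 0) / k) ^ 2)⁻¹ ≤ 1 := inv_le_one_of_one_le₀ (by
      have := sq_nonneg ((u x - 0) / k)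
      linarith)
    have g4 : 0 < (1 + ((u x - 0) / k) ^ 2)⁻¹ := by positivity
    generalize (1 + ((u x - 0) / k) ^ 2)⁻¹ = w at g3 g4
    have g5 := sq_coord_le_dot (Du x) i
    have g6 : η n x ^ 2 ≤ 1 := pow_le_one₀ g1 g2
    have g7 : w ^ 2 ≤ w := by nlinarith
    calc (η n x * (w * Du x i)) ^ 2 = η n x ^ 2 * (w ^ 2 * Du x i ^ 2) := by ring
      _ ≤ 1 * (w * (Du x ⬝ᵥ Du x)) := by gcongr
      _ = _ := one_mul _
  have hmain : ∀ n, eLpNorm (fun x => η n x * arcF 0 k (u x)) (sobExp d) volume ≤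
      C * (d * (e n ^ (1 / 2 : ℝ) + ENNReal.ofReal (k * Real.pi / lam) ^ (1 / 2 : ℝ))) := by
    intro n
    refine (hu.h1.sobolev (by omega) (hηt n) (hηp n) (arcF_contDiff 0 k) (q := 2) one_le_two le_rfl
      (sobExp_inv hd)).trans (mul_le_mul' le_rfl ?_)
    refine (Finset.sum_le_card_nsmul _ _ (e n ^ (1 / 2 : ℝ) +
      ENNReal.ofReal (k * Real.pi / lam) ^ (1 / 2 : ℝ)) fun i _ => ?_).trans
      (le_of_eq (by rw [Finset.card_univ, Fintype.card_fin, nsmul_eq_mul]))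
    refine le_trans (eLpNorm_add_le (f := fun x => gradAt (η n) x i * arcF 0 k (u x))
      (g := fun x => η n x * (deriv (arcF 0 k) (u x) * Du x i)) ?_ ?_ (by norm_num)) ?_
    · exact ((hηt n).gradAt_continuous i).aestronglyMeasurable.mul
        (hFc.measurable.comp_aemeasurable hum).aestronglyMeasurable
    · exact (hηt n).1.continuous.aestronglyMeasurable.mul
        ((hF'c.measurable.comp_aemeasurable hum).aestronglyMeasurable.mul
          (hu.locInt i).aestronglyMeasurable)
    · exact add_le_add (hcut n i) (hgr n i)
  have hlim : Tendsto (fun n => (C : ℝ≥0∞) * (d * (e n ^ (1 / 2 : ℝ) +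
      ENNReal.ofReal (k * Real.pi / lam) ^ (1 / 2 : ℝ)))) atTop
      (𝓝 (C * (d * ENNReal.ofReal (k * Real.pi / lam) ^ (1 / 2 : ℝ)))) := by
    refine ENNReal.Tendsto.const_mul (ENNReal.Tendsto.const_mul ?_
      (Or.inr (ENNReal.natCast_ne_top d))) (Or.inr ENNReal.coe_ne_top)
    have h1 := (ENNReal.continuous_rpow_const (y := (1 / 2 : ℝ))).tendsto 0 |>.comp het
    rw [ENNReal.zero_rpow_of_pos (by norm_num)] at h1
    have := h1.add_const (ENNReal.ofReal (k * Real.pi / lam) ^ (1 / 2 : ℝ))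
    rwa [zero_add] at this
  have hfatou := Lp.eLpNorm_lim_le_liminf_eLpNorm (p := (sobExp d : ℝ≥0∞))
    (μ := (volume : Measure (E d))) (f := fun n x => η n x * arcF 0 k (u x))
    (fun n => (hηt n).1.continuous.aestronglyMeasurable.mul
      (hFc.measurable.comp_aemeasurable hum).aestronglyMeasurable) (fun x => arcF 0 k (u x)) ?_
  · refine hfatou.trans ?_
    rw [← hlim.liminf_eq]
    exact liminf_le_liminf (Eventually.of_forall hmain)
  · have hne : Nonempty (Fin d) := ⟨⟨0, by omega⟩⟩
    have hp0 : ∀ᵐ x ∂(volume : Measure (E d)), x ≠ p := by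
      rw [ae_iff]
      simp
    filter_upwards [hp0] with x hx
    have hx' : 0 < dist x p := dist_pos.2 hx
    refine tendsto_const_nhds.congr' ?_
    have t1 : ∀ᶠ n in atTop, (N n)⁻¹ < dist x p / 2 := hNinv.eventually_lt_const (by positivity)
    have t2 : ∀ᶠ n in atTop, dist x p < N n := hNtop.eventually_gt_atTop _
    filter_upwards [t1, t2] with n hn1 hn2
    simp only [hη]
    rw [annCut_eq_one (c1 n) (c3 n) (by linarith) hn2.le, one_mul]

end HighDim

section

variable {d : ℕ} {lam : ℝ}

/-- The Sobolev constant of the truncated Green function. -/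
def sobB (d : ℕ) (lam : ℝ) : ℝ :=
  eLpNormLESNormFDerivOfEqInnerConst (volume : Measure (E d)) (2 : NNReal) *
    (d * (Real.pi / lam) ^ (1 / 2 : ℝ)) + 1

lemma sobB_pos (hlam : 0 < lam) : 0 < sobB d lam := by
  unfold sobB
  have := Real.pi_pos
  positivity

lemma IsFund.arc_sobolev_real {W : CoeffField d lam} {T : ℝ} {p : E d} {u : E d → ℝ}
    {Du : E d → Fin d → ℝ} (hu : IsFund W T p u Du) (hd : 3 ≤ d) (hlam : 0 < lam) (hT : 0 < T)
    {k : ℝ} (hk : 0 < k) :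
    eLpNorm (fun x => arcF 0 k (u x)) (sobExp d) volume ≤
      ENNReal.ofReal (sobB d lam * k ^ (1 / 2 : ℝ)) := by
  refine (hu.arc_sobolev hd hlam hT hk).trans ?_
  have hpi := Real.pi_pos
  rw [ENNReal.ofReal_rpow_of_nonneg (by positivity) (by norm_num),
    ← ENNReal.ofReal_natCast, ← ENNReal.ofReal_mul (by positivity), ← ENNReal.ofReal_coe_nnreal,
    ← ENNReal.ofReal_mul (by positivity)]
  refine ENNReal.ofReal_le_ofReal ?_
  rw [mul_div_assoc, Real.mul_rpow hk.le (by positivity)]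
  have : 0 ≤ k ^ (1 / 2 : ℝ) := by positivity
  unfold sobB
  nlinarith

lemma lintegral_rpow_le_of_eLpNorm_le {α : Type*} [MeasurableSpace α] {μ : Measure α} {f : α → ℝ}
    {r : NNReal} (hr : 0 < r) {B : ℝ} (hB : 0 ≤ B) (hf : ∀ x, 0 ≤ f x)
    (h : eLpNorm f r μ ≤ ENNReal.ofReal B) :
    ∫⁻ x, ENNReal.ofReal (f x ^ (r : ℝ)) ∂μ ≤ ENNReal.ofReal (B ^ (r : ℝ)) := by
  rw [eLpNorm_nnreal_eq_lintegral hr.ne'] at h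
  have h1 := ENNReal.rpow_le_rpow h (z := (r : ℝ)) r.coe_nonneg
  rw [← ENNReal.rpow_mul, one_div, inv_mul_cancel₀ (by exact_mod_cast hr.ne'), ENNReal.rpow_one,
    ENNReal.ofReal_rpow_of_nonneg hB r.coe_nonneg] at h1
  refine le_trans (le_of_eq (lintegral_congr fun x => ?_)) h1
  rw [Real.enorm_of_nonneg (hf x), ENNReal.ofReal_rpow_of_nonneg (hf x) r.coe_nonneg]

/-- A quantitative local `L²` bound for a fundamental solution that is bounded by `M` on `S`. -/
lemma exists_UE_le (hd : 3 ≤ d) (hlam : 0 < lam) : ∃ C : ℝ, 0 < C ∧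
    ∀ (W : CoeffField d lam) (T : ℝ) (p : E d) (u : E d → ℝ) (Du : E d → Fin d → ℝ),
    IsFund W T p u Du → 0 < T → ∀ (k s M : ℝ) (S : Set (E d)), 0 < k → 0 < s → 0 ≤ M →
      MeasurableSet S → volume S ≤ ENNReal.ofReal (s ^ d) * volume (ball (0 : E d) 1) →
      (∀ x ∈ S, u x ≤ M) →
      UE u S ≤ ENNReal.ofReal (C * (k * s ^ 2 + M ^ 2 * k ^ (-((sobExp d : ℝ) / 2)))) := by
  set v : ℝ := (volume (ball (0 : E d) 1)).toReal with hv
  have hv0 : 0 ≤ v := ENNReal.toReal_nonneg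
  set e : ℝ := (sobExp d : ℝ) with he
  have hdr : (3 : ℝ) ≤ d := by exact_mod_cast hd
  have he' : e = 2 * d / (d - 2) := sobExp_coe hd
  have hd2 : (0 : ℝ) < d - 2 := by linarith
  have hepos : 0 < e := by rw [he']; positivity
  have he2 : 2 ≤ e := by
    rw [he', le_div_iff₀ hd2]
    linarith
  have hinv : 1 / 2 - 1 / e = 1 / d := by
    rw [he']
    field_simp
    ring
  set B := sobB d lam with hB
  have hBpos : 0 < B := sobB_pos hlam
  refine ⟨4 * (B * v ^ (1 / d : ℝ)) ^ 2 + 2 ^ e * B ^ e + 1, by positivity, ?_⟩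
  intro W T p u Du hu hT k s M S hk hs hM hS hvol hle
  set F : E d → ℝ := fun x => arcF 0 k (u x) with hF
  have hF0 : ∀ x, 0 ≤ F x := fun x => arcF_zero_nonneg hk (hu.nonneg x)
  have hFm : AEStronglyMeasurable F (volume.restrict S) :=
    ((arcF_contDiff 0 k).continuous.measurable.comp_aemeasurable
      hu.aemeasurable).aestronglyMeasurable.restrict
  have hsob := hu.arc_sobolev_real hd hlam hT hk
  have hsobS : eLpNorm F (sobExp d) (volume.restrict S) ≤ ENNReal.ofReal (B * k ^ (1 / 2 : ℝ)) :=
    (eLpNorm_restrict_le _ _ _ _).trans hsob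
  have hvol' : volume S ≤ ENNReal.ofReal (s ^ d * v) := by
    rw [ENNReal.ofReal_mul (by positivity), hv, ENNReal.ofReal_toReal measure_ball_lt_top.ne]
    exact hvol
  have h1 : ∫⁻ x in S, ENNReal.ofReal (F x ^ 2) ≤
      ENNReal.ofReal ((B * v ^ (1 / d : ℝ)) ^ 2 * (k * s ^ 2)) := by
    rw [← eLpNorm_two_sq]
    have g1 := eLpNorm_le_eLpNorm_mul_rpow_measure_univ (p := 2) (q := sobExp d)
      (μ := volume.restrict S) (by
        have : (2 : NNReal) ≤ sobExp d := by
          rw [← NNReal.coe_le_coe]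
          exact he2
        exact_mod_cast this) hFm
    have g2 : (1 / (2 : ℝ≥0∞).toReal - 1 / (sobExp d : ℝ≥0∞).toReal) = 1 / d := by
      rw [← hinv]
      simp [he]
    rw [g2, Measure.restrict_apply_univ] at g1
    have g3 : volume S ^ (1 / d : ℝ) ≤ ENNReal.ofReal (s * v ^ (1 / d : ℝ)) := by
      refine (ENNReal.rpow_le_rpow hvol' (by positivity)).trans ?_
      rw [ENNReal.ofReal_rpow_of_nonneg (by positivity) (by positivity),
        Real.mul_rpow (by positivity) hv0, ← Real.rpow_natCast, ← Real.rpow_mul hs.le,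
        mul_one_div_cancel (by positivity), Real.rpow_one]
    have g4 := g1.trans (mul_le_mul' hsobS g3)
    rw [← ENNReal.ofReal_mul (by positivity)] at g4
    refine (pow_le_pow_left' g4 2).trans ?_
    rw [← ENNReal.ofReal_pow (by positivity)]
    refine ENNReal.ofReal_le_ofReal (le_of_eq ?_)
    have g5 : (k ^ (1 / 2 : ℝ)) ^ 2 = k := by
      rw [← Real.rpow_natCast, ← Real.rpow_mul hk.le]
      norm_num
    calc _ = (B * v ^ (1 / d : ℝ)) ^ 2 * ((k ^ (1 / 2 : ℝ)) ^ 2 * s ^ 2) := by ring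
      _ = _ := by rw [g5]
  have h2 : ∫⁻ x in S, ENNReal.ofReal (F x ^ e) ≤ ENNReal.ofReal (B ^ e * k ^ (e / 2)) := by
    have g1 := lintegral_rpow_le_of_eLpNorm_le (by exact_mod_cast hepos) (by positivity) hF0 hsobS
    refine g1.trans (le_of_eq ?_)
    rw [Real.mul_rpow hBpos.le (by positivity), ← Real.rpow_mul hk.le]
    ring_nf
    rfl
  have hpt : ∀ x ∈ S, ENNReal.ofReal (u x ^ 2) ≤ ENNReal.ofReal 4 * ENNReal.ofReal (F x ^ 2) +
      ENNReal.ofReal (M ^ 2 * (2 / k) ^ e) * ENNReal.ofReal (F x ^ e) := by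
    intro x hx
    rw [← ENNReal.ofReal_mul (by norm_num), ← ENNReal.ofReal_mul (by positivity),
      ← ENNReal.ofReal_add (by positivity) (by have := hF0 x; positivity)]
    refine ENNReal.ofReal_le_ofReal ?_
    have g1 := min_half_le_arcF hk (hu.nonneg x)
    have g2 := hF0 x
    have g3 := hu.nonneg x
    rcases le_total (u x) k with h | h
    · rw [min_eq_left h] at g1
      have g4 : u x ≤ 2 * F x := by linarith
      have : 0 ≤ M ^ 2 * (2 / k) ^ e * F x ^ e := by positivity
      nlinarith
    · rw [min_eq_right h] at g1
      have g4 : 1 ≤ (2 / k * F x) ^ e := by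
        refine Real.one_le_rpow ?_ hepos.le
        have : 2 / k * F x = 2 * F x / k := by ring
        rw [this, le_div_iff₀ hk]
        linarith
      rw [Real.mul_rpow (by positivity) g2] at g4
      have g5 : u x ^ 2 ≤ M ^ 2 := pow_le_pow_left₀ g3 (hle x hx) 2
      nlinarith [sq_nonneg (F x), sq_nonneg M]
  calc UE u S ≤ ∫⁻ x in S, (ENNReal.ofReal 4 * ENNReal.ofReal (F x ^ 2) +
      ENNReal.ofReal (M ^ 2 * (2 / k) ^ e) * ENNReal.ofReal (F x ^ e)) :=
        setLIntegral_mono_ae' hS (ae_of_all _ hpt)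
    _ = ENNReal.ofReal 4 * (∫⁻ x in S, ENNReal.ofReal (F x ^ 2)) +
      ENNReal.ofReal (M ^ 2 * (2 / k) ^ e) * ∫⁻ x in S, ENNReal.ofReal (F x ^ e) := by
        rw [lintegral_add_left' ((hFm.aemeasurable.pow_const 2).ennreal_ofReal.const_mul _),
          lintegral_const_mul' _ _ ENNReal.ofReal_ne_top,
          lintegral_const_mul' _ _ ENNReal.ofReal_ne_top]
    _ ≤ ENNReal.ofReal 4 * ENNReal.ofReal ((B * v ^ (1 / d : ℝ)) ^ 2 * (k * s ^ 2)) +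
      ENNReal.ofReal (M ^ 2 * (2 / k) ^ e) * ENNReal.ofReal (B ^ e * k ^ (e / 2)) := by gcongr
    _ ≤ _ := by
        rw [← ENNReal.ofReal_mul (by norm_num), ← ENNReal.ofReal_mul (by positivity),
          ← ENNReal.ofReal_add (by positivity) (by positivity)]
        refine ENNReal.ofReal_le_ofReal ?_
        have g1 : (2 / k) ^ e * k ^ (e / 2) = 2 ^ e * k ^ (-(e / 2)) := by
          rw [Real.div_rpow (by norm_num) hk.le, div_mul_eq_mul_div, mul_div_assoc,
            ← Real.rpow_sub hk]
          congr 2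
          ring
        have g2 : M ^ 2 * (2 / k) ^ e * (B ^ e * k ^ (e / 2)) =
            2 ^ e * B ^ e * (M ^ 2 * k ^ (-(e / 2))) := by
          rw [show M ^ 2 * (2 / k) ^ e * (B ^ e * k ^ (e / 2)) =
            M ^ 2 * B ^ e * ((2 / k) ^ e * k ^ (e / 2)) by ring, g1]
          ring
        rw [g2]
        have g3 : 0 ≤ k * s ^ 2 := by positivity
        have g4 : 0 ≤ M ^ 2 * k ^ (-(e / 2)) := by positivity
        have g5 : 0 ≤ (B * v ^ (1 / d : ℝ)) ^ 2 := by positivity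
        have g6 : 0 ≤ (2 : ℝ) ^ e * B ^ e := by positivity
        nlinarith [mul_nonneg g5 g4, mul_nonneg g6 g3]

end

section

variable {d : ℕ} {lam : ℝ} {W : CoeffField d lam} {T : ℝ} {p q : E d} {a b : E d → ℝ}
  {Da Db : E d → Fin d → ℝ}

lemma integrable_mul_grad_flux (W : CoeffField d lam) {K : Set (E d)} (hK : IsCompact K)
    (hD : ∀ i, MemLp (fun x => Da x i) 2 (volume.restrict K)) {f : E d → ℝ}
    (hf : ContinuousOn f K) {χ : E d → ℝ} (hχ : IsTestFun d χ)
    (h0 : ∀ x, x ∉ K → gradAt χ x = 0) :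
    Integrable (fun x => f x * (gradAt χ x ⬝ᵥ flux W Da x)) := by
  have hfin : IsFiniteMeasure (volume.restrict K) := ⟨by simpa using hK.measure_lt_top⟩
  have : ∀ i, Integrable fun x => (f x * gradAt χ x i) * flux W Da x i := fun i =>
    integrable_mul_of_zero_off hK (hf.mul (hχ.gradAt_continuous i).continuousOn)
      ((flux_memLp W hD i).integrable (by norm_num)) fun x hx => by simp [h0 x hx]
  have h2 : Integrable fun x => ∑ i, (f x * gradAt χ x i) * flux W Da x i :=
    integrable_finsetSum _ fun i _ => this i
  refine h2.congr (ae_of_all _ fun x => ?_)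
  simp only [dotProduct, Finset.mul_sum]
  exact Finset.sum_congr rfl fun i _ => by ring

lemma dot_flux_transpose (W : CoeffField d lam) (x : E d) :
    Da x ⬝ᵥ flux W.transpose Db x = Db x ⬝ᵥ flux W Da x := by
  change Da x ⬝ᵥ (W.A x)ᵀ *ᵥ Db x = Db x ⬝ᵥ W.A x *ᵥ Da x
  rw [Matrix.dotProduct_mulVec, Matrix.vecMul_transpose, dotProduct_comm]

/-- Green's second identity for the two fundamental solutions. -/
lemma IsFund.green_identity (ha : IsFund W T p a Da) (hb : IsFund W.transpose T q b Db)
    {η : E d → ℝ} (hη : IsTestFun d η) (hp : tsupport η ⊆ {p}ᶜ) (hq : tsupport η ⊆ {q}ᶜ) :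
    ∫ x, b x * (gradAt η x ⬝ᵥ flux W Da x) =
      ∫ x, a x * (gradAt η x ⬝ᵥ flux W.transpose Db x) := by
  have hK : IsCompact (tsupport η) := hη.2
  have t1 := ha.tested hb.h1 hη hp hq (F := fun s => s) contDiff_id
  have t2 := hb.tested ha.h1 hη hq hp (F := fun s => s) contDiff_id
  have hz : ∀ x, x ∉ tsupport η → gradAt η x = 0 := fun x hx => funext fun i => gradAt_eq_zero hx i
  have ca := ha.h1.cont.mono hp
  have cb := hb.h1.cont.mono hq
  have ma := ha.h1.memLp _ hp hK
  have mb := hb.h1.memLp _ hq hK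
  have hone : IntegrableOn (fun _ : E d => (1 : ℝ)) (tsupport η) volume :=
    integrableOn_const hK.measure_lt_top.ne
  have i1 : Integrable fun x => b x * (gradAt η x ⬝ᵥ flux W Da x) :=
    integrable_mul_grad_flux W hK ma cb hη hz
  have i2 : Integrable fun x => a x * (gradAt η x ⬝ᵥ flux W.transpose Db x) :=
    integrable_mul_grad_flux W.transpose hK mb ca hη hz
  have i3 : Integrable fun x => T⁻¹ * (η x * b x * a x) := by
    have := (integrable_mul_of_zero_off hK ((hη.1.continuous.continuousOn.mul cb).mul ca) hone
      fun x hx => by simp [image_eq_zero_of_notMem_tsupport hx]).const_mul T⁻¹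
    simpa using this
  have i4 : Integrable fun x => η x * (Db x ⬝ᵥ flux W Da x) :=
    integrable_mul_of_zero_off hK hη.1.continuous.continuousOn
      (integrableOn_dot mb fun i => flux_memLp W ma i)
      fun x hx => by simp [image_eq_zero_of_notMem_tsupport hx]
  have i5 : Integrable fun x => T⁻¹ * (η x * b x * a x) + η x * (Db x ⬝ᵥ flux W Da x) := i3.add i4
  have e1 : (∫ x, b x * (gradAt η x ⬝ᵥ flux W Da x)) +
      ∫ x, (T⁻¹ * (η x * b x * a x) + η x * (Db x ⬝ᵥ flux W Da x)) = 0 := by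
    rw [← integral_add i1 i5, ← t1]
    refine integral_congr_ae (ae_of_all _ fun x => ?_)
    simp only [deriv_id'']
    ring
  have e2 : (∫ x, a x * (gradAt η x ⬝ᵥ flux W.transpose Db x)) +
      ∫ x, (T⁻¹ * (η x * b x * a x) + η x * (Db x ⬝ᵥ flux W Da x)) = 0 := by
    rw [← integral_add i2 i5, ← t2]
    refine integral_congr_ae (ae_of_all _ fun x => ?_)
    simp only [deriv_id'', dot_flux_transpose]
    ring
  linarith

lemma IsFund.green_cutoff (ha : IsFund W T p a Da) (hb : IsFund W.transpose T q b Db) {ε s : ℝ}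
    (hε : 0 < ε) (hεs : 2 * ε ≤ s) (hs : 2 * s < dist q p) :
    (∫ x, b x * (gradAt (cutoff q s (2 * s)) x ⬝ᵥ flux W Da x)) -
      ∫ x, a x * (gradAt (cutoff q s (2 * s)) x ⬝ᵥ flux W.transpose Db x) =
    (∫ x, b x * (gradAt (cutoff q ε (2 * ε)) x ⬝ᵥ flux W Da x)) -
      ∫ x, a x * (gradAt (cutoff q ε (2 * ε)) x ⬝ᵥ flux W.transpose Db x) := by
  have hs0 : 0 < s := by linarith
  have e1 : ε < 2 * ε := by linarith
  have e2 : s < 2 * s := by linarith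
  set K : Set (E d) := {x | ε ≤ dist x q ∧ dist x q ≤ 2 * s} with hKd
  have hKc : IsCompact K := by
    refine (isCompact_closedBall q (2 * s)).of_isClosed_subset ?_ fun x hx => hx.2
    exact (isClosed_le continuous_const (continuous_id.dist continuous_const)).inter
      (isClosed_le (continuous_id.dist continuous_const) continuous_const)
  have hKq : K ⊆ {q}ᶜ := by
    rintro x hx rfl
    have := hx.1
    rw [dist_self] at this
    linarith
  have hKp : K ⊆ {p}ᶜ := by
    rintro x hx rfl
    have := hx.2
    rw [dist_comm] at this
    linarith
  have hsub : tsupport (annCut q ε (2 * ε) s (2 * s)) ⊆ K := annCut_tsupport e1 hεs e2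
  have hη : IsTestFun d (annCut q ε (2 * ε) s (2 * s)) := annCut_isTestFun hε e1 hεs e2
  have key := ha.green_identity hb hη (hsub.trans hKp) (hsub.trans hKq)
  have z1 : ∀ x, x ∉ K → gradAt (cutoff q s (2 * s)) x = 0 := fun x hx =>
    cutoff_gradAt_eq_zero e2 (by
      rcases le_or_gt (dist x q) s with h | h
      · exact Or.inl h
      · refine Or.inr ?_
        by_contra hc
        exact hx ⟨by linarith, by linarith⟩)
  have z2 : ∀ x, x ∉ K → gradAt (cutoff q ε (2 * ε)) x = 0 := fun x hx =>
    cutoff_gradAt_eq_zero e1 (by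
      rcases le_or_gt (dist x q) ε with h | h
      · exact Or.inl h
      · refine Or.inr ?_
        by_contra hc
        exact hx ⟨by linarith, by linarith⟩)
  have c1 := cutoff_isTestFun (p := q) hs0 e2
  have c2 := cutoff_isTestFun (p := q) hε e1
  have ma := ha.h1.memLp _ hKp hKc
  have mb := hb.h1.memLp _ hKq hKc
  have ca := ha.h1.cont.mono hKp
  have cb := hb.h1.cont.mono hKq
  have k1 := integral_sub (integrable_mul_grad_flux W hKc ma cb c1 z1)
    (integrable_mul_grad_flux W hKc ma cb c2 z2)
  have k2 := integral_sub (integrable_mul_grad_flux W.transpose hKc mb ca c1 z1)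
    (integrable_mul_grad_flux W.transpose hKc mb ca c2 z2)
  have k3 : ∀ x, b x * (gradAt (annCut q ε (2 * ε) s (2 * s)) x ⬝ᵥ flux W Da x) =
      b x * (gradAt (cutoff q s (2 * s)) x ⬝ᵥ flux W Da x) -
      b x * (gradAt (cutoff q ε (2 * ε)) x ⬝ᵥ flux W Da x) := fun x => by
    rw [annCut_gradAt hε e1 hεs e2, sub_dotProduct, mul_sub]
  have k4 : ∀ x, a x * (gradAt (annCut q ε (2 * ε) s (2 * s)) x ⬝ᵥ flux W.transpose Db x) =
      a x * (gradAt (cutoff q s (2 * s)) x ⬝ᵥ flux W.transpose Db x) -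
      a x * (gradAt (cutoff q ε (2 * ε)) x ⬝ᵥ flux W.transpose Db x) := fun x => by
    rw [annCut_gradAt hε e1 hεs e2, sub_dotProduct, mul_sub]
  simp only [k3, k4] at key
  linarith

end

section

variable {d : ℕ} {lam : ℝ} {W : CoeffField d lam} {T : ℝ} {p q : E d} {a b : E d → ℝ}
  {Da Db : E d → Fin d → ℝ}

lemma IsFund.cutoff_flux_sq_le (ha : IsFund W T p a Da) (z : E d) {f : E d → ℝ} {R : ℝ}
    (hR : 0 < R) (hf : AEMeasurable f volume) :
    ENNReal.ofReal |∫ x, f x * (gradAt (cutoff z R (2 * R)) x ⬝ᵥ flux W Da x)| ^ 2 ≤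
      ENNReal.ofReal ((cutK / R) ^ 2) * UE f (shell z R (2 * R)) * DE Da (shell z R (2 * R)) := by
  have e1 : R < 2 * R := by linarith
  refine (ofReal_abs_integral_sq_le (S := shell z R (2 * R)) (measurableSet_shell _ _ _)
    (a := fun x => (cutK / R) ^ 2 * f x ^ 2) (b := fun x => Da x ⬝ᵥ Da x) ?_ ?_ ?_ ?_ ?_).trans
    (le_of_eq ?_)
  · intro x _
    have h1 := abs_dot_flux_le W Da (gradAt (cutoff z R (2 * R)) x) x
    have h2 := cutoff_gradAt_le (p := z) e1 x
    rw [show 2 * R - R = R by ring] at h2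
    have h3 := dot_self_nonneg (Da x)
    calc _ = f x ^ 2 * (gradAt (cutoff z R (2 * R)) x ⬝ᵥ flux W Da x) ^ 2 := by ring
      _ ≤ f x ^ 2 * ((cutK / R) ^ 2 * (Da x ⬝ᵥ Da x)) := by
        gcongr
        exact h1.trans (mul_le_mul_of_nonneg_right h2 h3)
      _ = _ := by ring
  · exact fun x _ => by positivity
  · intro x hx
    rw [cutoff_gradAt_eq_zero e1, zero_dotProduct, mul_zero]
    by_contra hc
    push Not at hc
    exact hx hc
  · exact ((hf.pow_const 2).const_mul _).restrict
  · exact ha.aemeasurable_dot.restrict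
  · congr 1
    simp only [UE]
    rw [← lintegral_const_mul' _ _ ENNReal.ofReal_ne_top]
    simp only [ENNReal.ofReal_mul (sq_nonneg (cutK / R))]

lemma UE_le_of_abs_le {f : E d → ℝ} {S : Set (E d)} (hS : MeasurableSet S) {c : ℝ}
    (h : ∀ x ∈ S, |f x| ≤ c) : UE f S ≤ ENNReal.ofReal (c ^ 2) * volume S := by
  refine (setLIntegral_mono_ae' hS (ae_of_all _ fun x hx => ENNReal.ofReal_le_ofReal ?_)).trans
    (le_of_eq (setLIntegral_const _ _))
  rw [← sq_abs]
  exact pow_le_pow_left₀ (abs_nonneg _) (h x hx) 2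

lemma volume_closedBall_eq (hd : 0 < d) (z : E d) {r : ℝ} (hr : 0 ≤ r) :
    volume (closedBall z r) = ENNReal.ofReal (r ^ d) * volume (ball (0 : E d) 1) := by
  have : Nonempty (Fin d) := ⟨⟨0, hd⟩⟩
  rw [Measure.addHaar_closedBall _ _ hr, finrank_euclideanSpace_fin]

/-- The flux of a fundamental solution through small shells around the pole tends to one. -/
lemma IsFund.tendsto_flux (hb : IsFund W T q b Db) (hd : 0 < d) :
    Tendsto (fun ε => ∫ x, gradAt (cutoff q ε (2 * ε)) x ⬝ᵥ flux W Db x) (𝓝[>] 0) (𝓝 1) := by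
  have hne : Nonempty (Fin d) := ⟨⟨0, hd⟩⟩
  have hloc := hb.h1.locInt
  have hbi : IntegrableOn b (closedBall q 2) := hloc.integrableOn_isCompact (isCompact_closedBall _ _)
  have key : ∀ ε : ℝ, 0 < ε → ∫ x, gradAt (cutoff q ε (2 * ε)) x ⬝ᵥ flux W Db x =
      1 - T⁻¹ * ∫ x, b x * cutoff q ε (2 * ε) x := by
    intro ε hε
    have e1 : ε < 2 * ε := by linarith
    have hc := cutoff_isTestFun (p := q) hε e1
    have h1 := hb.eqn _ hc
    rw [cutoff_eq_one e1 (by rw [dist_self]; exact hε.le)] at h1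
    set K : Set (E d) := {x | ε ≤ dist x q ∧ dist x q ≤ 2 * ε} with hKd
    have hKc : IsCompact K := by
      refine (isCompact_closedBall q (2 * ε)).of_isClosed_subset ?_ fun x hx => hx.2
      exact (isClosed_le continuous_const (continuous_id.dist continuous_const)).inter
        (isClosed_le (continuous_id.dist continuous_const) continuous_const)
    have hKq : K ⊆ {q}ᶜ := by
      rintro x hx rfl
      have := hx.1
      rw [dist_self] at this
      linarith
    have i1 := integrable_mul_grad_flux W hKc (hb.h1.memLp _ hKq hKc)
      (f := fun _ => 1) continuousOn_const hc fun x hx => cutoff_gradAt_eq_zero e1 (by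
        by_contra hcon
        push Not at hcon
        exact hx ⟨hcon.1.le, hcon.2.le⟩)
    simp only [one_mul] at i1
    have i2 : Integrable fun x => b x * cutoff q ε (2 * ε) x := by
      have := hloc.integrable_smul_left_of_hasCompactSupport hc.1.continuous hc.2
      refine this.congr (ae_of_all _ fun x => ?_)
      simp [mul_comm]
    have i3 : Integrable fun x => T⁻¹ * b x * cutoff q ε (2 * ε) x := by
      simpa [mul_assoc] using i2.const_mul T⁻¹
    have h2 := integral_add i3 i1
    have h3 : ∫ x, T⁻¹ * b x * cutoff q ε (2 * ε) x = T⁻¹ * ∫ x, b x * cutoff q ε (2 * ε) x := by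
      rw [← integral_const_mul]
      simp only [mul_assoc]
    rw [← h3]
    have h4 : ∫ x, (T⁻¹ * b x * cutoff q ε (2 * ε) x +
      gradAt (cutoff q ε (2 * ε)) x ⬝ᵥ flux W Db x) = 1 := h1
    linarith
  have hlim : Tendsto (fun ε : ℝ => ∫ x, b x * cutoff q ε (2 * ε) x) (𝓝[>] 0)
      (𝓝 (∫ _ : E d, (0 : ℝ))) := by
    refine tendsto_integral_filter_of_dominated_convergence
      ((closedBall q 2).indicator fun x => b x) ?_ ?_ ?_ ?_
    · filter_upwards [self_mem_nhdsWithin] with ε hε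
      exact hloc.aestronglyMeasurable.mul (cutoff_isTestFun (p := q) hε
        (by linarith [Set.mem_Ioi.1 hε])).1.continuous.aestronglyMeasurable
    · have h1 : ∀ᶠ ε : ℝ in 𝓝[>] 0, ε < 1 :=
        mem_nhdsWithin_of_mem_nhds (Iio_mem_nhds one_pos)
      filter_upwards [self_mem_nhdsWithin, h1] with ε hε hε1
      refine ae_of_all _ fun x => ?_
      have hε' : 0 < ε := hε
      by_cases hx : x ∈ closedBall q 2
      · rw [Set.indicator_of_mem hx, Real.norm_eq_abs, abs_of_nonneg
          (mul_nonneg (hb.nonneg x) (cutoff_nonneg x))]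
        exact mul_le_of_le_one_right (hb.nonneg x) (cutoff_le_one x)
      · rw [Set.indicator_of_notMem hx, cutoff_eq_zero (by linarith), mul_zero, norm_zero]
        rw [mem_closedBall, not_le] at hx
        linarith
    · exact hbi.integrable_indicator measurableSet_closedBall
    · have h0 : ∀ᵐ x : E d, x ≠ q := by
        rw [ae_iff]
        simp
      filter_upwards [h0] with x hx
      have hpos : 0 < dist x q := dist_pos.2 hx
      refine tendsto_const_nhds.congr' ?_
      have h1 : ∀ᶠ ε : ℝ in 𝓝[>] 0, ε < dist x q / 2 :=
        mem_nhdsWithin_of_mem_nhds (Iio_mem_nhds (by positivity))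
      filter_upwards [self_mem_nhdsWithin, h1] with ε hε hε1
      have hε' : 0 < ε := hε
      rw [cutoff_eq_zero (by linarith) (by linarith), mul_zero]
  simp only [integral_zero] at hlim
  have h2 := (hlim.const_mul T⁻¹).const_sub 1
  rw [mul_zero, sub_zero] at h2
  refine h2.congr' ?_
  filter_upwards [self_mem_nhdsWithin] with ε hε
  exact (key ε hε).symm

end

section

variable {d : ℕ} {lam : ℝ} {W : CoeffField d lam} {T : ℝ} {p q : E d} {a b : E d → ℝ}
  {Da Db : E d → Fin d → ℝ}

lemma sq_le_of_ofReal_abs_sq_le {x K : ℝ} (hK : 0 ≤ K)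
    (h : ENNReal.ofReal |x| ^ 2 ≤ ENNReal.ofReal K) : x ^ 2 ≤ K := by
  rw [← ENNReal.ofReal_pow (abs_nonneg _), sq_abs] at h
  exact (ENNReal.ofReal_le_ofReal_iff hK).1 h

/-- Away from the pole, a fundamental solution `b` pairs trivially with small shells around the
pole of `b`. -/
lemma IsFund.exists_flux_bound (ha : IsFund W T p a Da) (hb : IsFund W.transpose T q b Db)
    (hd : 3 ≤ d) (hlam : 0 < lam) (hT : 0 < T) :
    ∃ K₁ K₂ : ℝ, 0 ≤ K₁ ∧ 0 ≤ K₂ ∧ ∀ ε δ : ℝ, 0 < ε → 4 * ε < dist q p →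
      (∀ x ∈ closedBall q (4 * ε), |a x - a q| ≤ δ) →
      (∫ x, b x * (gradAt (cutoff q ε (2 * ε)) x ⬝ᵥ flux W Da x)) ^ 2 ≤ K₁ * ε ^ 2 + K₂ * δ ^ 2 := by
  obtain ⟨c, C, hc, hC, hbd, -⟩ := hb.bound
  set v : ℝ := (volume (ball (0 : E d) 1)).toReal with hv
  have hv0 : 0 ≤ v := ENNReal.toReal_nonneg
  have hv' : volume (ball (0 : E d) 1) = ENNReal.ofReal v :=
    (ENNReal.ofReal_toReal measure_ball_lt_top.ne).symm
  have hcK := cutK_pos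
  have hT' : 0 < T⁻¹ := inv_pos.2 hT
  set K₀ : ℝ := cutK ^ 2 * C ^ 2 * 2 ^ d * v * (2 / lam) * 4 ^ d * v with hK₀
  have hK₀' : 0 ≤ K₀ := by positivity
  refine ⟨K₀ * (T⁻¹ * a q ^ 2 / 2), K₀ * (2 / lam * (cutK / 2) ^ 2), by positivity, by positivity,
    fun ε δ hε hεp hδ => ?_⟩
  have hδ0 : 0 ≤ δ := (abs_nonneg _).trans (hδ q (mem_closedBall_self (by positivity)))
  refine sq_le_of_ofReal_abs_sq_le (by positivity) ?_
  refine (ha.cutoff_flux_sq_le q hε hb.aemeasurable).trans ?_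
  have hpow : ε ^ ((2 : ℝ) - d) = ε ^ 2 / ε ^ d := by
    rw [Real.rpow_sub hε, Real.rpow_natCast, Real.rpow_ofNat]
  have h1 : UE b (shell q ε (2 * ε)) ≤
      ENNReal.ofReal ((C * (ε ^ 2 / ε ^ d)) ^ 2 * ((2 * ε) ^ d * v)) := by
    refine (UE_le_of_abs_le (measurableSet_shell _ _ _) (c := C * (ε ^ 2 / ε ^ d)) ?_).trans ?_
    · intro x hx
      have hx0 : 0 < dist x q := hε.trans hx.1
      rw [abs_of_nonneg (hb.nonneg x)]
      refine (hbd x (dist_pos.1 hx0)).trans (mul_le_mul_of_nonneg_left ?_ hC.le)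
      unfold gBound
      rw [if_neg (by omega), ← hpow]
      refine (mul_le_of_le_one_left (by positivity) ?_).trans ?_
      · refine Real.exp_le_one_iff.2 (div_nonpos_of_nonpos_of_nonneg ?_ (Real.sqrt_nonneg _))
        exact neg_nonpos.2 (by positivity)
      · refine Real.rpow_le_rpow_of_nonpos hε hx.1.le ?_
        have : (3 : ℝ) ≤ d := by exact_mod_cast hd
        linarith
    · rw [ENNReal.ofReal_mul (by positivity)]
      refine mul_le_mul' le_rfl ?_
      rw [ENNReal.ofReal_mul (by positivity), ← hv']
      exact volume_shell_le _ _ (by positivity)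
  have h2 : DE Da (shell q ε (2 * ε)) ≤ ENNReal.ofReal (2 / lam * ((4 * ε) ^ d * v) *
      (T⁻¹ * a q ^ 2 / 2 + 2 / lam * (cutK / (2 * ε)) ^ 2 * δ ^ 2)) := by
    have g0 : DE Da (shell q ε (2 * ε)) ≤ DE Da (closedBall q (2 * ε)) :=
      DE_mono fun x hx => hx.2.le
    refine g0.trans ?_
    have g1 := ha.cacc_ball hlam hT (z := q) (a := 2 * ε) (b := 4 * ε) (by positivity) (by linarith)
      hεp (a q)
    rw [show 4 * ε - 2 * ε = 2 * ε by ring] at g1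
    have g2 : UE (fun x => a x - a q) (shell q (2 * ε) (4 * ε)) ≤
        ENNReal.ofReal (δ ^ 2 * ((4 * ε) ^ d * v)) := by
      refine (UE_le_of_abs_le (measurableSet_shell _ _ _) (c := δ)
        fun x hx => hδ x hx.2.le).trans ?_
      rw [ENNReal.ofReal_mul (by positivity)]
      refine mul_le_mul' le_rfl ?_
      rw [ENNReal.ofReal_mul (by positivity), ← hv']
      exact volume_shell_le _ _ (by positivity)
    have g3 : volume (closedBall q (4 * ε)) = ENNReal.ofReal ((4 * ε) ^ d * v) := by
      rw [volume_closedBall_eq (by omega) q (by positivity), hv', ← ENNReal.ofReal_mul (by positivity)]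
    have g4 : ENNReal.ofReal (lam / 2) * DE Da (closedBall q (2 * ε)) ≤
        ENNReal.ofReal (((4 * ε) ^ d * v) *
      (T⁻¹ * a q ^ 2 / 2 + 2 / lam * (cutK / (2 * ε)) ^ 2 * δ ^ 2)) := by
      refine (le_self_add.trans g1).trans ?_
      rw [g3]
      refine (add_le_add le_rfl (mul_le_mul' le_rfl g2)).trans ?_
      rw [← ENNReal.ofReal_mul (by positivity), ← ENNReal.ofReal_mul (by positivity),
        ← ENNReal.ofReal_add (by positivity) (by positivity)]
      exact ENNReal.ofReal_le_ofReal (le_of_eq (by ring))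
    calc DE Da (closedBall q (2 * ε)) =
        ENNReal.ofReal (2 / lam) * (ENNReal.ofReal (lam / 2) * DE Da (closedBall q (2 * ε))) := by
          rw [← mul_assoc, ← ENNReal.ofReal_mul (by positivity)]
          rw [show 2 / lam * (lam / 2) = 1 by field_simp, ENNReal.ofReal_one, one_mul]
      _ ≤ _ := by
          refine (mul_le_mul' le_rfl g4).trans ?_
          rw [← ENNReal.ofReal_mul (by positivity)]
          exact ENNReal.ofReal_le_ofReal (le_of_eq (by ring))
  refine (mul_le_mul' (mul_le_mul' le_rfl h1) h2).trans ?_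
  rw [← ENNReal.ofReal_mul (by positivity), ← ENNReal.ofReal_mul (by positivity)]
  refine ENNReal.ofReal_le_ofReal (le_of_eq ?_)
  rw [hK₀, mul_pow 2 ε d, mul_pow 4 ε d]
  field_simp

/-- Representation of `a` at the pole of `b`. -/
lemma IsFund.representation (ha : IsFund W T p a Da) (hb : IsFund W.transpose T q b Db)
    (hd : 3 ≤ d) (hlam : 0 < lam) (hT : 0 < T) {s : ℝ} (hs : 0 < s) (hsp : 2 * s < dist q p) :
    a q = (∫ x, a x * (gradAt (cutoff q s (2 * s)) x ⬝ᵥ flux W.transpose Db x)) -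
      ∫ x, b x * (gradAt (cutoff q s (2 * s)) x ⬝ᵥ flux W Da x) := by
  have hqp : 0 < dist q p := by linarith
  have hne : Nonempty (Fin d) := ⟨⟨0, by omega⟩⟩
  obtain ⟨K₁, K₂, hK₁, hK₂, hX⟩ := ha.exists_flux_bound hb hd hlam hT
  obtain ⟨B, k, hB, hk, hY⟩ := hb.exists_shell_bound hT
  set Z : ℝ → ℝ := fun ε => ∫ x, gradAt (cutoff q ε (2 * ε)) x ⬝ᵥ flux W.transpose Db x with hZ
  have hZt : Tendsto Z (𝓝[>] 0) (𝓝 1) := hb.tendsto_flux (by omega)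
  set I : ℝ := (∫ x, a x * (gradAt (cutoff q s (2 * s)) x ⬝ᵥ flux W.transpose Db x)) -
      ∫ x, b x * (gradAt (cutoff q s (2 * s)) x ⬝ᵥ flux W Da x) with hI
  have hcont : ContinuousAt a q :=
    ha.h1.cont.continuousAt (ha.h1.isOpen.mem_nhds (dist_pos.1 hqp))
  have main : ∀ δ : ℝ, 0 < δ → (I - a q) ^ 2 ≤ 3 * ((K₂ + B) * δ ^ 2) := by
    intro δ hδ
    obtain ⟨r, hr, hball⟩ := Metric.continuousAt_iff.1 hcont δ hδ
    have hev : ∀ᶠ ε : ℝ in 𝓝[>] 0, (I - a q) ^ 2 ≤ 3 * (K₁ * ε ^ 2 + (K₂ + B) * δ ^ 2 +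
        a q ^ 2 * (Z ε - 1) ^ 2) := by
      have h1 : ∀ᶠ ε : ℝ in 𝓝[>] 0, ε < min (min (s / 2) (r / 4)) (dist q p / 4) :=
        mem_nhdsWithin_of_mem_nhds (Iio_mem_nhds (by positivity))
      filter_upwards [self_mem_nhdsWithin, h1] with ε hε hε1
      have hε0 : 0 < ε := hε
      rw [lt_min_iff, lt_min_iff] at hε1
      obtain ⟨⟨hεs, hεr⟩, hεp⟩ := hε1
      have hosc : ∀ x ∈ closedBall q (4 * ε), |a x - a q| ≤ δ := by
        intro x hx
        rw [← Real.dist_eq]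
        exact (hball (lt_of_le_of_lt (mem_closedBall.1 hx) (by linarith))).le
      have hXε := hX ε δ hε0 (by linarith) hosc
      have hg := ha.green_cutoff hb hε0 (by linarith : 2 * ε ≤ s) hsp
      have e1 : ε < 2 * ε := by linarith
      set K : Set (E d) := {x | ε ≤ dist x q ∧ dist x q ≤ 2 * ε} with hKd
      have hKc : IsCompact K := by
        refine (isCompact_closedBall q (2 * ε)).of_isClosed_subset ?_ fun x hx => hx.2
        exact (isClosed_le continuous_const (continuous_id.dist continuous_const)).inter
          (isClosed_le (continuous_id.dist continuous_const) continuous_const)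
      have hKq : K ⊆ {q}ᶜ := by
        rintro x hx rfl
        have := hx.1
        rw [dist_self] at this
        linarith
      have hKp : K ⊆ {p}ᶜ := by
        rintro x hx rfl
        have := hx.2
        rw [dist_comm] at this
        linarith
      have hz : ∀ x, x ∉ K → gradAt (cutoff q ε (2 * ε)) x = 0 := fun x hx =>
        cutoff_gradAt_eq_zero e1 (by
          by_contra hcon
          push Not at hcon
          exact hx ⟨hcon.1.le, hcon.2.le⟩)
      have hc := cutoff_isTestFun (p := q) hε0 e1
      have i1 := integrable_mul_grad_flux W.transpose hKc (hb.h1.memLp _ hKq hKc)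
        (ha.h1.cont.mono hKp) hc hz
      have i2 := integrable_mul_grad_flux W.transpose hKc (hb.h1.memLp _ hKq hKc)
        (f := fun _ => a q) continuousOn_const hc hz
      have hsplit := integral_sub i1 i2
      rw [integral_const_mul] at hsplit
      set Y := ∫ x, (a x * (gradAt (cutoff q ε (2 * ε)) x ⬝ᵥ flux W.transpose Db x) -
        a q * (gradAt (cutoff q ε (2 * ε)) x ⬝ᵥ flux W.transpose Db x)) with hYd
      have hYε : Y ^ 2 ≤ B * δ ^ 2 := by
        refine sq_le_of_ofReal_abs_sq_le (by positivity) ?_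
        have g0 : Y = ∫ x, (a x - a q) *
            (gradAt (cutoff q ε (2 * ε)) x ⬝ᵥ flux W.transpose Db x) := by
          simp only [hYd, sub_mul]
        rw [g0]
        refine (hb.cutoff_flux_sq_le q hε0 (ha.aemeasurable.sub_const _)).trans ?_
        have g1 : UE (fun x => a x - a q) (shell q ε (2 * ε)) ≤
            ENNReal.ofReal (δ ^ 2) * volume (shell q ε (2 * ε)) :=
          UE_le_of_abs_le (measurableSet_shell _ _ _) fun x hx => hosc x
            (mem_closedBall.2 (by linarith [hx.2]))
        have g2 := hY ε hε0
        rw [setLIntegral_const] at g2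
        calc _ ≤ ENNReal.ofReal ((cutK / ε) ^ 2) * (ENNReal.ofReal (δ ^ 2) *
              volume (shell q ε (2 * ε))) * DE Db (shell q ε (2 * ε)) := by gcongr
          _ = ENNReal.ofReal (δ ^ 2) * (ENNReal.ofReal ((cutK / ε) ^ 2) *
              volume (shell q ε (2 * ε)) * DE Db (shell q ε (2 * ε))) := by ring
          _ ≤ ENNReal.ofReal (δ ^ 2) * ENNReal.ofReal B := by
              refine mul_le_mul' le_rfl (g2.trans (ENNReal.ofReal_le_ofReal ?_))
              refine mul_le_of_le_one_right hB.le (Real.exp_le_one_iff.2 ?_)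
              rw [neg_nonpos]
              positivity
          _ = _ := by rw [← ENNReal.ofReal_mul (by positivity), mul_comm]
      set X := ∫ x, b x * (gradAt (cutoff q ε (2 * ε)) x ⬝ᵥ flux W Da x) with hXd
      have hIe : I - a q = Y + a q * (Z ε - 1) - X := by
        have : Z ε = ∫ x, gradAt (cutoff q ε (2 * ε)) x ⬝ᵥ flux W.transpose Db x := rfl
        rw [← this] at hsplit
        linarith
      rw [hIe]
      nlinarith [sq_nonneg (Y - a q * (Z ε - 1)), sq_nonneg (Y + X),
        sq_nonneg (a q * (Z ε - 1) + X)]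
    have hlim : Tendsto (fun ε : ℝ => 3 * (K₁ * ε ^ 2 + (K₂ + B) * δ ^ 2 +
        a q ^ 2 * (Z ε - 1) ^ 2)) (𝓝[>] 0) (𝓝 (3 * (K₁ * 0 ^ 2 + (K₂ + B) * δ ^ 2 +
        a q ^ 2 * (1 - 1) ^ 2))) := by
      have h0 : Tendsto (fun ε : ℝ => ε) (𝓝[>] 0) (𝓝 0) := tendsto_nhdsWithin_of_tendsto_nhds tendsto_id
      exact (((h0.pow 2).const_mul K₁).add_const _ |>.add
        (((hZt.sub_const 1).pow 2).const_mul _)).const_mul 3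
    have := ge_of_tendsto hlim hev
    simpa using this
  have hlim : Tendsto (fun δ : ℝ => 3 * ((K₂ + B) * δ ^ 2)) (𝓝[>] 0) (𝓝 (3 * ((K₂ + B) * 0 ^ 2))) := by
    have h0 : Tendsto (fun ε : ℝ => ε) (𝓝[>] 0) (𝓝 0) := tendsto_nhdsWithin_of_tendsto_nhds tendsto_id
    exact ((h0.pow 2).const_mul _).const_mul 3
  have h0 := ge_of_tendsto hlim (by
    filter_upwards [self_mem_nhdsWithin] with δ hδ
    exact main δ hδ)
  have h1 : I - a q = 0 := by
    have : (I - a q) ^ 2 ≤ 0 := by simpa using h0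
    nlinarith
  linarith

end

section

variable {d : ℕ} {lam : ℝ} {W : CoeffField d lam} {T : ℝ} {p q : E d} {a b : E d → ℝ}
  {Da Db : E d → Fin d → ℝ}

lemma le_ofReal_inv_mul {c : ℝ} (hc : 0 < c) {x y : ℝ≥0∞} (h : ENNReal.ofReal c * x ≤ y) :
    x ≤ ENNReal.ofReal c⁻¹ * y := by
  calc x = ENNReal.ofReal c⁻¹ * (ENNReal.ofReal c * x) := by
        rw [← mul_assoc, ← ENNReal.ofReal_mul (by positivity), inv_mul_cancel₀ hc.ne',
          ENNReal.ofReal_one, one_mul]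
    _ ≤ _ := mul_le_mul' le_rfl h

/-- Pointwise bound for `a` at the pole of `b` by local `L²` norms. -/
lemma IsFund.sq_le_UE_mul_UE (ha : IsFund W T p a Da) (hb : IsFund W.transpose T q b Db)
    (hd : 3 ≤ d) (hlam : 0 < lam) (hT : 0 < T) {s : ℝ} (hs : 0 < s) (hsp : 3 * s < dist q p) :
    ENNReal.ofReal (a q ^ 2) ≤ ENNReal.ofReal ((9 * cutK ^ 2 / (lam * s ^ 2)) ^ 2) *
      (UE a (closedBall q (3 * s)) * UE b (shell q (s / 2) (4 * s))) := by
  have hcK := cutK_pos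
  have hrep := ha.representation hb hd hlam hT hs (by linarith)
  set I₁ := ∫ x, a x * (gradAt (cutoff q s (2 * s)) x ⬝ᵥ flux W.transpose Db x)
  set I₂ := ∫ x, b x * (gradAt (cutoff q s (2 * s)) x ⬝ᵥ flux W Da x)
  set P := UE a (closedBall q (3 * s)) with hP
  set Q := UE b (shell q (s / 2) (4 * s)) with hQ
  have h1 : ENNReal.ofReal |I₁| ^ 2 ≤ _ := hb.cutoff_flux_sq_le q hs ha.aemeasurable
  have h2 : ENNReal.ofReal |I₂| ^ 2 ≤ _ := ha.cutoff_flux_sq_le q hs hb.aemeasurable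
  have u1 : UE a (shell q s (2 * s)) ≤ P := UE_mono fun x hx => mem_closedBall.2 (by linarith [hx.2])
  have u2 : UE b (shell q s (2 * s)) ≤ Q :=
    UE_mono fun x hx => ⟨by linarith [hx.1], by linarith [hx.2]⟩
  have d1 : DE Db (shell q s (2 * s)) ≤
      ENNReal.ofReal (lam / 2)⁻¹ * (ENNReal.ofReal (2 / lam * (8 * (cutK / s) ^ 2)) * Q) := by
    refine le_ofReal_inv_mul (by positivity) ?_
    refine (le_self_add.trans (hb.cacc_shell hlam hT (a := s / 2) (b := s) (c := 2 * s) (e := 4 * s)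
      (by positivity) (by linarith) (by linarith) (by linarith))).trans ?_
    have g1 : UE b (shell q (s / 2) s) ≤ Q :=
      UE_mono fun x hx => ⟨hx.1, by linarith [hx.2]⟩
    have g2 : UE b (shell q (2 * s) (4 * s)) ≤ Q :=
      UE_mono fun x hx => ⟨by linarith [hx.1], hx.2⟩
    refine (add_le_add (mul_le_mul' le_rfl g1) (mul_le_mul' le_rfl g2)).trans ?_
    rw [← add_mul, ← ENNReal.ofReal_add (by positivity) (by positivity)]
    refine mul_le_mul' (ENNReal.ofReal_le_ofReal ?_) le_rfl
    rw [← mul_add]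
    refine mul_le_mul_of_nonneg_left ?_ (by positivity)
    have e1 : cutK / (s - s / 2) = 2 * (cutK / s) := by field_simp; ring
    have e2 : cutK / (4 * s - 2 * s) = (cutK / s) / 2 := by field_simp; ring
    rw [e1, e2]
    nlinarith [sq_nonneg (cutK / s)]
  have d2 : DE Da (shell q s (2 * s)) ≤
      ENNReal.ofReal (lam / 2)⁻¹ * (ENNReal.ofReal (2 / lam * (cutK / s) ^ 2) * P) := by
    refine le_ofReal_inv_mul (by positivity) ?_
    have g0 : DE Da (shell q s (2 * s)) ≤ DE Da (closedBall q (2 * s)) :=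
      DE_mono fun x hx => hx.2.le
    refine (mul_le_mul' le_rfl g0).trans ((le_self_add.trans (ha.cacc_ball hlam hT (z := q)
      (a := 2 * s) (b := 3 * s) (by positivity) (by linarith) hsp 0)).trans ?_)
    have g1 : UE (fun x => a x - 0) (shell q (2 * s) (3 * s)) ≤ P := by
      simp only [sub_zero]
      exact UE_mono fun x hx => mem_closedBall.2 hx.2.le
    rw [show 3 * s - 2 * s = s by ring]
    refine (add_le_add le_rfl (mul_le_mul' le_rfl g1)).trans (le_of_eq ?_)
    simp
  have hsq : a q ^ 2 ≤ 2 * |I₁| ^ 2 + 2 * |I₂| ^ 2 := by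
    rw [hrep, sq_abs, sq_abs]
    nlinarith [sq_nonneg (I₁ + I₂)]
  calc ENNReal.ofReal (a q ^ 2) ≤ ENNReal.ofReal (2 * |I₁| ^ 2 + 2 * |I₂| ^ 2) :=
        ENNReal.ofReal_le_ofReal hsq
    _ = ENNReal.ofReal 2 * ENNReal.ofReal |I₁| ^ 2 + ENNReal.ofReal 2 * ENNReal.ofReal |I₂| ^ 2 := by
        rw [ENNReal.ofReal_add (by positivity) (by positivity), ENNReal.ofReal_mul (by norm_num),
          ENNReal.ofReal_mul (by norm_num), ENNReal.ofReal_pow (abs_nonneg _),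
          ENNReal.ofReal_pow (abs_nonneg _)]
    _ ≤ ENNReal.ofReal 2 * (ENNReal.ofReal ((cutK / s) ^ 2) * P * (ENNReal.ofReal (lam / 2)⁻¹ *
          (ENNReal.ofReal (2 / lam * (8 * (cutK / s) ^ 2)) * Q))) +
        ENNReal.ofReal 2 * (ENNReal.ofReal ((cutK / s) ^ 2) * Q * (ENNReal.ofReal (lam / 2)⁻¹ *
          (ENNReal.ofReal (2 / lam * (cutK / s) ^ 2) * P))) := by
        refine add_le_add (mul_le_mul' le_rfl (h1.trans ?_)) (mul_le_mul' le_rfl (h2.trans ?_))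
        · exact mul_le_mul' (mul_le_mul' le_rfl u1) d1
        · exact mul_le_mul' (mul_le_mul' le_rfl u2) d2
    _ = (ENNReal.ofReal 2 * ENNReal.ofReal ((cutK / s) ^ 2) * ENNReal.ofReal (lam / 2)⁻¹ *
          ENNReal.ofReal (2 / lam * (8 * (cutK / s) ^ 2)) +
        ENNReal.ofReal 2 * ENNReal.ofReal ((cutK / s) ^ 2) * ENNReal.ofReal (lam / 2)⁻¹ *
          ENNReal.ofReal (2 / lam * (cutK / s) ^ 2)) * (P * Q) := by ring
    _ ≤ _ := by
        refine mul_le_mul' ?_ le_rfl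
        rw [← ENNReal.ofReal_mul (by positivity), ← ENNReal.ofReal_mul (by positivity),
          ← ENNReal.ofReal_mul (by positivity), ← ENNReal.ofReal_mul (by positivity),
          ← ENNReal.ofReal_add (by positivity) (by positivity)]
        refine ENNReal.ofReal_le_ofReal ?_
        have : 2 * (cutK / s) ^ 2 * (lam / 2)⁻¹ * (2 / lam * (8 * (cutK / s) ^ 2)) +
          2 * (cutK / s) ^ 2 * (lam / 2)⁻¹ * (2 / lam * (cutK / s) ^ 2) =
          72 * (cutK ^ 2 / (lam * s ^ 2)) ^ 2 := by
            field_simp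
            ring
        rw [this, mul_div_assoc, mul_pow]
        nlinarith [sq_nonneg (cutK ^ 2 / (lam * s ^ 2))]

/-- One step of the improvement of the pointwise bound. -/
lemma exists_bound_improvement (hd : 3 ≤ d) (hlam : 0 < lam) : ∃ C : ℝ, 0 < C ∧
    ∀ (W : CoeffField d lam) (T : ℝ) (p q : E d) (a b : E d → ℝ) (Da Db : E d → Fin d → ℝ),
    IsFund W T p a Da → IsFund W.transpose T q b Db → 0 < T → p ≠ q → ∀ M ε : ℝ, 0 < M → 0 < ε →
    (∀ x, x ≠ p → a x ≤ M * dist x p ^ ((2 : ℝ) - d)) →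
    (∀ x, x ≠ q → b x ≤ M * dist x q ^ ((2 : ℝ) - d)) →
    a q ≤ C * (ε + ε ^ (-((sobExp d : ℝ) / 2)) *
      ((16 : ℝ) ^ ((d : ℝ) - 2) * M) ^ (1 - (sobExp d : ℝ) / 2)) *
      (M * dist q p ^ ((2 : ℝ) - d)) := by
  obtain ⟨C₁, hC₁, hUE⟩ := exists_UE_le (lam := lam) hd hlam
  have hcK := cutK_pos
  set L : ℝ := (16 : ℝ) ^ ((d : ℝ) - 2) with hL
  have hLpos : 0 < L := by positivity
  refine ⟨9 * cutK ^ 2 / lam * 64 * C₁ * L, by positivity, ?_⟩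
  intro W T p q a b Da Db ha hb hT hpq M ε hM hε hbda hbdb
  have hdr : (3 : ℝ) ≤ d := by exact_mod_cast hd
  set h : ℝ := (sobExp d : ℝ) / 2 with hh
  have hh' : h = d / (d - 2) := by
    rw [hh, sobExp_coe hd]
    ring
  set r := dist q p with hr
  have hr0 : 0 < r := dist_pos.2 hpq.symm
  set M' : ℝ := L * M * r ^ ((2 : ℝ) - d) with hM'
  have hM'pos : 0 < M' := by positivity
  have hscale : ∀ t : ℝ, r / 16 ≤ t → M * t ^ ((2 : ℝ) - d) ≤ M' := by
    intro t ht
    have g1 : t ^ ((2 : ℝ) - d) ≤ (r / 16) ^ ((2 : ℝ) - d) :=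
      Real.rpow_le_rpow_of_nonpos (by positivity) ht (by linarith)
    have g2 : (r / 16) ^ ((2 : ℝ) - d) = L * r ^ ((2 : ℝ) - d) := by
      rw [Real.div_rpow hr0.le (by norm_num), hL, show (d : ℝ) - 2 = -(2 - d) by ring,
        Real.rpow_neg (by norm_num)]
      ring
    rw [g2] at g1
    calc M * t ^ ((2 : ℝ) - d) ≤ M * (L * r ^ ((2 : ℝ) - d)) := by gcongr
      _ = M' := by rw [hM']; ring
  set θ : ℝ := ε + ε ^ (-h) * (L * M) ^ (1 - h) with hθ
  have hθpos : 0 < θ := by positivity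
  have hval : ε * M' * r ^ 2 + M' ^ 2 * (ε * M') ^ (-h) = M' * r ^ 2 * θ := by
    have g1 : M' ^ 2 * (ε * M') ^ (-h) = M' * (ε ^ (-h) * M' ^ (1 - h)) := by
      rw [Real.mul_rpow hε.le hM'pos.le, Real.rpow_sub hM'pos, Real.rpow_one,
        Real.rpow_neg hM'pos.le]
      field_simp
    have g2 : M' ^ (1 - h) = (L * M) ^ (1 - h) * r ^ 2 := by
      rw [hM', Real.mul_rpow (by positivity) (by positivity), ← Real.rpow_mul hr0.le]
      have : ((2 : ℝ) - d) * (1 - h) = (2 : ℕ) := by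
        rw [hh']
        have : (d : ℝ) - 2 ≠ 0 := by linarith
        field_simp
        push_cast
        ring
      rw [this, Real.rpow_natCast]
    rw [g1, g2, hθ]
    ring
  have v1 : UE a (closedBall q (3 * (r / 8))) ≤ ENNReal.ofReal (C₁ * (M' * r ^ 2 * θ)) := by
    rw [← hval]
    refine hUE W T p a Da ha hT (ε * M') r M' _ (by positivity) hr0 hM'pos.le
      measurableSet_closedBall ?_ ?_
    · rw [volume_closedBall_eq (by omega) _ (by positivity)]
      gcongr
      linarith
    · intro x hx
      have hx' := mem_closedBall.1 hx
      have h3 : r / 16 ≤ dist x p := by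
        have := dist_triangle q x p
        rw [dist_comm q x] at this
        linarith
      exact (hbda x (dist_pos.1 (by linarith))).trans (hscale _ h3)
  have v2 : UE b (shell q (r / 8 / 2) (4 * (r / 8))) ≤ ENNReal.ofReal (C₁ * (M' * r ^ 2 * θ)) := by
    rw [← hval]
    refine hUE W.transpose T q b Db hb hT (ε * M') r M' _ (by positivity) hr0 hM'pos.le
      (measurableSet_shell _ _ _) ?_ ?_
    · refine (volume_shell_le _ _ (by positivity)).trans ?_
      gcongr
      linarith
    · intro x hx
      have h3 : r / 16 ≤ dist x q := by linarith [hx.1]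
      exact (hbdb x (dist_pos.1 (by linarith))).trans (hscale _ h3)
  have key := (ha.sq_le_UE_mul_UE hb hd hlam hT (s := r / 8) (by positivity) (by linarith)).trans
    (mul_le_mul' le_rfl (mul_le_mul' v1 v2))
  rw [← ENNReal.ofReal_mul (by positivity), ← ENNReal.ofReal_mul (by positivity),
    ENNReal.ofReal_le_ofReal_iff (by positivity)] at key
  have hfin : a q ^ 2 ≤ (9 * cutK ^ 2 / lam * 64 * C₁ * M' * θ) ^ 2 := by
    refine key.trans (le_of_eq ?_)
    field_simp
    ring
  have := abs_le_of_sq_le_sq' hfin (by positivity)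
  refine this.2.trans (le_of_eq ?_)
  rw [hM']
  ring

end

section

variable {d : ℕ} {lam : ℝ}

/-- Uniform pointwise bound for the Green function in dimension at least three. -/
lemma exists_green_bound (hd : 3 ≤ d) (hlam : 0 < lam) : ∃ M : ℝ, 0 < M ∧
    ∀ (W : CoeffField d lam) (T : ℝ) (G : E d → E d → ℝ) (DxG DyG : E d → E d → Fin d → ℝ),
    0 < T → IsGreenFunction W T G DxG DyG →
    ∀ x y, x ≠ y → G x y ≤ M * dist x y ^ ((2 : ℝ) - d) := by
  obtain ⟨C, hC, himp⟩ := exists_bound_improvement (lam := lam) hd hlam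
  have hdr : (3 : ℝ) ≤ d := by exact_mod_cast hd
  set h : ℝ := (sobExp d : ℝ) / 2 with hh
  have hh' : h = d / (d - 2) := by
    rw [hh, sobExp_coe hd]
    ring
  have hh1 : 0 < h - 1 := by
    rw [hh', sub_pos, lt_div_iff₀ (by linarith)]
    linarith
  set L : ℝ := (16 : ℝ) ^ ((d : ℝ) - 2) with hL
  have hLpos : 0 < L := by positivity
  set ε : ℝ := (4 * C)⁻¹ with hε
  have hεpos : 0 < ε := by positivity
  obtain ⟨M₀, hM₀, hM₀'⟩ : ∃ M₀ : ℝ, 0 < M₀ ∧ ∀ M, M₀ ≤ M → C * (ε ^ (-h) * (L * M) ^ (1 - h)) ≤ 1 / 4 := by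
    have ht : Tendsto (fun M : ℝ => C * (ε ^ (-h) * (L * M) ^ (-(h - 1)))) atTop
        (𝓝 (C * (ε ^ (-h) * 0))) :=
      (((tendsto_rpow_neg_atTop hh1).comp (tendsto_id.const_mul_atTop hLpos)).const_mul _).const_mul _
    rw [mul_zero, mul_zero] at ht
    obtain ⟨M₁, h1⟩ := eventually_atTop.1 (ht.eventually (Iio_mem_nhds (by norm_num : (0 : ℝ) < 1 / 4)))
    refine ⟨max M₁ 1, by positivity, fun M hM => ?_⟩
    have := (h1 M ((le_max_left _ _).trans hM)).le
    rwa [neg_sub] at this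
  refine ⟨M₀, hM₀, ?_⟩
  intro W T G DxG DyG hT hG
  obtain ⟨c, C', hc, hC', hprops⟩ := hG
  set S : Set ℝ := {t | ∃ x y : E d, x ≠ y ∧ t = G x y * dist x y ^ ((d : ℝ) - 2)} with hS
  have hinv : ∀ {x y : E d}, x ≠ y →
      dist x y ^ ((d : ℝ) - 2) * dist x y ^ ((2 : ℝ) - d) = 1 := by
    intro x y hxy
    rw [← Real.rpow_add (dist_pos.2 hxy)]
    simp
  have hSb : BddAbove S := by
    refine ⟨C', ?_⟩
    rintro t ⟨x, y, hxy, rfl⟩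
    have hp := dist_pos.2 hxy
    have h1 := hprops.2.2.1 x y hxy
    unfold gBound at h1
    rw [if_neg (by omega)] at h1
    have h2 : Real.exp (-(c * dist x y) / Real.sqrt T) ≤ 1 :=
      Real.exp_le_one_iff.2 (div_nonpos_of_nonpos_of_nonneg
        (neg_nonpos.2 (by positivity)) (Real.sqrt_nonneg _))
    calc G x y * dist x y ^ ((d : ℝ) - 2) ≤ C' * (1 * dist x y ^ ((2 : ℝ) - d)) *
          dist x y ^ ((d : ℝ) - 2) := by
          refine mul_le_mul_of_nonneg_right (h1.trans ?_) (by positivity)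
          gcongr
      _ = C' * (dist x y ^ ((d : ℝ) - 2) * dist x y ^ ((2 : ℝ) - d)) := by ring
      _ = C' := by rw [hinv hxy, mul_one]
  have hbd : ∀ M, (∀ t ∈ S, t ≤ M) → ∀ x y, x ≠ y → G x y ≤ M * dist x y ^ ((2 : ℝ) - d) := by
    intro M hM x y hxy
    have h1 := hM _ ⟨x, y, hxy, rfl⟩
    calc G x y = G x y * (dist x y ^ ((d : ℝ) - 2) * dist x y ^ ((2 : ℝ) - d)) := by
          rw [hinv hxy, mul_one]
      _ = G x y * dist x y ^ ((d : ℝ) - 2) * dist x y ^ ((2 : ℝ) - d) := by ring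
      _ ≤ _ := mul_le_mul_of_nonneg_right h1 (by positivity)
  refine hbd M₀ fun t ht => ?_
  by_contra hcon
  push Not at hcon
  have hsup := le_csSup hSb ht
  set M := sSup S with hMd
  have hMM : M₀ < M := hcon.trans_le hsup
  have hMpos : 0 < M := hM₀.trans hMM
  have hMb := hbd M fun t ht => le_csSup hSb ht
  have : M ≤ M / 2 := by
    refine csSup_le ⟨t, ht⟩ ?_
    rintro _ ⟨x, y, hxy, rfl⟩
    have key := himp W T y x (fun w => G w y) (fun w => G x w) (fun w => DxG w y) (fun w => DyG x w)
      (hprops.isFund_left hc hC' y) (hprops.isFund_right hc hC' x) hT hxy.symm M ε hMpos hεpos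
      (fun w hw => hMb w y hw) (fun w hw => by rw [dist_comm]; exact hMb x w hw.symm)
    have h1 : C * (ε + ε ^ (-h) * (L * M) ^ (1 - h)) ≤ 1 / 2 := by
      have := hM₀' M hMM.le
      have h2 : C * ε = 1 / 4 := by rw [hε]; field_simp
      rw [mul_add, h2]
      linarith
    have hp := dist_pos.2 hxy
    calc G x y * dist x y ^ ((d : ℝ) - 2) ≤ 1 / 2 * (M * dist x y ^ ((2 : ℝ) - d)) *
          dist x y ^ ((d : ℝ) - 2) := by
          refine mul_le_mul_of_nonneg_right (key.trans ?_) (by positivity)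
          exact mul_le_mul_of_nonneg_right h1 (by positivity)
      _ = M / 2 * (dist x y ^ ((d : ℝ) - 2) * dist x y ^ ((2 : ℝ) - d)) := by ring
      _ = M / 2 := by rw [hinv hxy, mul_one]
  linarith

/-- The exponential decay rate. -/
def decRate (lam : ℝ) : ℝ := Real.log 2 / (2 * decK lam)

lemma decRate_pos (hlam : 0 < lam) : 0 < decRate lam := by
  have h1 := decK_pos hlam
  have h2 := Real.log_pos one_lt_two
  unfold decRate
  positivity

lemma IsFund.UE_ext_le {W : CoeffField d lam} {T : ℝ} {p : E d} {u : E d → ℝ}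
    {Du : E d → Fin d → ℝ} (hu : IsFund W T p u Du) (hd : 2 ≤ d) (hlam : 0 < lam) (hT : 0 < T)
    {ρ : ℝ} (hρ : 0 < ρ) :
    UE u (ext p ρ) ≤ ENNReal.ofReal (128 * cutK ^ 2 / lam * (T / ρ ^ 2) *
      Real.exp (-(decRate lam * (ρ / Real.sqrt T)))) * UE u (shell p (ρ / 4) (ρ / 2)) := by
  have hcK := cutK_pos
  have h1 := hu.UE_ext_decay hd hlam hT (a := ρ / 2) (b := ρ) (by positivity) (by linarith)
  have h2 := le_ofReal_inv_mul (by positivity) (le_add_self.trans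
    (hu.cacc_ext hd hlam hT (a := ρ / 4) (b := ρ / 2) (by positivity) (by linarith)))
  refine (h1.trans (mul_le_mul' le_rfl h2)).trans ?_
  rw [← mul_assoc, ← mul_assoc, ← ENNReal.ofReal_mul (by positivity),
    ← ENNReal.ofReal_mul (by positivity)]
  refine mul_le_mul' (ENNReal.ofReal_le_ofReal (le_of_eq ?_)) le_rfl
  have e1 : Real.log 2 / decK lam * ((ρ - ρ / 2) / Real.sqrt T) =
      decRate lam * (ρ / Real.sqrt T) := by
    unfold decRate
    have := decK_pos hlam
    field_simp
    ring
  rw [e1]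
  have e2 : ρ / 2 - ρ / 4 = ρ / 4 := by ring
  rw [e2]
  field_simp
  ring

lemma min_decay_le {T ρ K κ : ℝ} (hT : 0 < T) (hρ : 0 < ρ) (hK : 0 ≤ K) (hκ : 0 < κ) {X A : ℝ≥0∞}
    (h1 : X ≤ A) (h2 : X ≤ ENNReal.ofReal (K * (T / ρ ^ 2) *
      Real.exp (-(κ * (ρ / Real.sqrt T)))) * A) :
    X ≤ ENNReal.ofReal ((K + Real.exp κ) * Real.exp (-(κ * (ρ / Real.sqrt T)))) * A := by
  have hsT : 0 < Real.sqrt T := Real.sqrt_pos.2 hT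
  rcases le_total (Real.sqrt T) ρ with h | h
  · refine h2.trans (mul_le_mul' (ENNReal.ofReal_le_ofReal ?_) le_rfl)
    refine mul_le_mul_of_nonneg_right ?_ (by positivity)
    have : T / ρ ^ 2 ≤ 1 := by
      rw [div_le_one (by positivity), ← Real.sq_sqrt hT.le]
      exact pow_le_pow_left₀ hsT.le h 2
    have := mul_le_of_le_one_right hK this
    have := Real.exp_pos κ
    linarith
  · calc X ≤ ENNReal.ofReal 1 * A := by simpa using h1
      _ ≤ _ := by
        refine mul_le_mul' (ENNReal.ofReal_le_ofReal ?_) le_rfl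
        rw [add_mul, ← Real.exp_add]
        have : ρ / Real.sqrt T ≤ 1 := (div_le_one hsT).2 h
        have h3 : 1 ≤ Real.exp (κ + -(κ * (ρ / Real.sqrt T))) := Real.one_le_exp (by nlinarith)
        have h4 : 0 ≤ K * Real.exp (-(κ * (ρ / Real.sqrt T))) := by positivity
        linarith

end

section

variable {d : ℕ} {lam : ℝ}

/-- Uniform pointwise decay of the Green function in dimension at least three. -/
lemma exists_green_decay (hd : 3 ≤ d) (hlam : 0 < lam) : ∃ c M : ℝ, 0 < c ∧ 0 < M ∧
    ∀ (W : CoeffField d lam) (T : ℝ) (G : E d → E d → ℝ) (DxG DyG : E d → E d → Fin d → ℝ),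
    0 < T → IsGreenFunction W T G DxG DyG →
    ∀ x y, x ≠ y → G x y ≤ M * dist x y ^ ((2 : ℝ) - d) *
      Real.exp (-(c * (dist x y / Real.sqrt T))) := by
  obtain ⟨M, hM, hG0⟩ := exists_green_bound (lam := lam) hd hlam
  have hcK := cutK_pos
  have hκ := decRate_pos hlam
  have hdr : (3 : ℝ) ≤ d := by exact_mod_cast hd
  set L : ℝ := (16 : ℝ) ^ ((d : ℝ) - 2) with hL
  have hLpos : 0 < L := by positivity
  set V : ℝ := (volume (ball (0 : E d) 1)).toReal + 1 with hV
  have hVpos : 0 < V := by positivity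
  have hVle : volume (ball (0 : E d) 1) ≤ ENNReal.ofReal V := by
    rw [ENNReal.le_ofReal_iff_toReal_le measure_ball_lt_top.ne hVpos.le]
    linarith
  set K : ℝ := 128 * cutK ^ 2 / lam + Real.exp (decRate lam) with hK
  have hKpos : 0 < K := by positivity
  refine ⟨decRate lam / 4, 576 * cutK ^ 2 / lam * Real.sqrt K * (L * M) ^ 2 * V, by positivity,
    by positivity, ?_⟩
  intro W T G DxG DyG hT hG x y hxy
  have hGb := hG0 W T G DxG DyG hT hG
  obtain ⟨c, C', hc, hC', hprops⟩ := hG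
  have ha := hprops.isFund_left hc hC' y
  have hb := hprops.isFund_right hc hC' x
  set r := dist x y with hr
  have hr0 : 0 < r := dist_pos.2 hxy
  set M' : ℝ := L * M * r ^ ((2 : ℝ) - d) with hM'
  have hM'pos : 0 < M' := by positivity
  have hscale : ∀ t : ℝ, r / 16 ≤ t → M * t ^ ((2 : ℝ) - d) ≤ M' := by
    intro t ht
    have g1 : t ^ ((2 : ℝ) - d) ≤ (r / 16) ^ ((2 : ℝ) - d) :=
      Real.rpow_le_rpow_of_nonpos (by positivity) ht (by linarith)
    have g2 : (r / 16) ^ ((2 : ℝ) - d) = L * r ^ ((2 : ℝ) - d) := by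
      rw [Real.div_rpow hr0.le (by norm_num), hL, show (d : ℝ) - 2 = -(2 - d) by ring,
        Real.rpow_neg (by norm_num)]
      ring
    rw [g2] at g1
    calc M * t ^ ((2 : ℝ) - d) ≤ M * (L * r ^ ((2 : ℝ) - d)) := by gcongr
      _ = M' := by rw [hM']; ring
  have hval : M' ^ 2 * r ^ d = M' * (L * M) * r ^ 2 := by
    have : r ^ ((2 : ℝ) - d) * r ^ d = r ^ 2 := by
      rw [← Real.rpow_natCast r d, ← Real.rpow_add hr0, ← Real.rpow_natCast r 2]
      congr 1
      push_cast
      ring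
    rw [← this, hM']
    ring
  set A : ℝ≥0∞ := ENNReal.ofReal (M' * (L * M) * r ^ 2 * V) with hA
  have hball : ∀ s : ℝ, 0 ≤ s → s ≤ r →
      ENNReal.ofReal (M' ^ 2) * (ENNReal.ofReal (s ^ d) * volume (ball (0 : E d) 1)) ≤ A := by
    intro s hs hsr
    rw [hA, ← hval, ENNReal.ofReal_mul (by positivity), ENNReal.ofReal_mul (by positivity),
      ← mul_assoc]
    gcongr
  have hfx : ∀ t, t ≠ y → r / 16 ≤ dist t y → |G t y| ≤ M' := fun t hty ht => by
    rw [abs_of_nonneg (ha.nonneg t)]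
    exact (hGb t y hty).trans (hscale _ ht)
  have hfy : ∀ t, t ≠ x → r / 16 ≤ dist t x → |G x t| ≤ M' := fun t hty ht => by
    rw [abs_of_nonneg (hb.nonneg t)]
    refine (hGb x t hty.symm).trans (hscale _ ?_)
    rwa [dist_comm]
  have hsub : closedBall x (3 * (r / 8)) ⊆ ext y (r / 2) := by
    intro t ht
    have h1 := mem_closedBall.1 ht
    have := dist_triangle x t y
    rw [dist_comm x t] at this
    change r / 2 < dist t y
    linarith
  have v1 : UE (fun t => G t y) (closedBall x (3 * (r / 8))) ≤
      ENNReal.ofReal (K * Real.exp (-(decRate lam * (r / 2 / Real.sqrt T)))) * A := by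
    refine min_decay_le hT (by positivity) (by positivity) hκ ?_ ?_
    · refine (UE_le_of_abs_le measurableSet_closedBall (c := M') fun t ht => ?_).trans ?_
      · have : r / 2 < dist t y := hsub ht
        exact hfx t (dist_pos.1 (by linarith)) (by linarith)
      · rw [volume_closedBall_eq (by omega) _ (by positivity)]
        exact hball _ (by positivity) (by linarith)
    · refine (UE_mono hsub).trans ((ha.UE_ext_le (by omega) hlam hT (by positivity)).trans
        (mul_le_mul' le_rfl ?_))
      refine (UE_le_of_abs_le (measurableSet_shell _ _ _) (c := M') fun t ht => ?_).trans ?_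
      · have := ht.1
        exact hfx t (dist_pos.1 (by linarith)) (by linarith)
      · exact (mul_le_mul' le_rfl (volume_shell_le _ _ (by positivity))).trans
          (hball _ (by positivity) (by linarith))
  have v2 : UE (fun t => G x t) (shell x (r / 8 / 2) (4 * (r / 8))) ≤ A := by
    refine (UE_le_of_abs_le (measurableSet_shell _ _ _) (c := M') fun t ht => ?_).trans ?_
    · have := ht.1
      exact hfy t (dist_pos.1 (by linarith)) (by linarith)
    · exact (mul_le_mul' le_rfl (volume_shell_le _ _ (by positivity))).trans
          (hball _ (by positivity) (by linarith))
  have key := (ha.sq_le_UE_mul_UE hb hd hlam hT (s := r / 8) (by positivity)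
    (by linarith)).trans (mul_le_mul' le_rfl (mul_le_mul' v1 v2))
  rw [hA, ← ENNReal.ofReal_mul (by positivity), ← ENNReal.ofReal_mul (by positivity),
    ← ENNReal.ofReal_mul (by positivity), ENNReal.ofReal_le_ofReal_iff (by positivity)] at key
  have hexp : Real.exp (-(decRate lam * (r / 2 / Real.sqrt T))) =
      Real.exp (-(decRate lam / 4 * (r / Real.sqrt T))) ^ 2 := by
    rw [← Real.exp_nat_mul]
    congr 1
    push_cast
    ring
  have hfin : G x y ^ 2 ≤ (576 * cutK ^ 2 / lam * Real.sqrt K * (L * M) * M' * V *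
      Real.exp (-(decRate lam / 4 * (r / Real.sqrt T)))) ^ 2 := by
    refine key.trans (le_of_eq ?_)
    rw [hexp]
    have hsq : Real.sqrt K ^ 2 = K := Real.sq_sqrt hKpos.le
    simp only [mul_pow, hsq]
    field_simp
    ring
  have := abs_le_of_sq_le_sq' hfin (by positivity)
  refine this.2.trans (le_of_eq ?_)
  rw [hM']
  ring

/-- The gradient estimate in dimension at least three. -/
lemma exists_gradient_bound_of_three_le (hd : 3 ≤ d) (hlam : 0 < lam) {R : ℝ} (hR : 1 ≤ R) :
    ∃ c C : ℝ, 0 < c ∧ 0 < C ∧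
      ∀ (W : CoeffField d lam) (T : ℝ), 0 < T →
      ∀ (G : E d → E d → ℝ) (DxG DyG : E d → E d → Fin d → ℝ),
        IsGreenFunction W T G DxG DyG →
      ∀ z : E d, 2*R < dist z 0 →
        (∫⁻ y in ball z R, ENNReal.ofReal (DxG y 0 ⬝ᵥ DxG y 0)) ^ ((1:ℝ)/2) ≤
          ENNReal.ofReal (C * Real.exp (-(c * dist z 0) / Real.sqrt T) *
            dist z 0 ^ ((2:ℝ) - (d:ℝ))) := by
  obtain ⟨κ, M, hκ, hM, hdec⟩ := exists_green_decay (lam := lam) hd hlam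
  have hcK := cutK_pos
  have hdr : (3 : ℝ) ≤ d := by exact_mod_cast hd
  set L : ℝ := (4 : ℝ) ^ ((d : ℝ) - 2) with hL
  have hLpos : 0 < L := by positivity
  set V : ℝ := (volume (ball (0 : E d) 1)).toReal + 1 with hV
  have hVpos : 0 < V := by positivity
  have hVle : volume (ball (0 : E d) 1) ≤ ENNReal.ofReal V := by
    rw [ENNReal.le_ofReal_iff_toReal_le measure_ball_lt_top.ne hVpos.le]
    linarith
  set D : ℝ := (lam / 2)⁻¹ * (2 / lam * (cutK / (3 / 2 * R - R)) ^ 2) * ((3 / 2 * R) ^ d * V) with hD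
  have hDpos : 0 < D := by
    have : 0 < 3 / 2 * R - R := by linarith
    positivity
  refine ⟨κ / 4, M * L * Real.sqrt D, by positivity, by positivity, ?_⟩
  intro W T hT G DxG DyG hG z hz
  have hGb := hdec W T G DxG DyG hT hG
  obtain ⟨c, C', hc, hC', hprops⟩ := hG
  have ha := hprops.isFund_left hc hC' 0
  set r := dist z 0 with hr
  have hr0 : 0 < r := by linarith
  set X : ℝ := Real.exp (-(κ / 4 * r) / Real.sqrt T) * r ^ ((2:ℝ) - (d:ℝ)) with hX
  have hXpos : 0 < X := by positivity
  have hpt : ∀ t ∈ shell z R (3 / 2 * R), |G t 0 - 0| ≤ M * L * X := by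
    intro t ht
    have h1 : r / 4 ≤ dist t 0 := by
      have := dist_triangle z t 0
      rw [dist_comm z t] at this
      linarith [ht.2]
    rw [sub_zero, abs_of_nonneg (ha.nonneg t)]
    refine (hGb t 0 (dist_pos.1 (by linarith))).trans ?_
    have g1 : dist t 0 ^ ((2 : ℝ) - d) ≤ (r / 4) ^ ((2 : ℝ) - d) :=
      Real.rpow_le_rpow_of_nonpos (by positivity) h1 (by linarith)
    have g2 : (r / 4) ^ ((2 : ℝ) - d) = L * r ^ ((2 : ℝ) - d) := by
      rw [Real.div_rpow hr0.le (by norm_num), hL, show (d : ℝ) - 2 = -(2 - d) by ring,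
        Real.rpow_neg (by norm_num)]
      ring
    have g3 : Real.exp (-(κ * (dist t 0 / Real.sqrt T))) ≤
        Real.exp (-(κ / 4 * r) / Real.sqrt T) := by
      refine Real.exp_le_exp.2 ?_
      rw [neg_div, neg_le_neg_iff]
      calc κ / 4 * r / Real.sqrt T = κ * (r / 4 / Real.sqrt T) := by ring
        _ ≤ _ := by gcongr
    rw [g2] at g1
    calc _ ≤ M * (L * r ^ ((2 : ℝ) - d)) * Real.exp (-(κ / 4 * r) / Real.sqrt T) := by gcongr
      _ = _ := by rw [hX]; ring
  have hca := le_ofReal_inv_mul (by positivity) (le_self_add.trans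
    (ha.cacc_ball hlam hT (z := z) (a := R) (b := 3 / 2 * R) (by linarith) (by linarith)
      (by linarith) 0))
  have hU : UE (fun x => G x 0 - 0) (shell z R (3 / 2 * R)) ≤
      ENNReal.ofReal ((M * L * X) ^ 2 * ((3 / 2 * R) ^ d * V)) := by
    refine (UE_le_of_abs_le (measurableSet_shell _ _ _) hpt).trans ?_
    rw [ENNReal.ofReal_mul (by positivity)]
    refine mul_le_mul' le_rfl ((volume_shell_le _ _ (by positivity)).trans ?_)
    rw [ENNReal.ofReal_mul (by positivity)]
    gcongr
  have hE : DE (fun x => DxG x 0) (ball z R) ≤ ENNReal.ofReal ((M * L * Real.sqrt D * X) ^ 2) := by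
    refine (DE_mono ball_subset_closedBall).trans (hca.trans ?_)
    simp only [ne_eq, OfNat.ofNat_ne_zero, not_false_eq_true, zero_pow, mul_zero, zero_div,
      ENNReal.ofReal_zero, zero_mul, zero_add]
    refine (mul_le_mul' le_rfl (mul_le_mul' le_rfl hU)).trans (le_of_eq ?_)
    rw [← ENNReal.ofReal_mul (by positivity), ← ENNReal.ofReal_mul (by positivity)]
    congr 1
    rw [mul_pow (M * L * Real.sqrt D), mul_pow (M * L) (Real.sqrt D), Real.sq_sqrt hDpos.le, hD]
    ring
  calc _ ≤ (ENNReal.ofReal ((M * L * Real.sqrt D * X) ^ 2)) ^ ((1 : ℝ) / 2) :=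
        ENNReal.rpow_le_rpow hE (by norm_num)
    _ = ENNReal.ofReal (M * L * Real.sqrt D * X) := by
        rw [ENNReal.ofReal_rpow_of_nonneg (by positivity) (by norm_num), ← Real.sqrt_eq_rpow,
          Real.sqrt_sq (by positivity)]
    _ = _ := by rw [hX, ← mul_assoc]

end

/-- Polar coordinates around `q` in the plane. -/
def polarPt (q : E 2) (p : ℝ × ℝ) : E 2 := q + !₂[p.1 * Real.cos p.2, p.1 * Real.sin p.2]

lemma dist_polarPt (q : E 2) (p : ℝ × ℝ) : dist (polarPt q p) q = |p.1| := by
  rw [polarPt, dist_eq_norm, add_sub_cancel_left, EuclideanSpace.norm_eq, ← Real.sqrt_sq_eq_abs]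
  congr 1
  simp only [Real.norm_eq_abs, sq_abs, Fin.sum_univ_two, Matrix.cons_val_zero,
    Matrix.cons_val_one]
  linear_combination p.1 ^ 2 * Real.sin_sq_add_cos_sq p.2

lemma continuous_polarPt (q : E 2) : Continuous (polarPt q) := by
  unfold polarPt
  refine continuous_const.add ((PiLp.continuous_toLp 2 _).comp (continuous_pi fun i => ?_))
  fin_cases i
  · simp only [Fin.zero_eta, Matrix.cons_val_zero]
    fun_prop
  · simp only [Fin.mk_one, Matrix.cons_val_one]
    fun_prop

lemma lintegral_polarPt (q : E 2) (f : E 2 → ℝ≥0∞) :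
    ∫⁻ x, f x = ∫⁻ p in Set.Ioi (0 : ℝ) ×ˢ Set.Ioo (-Real.pi) Real.pi,
      ENNReal.ofReal p.1 * f (polarPt q p) := by
  have h1 := (volume_preserving_finTwoArrow ℝ).symm.lintegral_comp_emb
    (MeasurableEquiv.finTwoArrow (α := ℝ)).symm.measurableEmbedding
    (fun v => f (q + WithLp.toLp 2 v))
  have h2 := (EuclideanSpace.volume_preserving_symm_measurableEquiv_toLp (Fin 2)).symm.lintegral_comp_emb
    (MeasurableEquiv.toLp 2 (Fin 2 → ℝ)).measurableEmbedding (fun x => f (q + x))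
  rw [← lintegral_add_left_eq_self f q, ← h2]
  refine h1.symm.trans ?_
  rw [← lintegral_comp_polarCoord_symm]
  rfl

lemma lintegral_shell_polarPt (q : E 2) {a b : ℝ} (ha : 0 ≤ a) (f : E 2 → ℝ≥0∞) :
    ∫⁻ x in shell q a b, f x = ∫⁻ p in Set.Ioo a b ×ˢ Set.Ioo (-Real.pi) Real.pi,
      ENNReal.ofReal p.1 * f (polarPt q p) := by
  rw [← lintegral_indicator (measurableSet_shell q a b), lintegral_polarPt q,
    ← lintegral_indicator (measurableSet_Ioi.prod measurableSet_Ioo),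
    ← lintegral_indicator (measurableSet_Ioo.prod measurableSet_Ioo)]
  congr 1
  funext p
  by_cases h : p ∈ Set.Ioo a b ×ˢ Set.Ioo (-Real.pi) Real.pi
  · have h0 : 0 < p.1 := ha.trans_lt h.1.1
    have hs : polarPt q p ∈ shell q a b := by
      change a < dist _ q ∧ dist _ q < b
      rw [dist_polarPt, abs_of_pos h0]
      exact h.1
    rw [Set.indicator_of_mem h,
      Set.indicator_of_mem (show p ∈ Set.Ioi (0 : ℝ) ×ˢ Set.Ioo (-Real.pi) Real.pi from ⟨h0, h.2⟩), Set.indicator_of_mem hs]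
  · rw [Set.indicator_of_notMem h]
    by_cases h' : p ∈ Set.Ioi (0 : ℝ) ×ˢ Set.Ioo (-Real.pi) Real.pi
    · rw [Set.indicator_of_mem h', Set.indicator_of_notMem, mul_zero]
      intro hs
      change a < dist _ q ∧ dist _ q < b at hs
      rw [dist_polarPt, abs_of_pos h'.1] at hs
      exact h ⟨hs, h'.2⟩
    · rw [Set.indicator_of_notMem h']

/-- A function of two variables whose increments are controlled by one-variable functions. -/
lemma lintegral_lintegral_sq_le {μ ν : Measure ℝ} [SFinite μ] [SFinite ν] {h : ℝ × ℝ → ℝ}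
    {α β : ℝ → ℝ≥0∞} (hα : Measurable α) (hβ : Measurable β) {S : Set (ℝ × ℝ)}
    (hS : ∀ᵐ p ∂(μ.prod ν), p ∈ S)
    (h1 : ∀ p ∈ S, ∀ p' ∈ S, ENNReal.ofReal |h p - h p'| ≤ α p.2 + β p'.1)
    (h2 : ∀ p ∈ S, ∀ p' ∈ S, ENNReal.ofReal |h p - h p'| ≤ β p.1 + α p'.2) :
    ∫⁻ p, ∫⁻ p', ENNReal.ofReal ((h p - h p') ^ 2) ∂(μ.prod ν) ∂(μ.prod ν) ≤
      ((∫⁻ t, α t ∂ν) * μ Set.univ + (∫⁻ s, β s ∂μ) * ν Set.univ) ^ 2 := by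
  set A := ∫⁻ t, α t ∂ν
  set B := ∫⁻ s, β s ∂μ
  have hin : ∀ p ∈ S, ∫⁻ p', ENNReal.ofReal ((h p - h p') ^ 2) ∂(μ.prod ν) ≤
      (β p.1 * ν Set.univ + A) * (α p.2 * μ Set.univ + B) := by
    intro p hp
    calc _ ≤ ∫⁻ p', (α p.2 + β p'.1) * (β p.1 + α p'.2) ∂(μ.prod ν) := by
          refine lintegral_mono_ae ?_
          filter_upwards [hS] with p' hp'
          rw [← sq_abs, ENNReal.ofReal_pow (abs_nonneg _), sq]
          exact mul_le_mul' (h1 p hp p' hp') (h2 p hp p' hp')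
      _ = (∫⁻ s, (α p.2 + β s) ∂μ) * ∫⁻ t, (β p.1 + α t) ∂ν :=
          lintegral_prod_mul (f := fun s => α p.2 + β s) (g := fun t => β p.1 + α t)
            (by fun_prop) (by fun_prop)
      _ = _ := by
          rw [lintegral_add_left measurable_const, lintegral_add_left measurable_const,
            lintegral_const, lintegral_const, mul_comm]
  calc _ ≤ ∫⁻ p, (β p.1 * ν Set.univ + A) * (α p.2 * μ Set.univ + B) ∂(μ.prod ν) := by
        refine lintegral_mono_ae ?_
        filter_upwards [hS] with p hp using hin p hp
    _ = (∫⁻ s, (β s * ν Set.univ + A) ∂μ) * ∫⁻ t, (α t * μ Set.univ + B) ∂ν :=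
        lintegral_prod_mul (f := fun s => β s * ν Set.univ + A)
          (g := fun t => α t * μ Set.univ + B) (by fun_prop) (by fun_prop)
    _ = _ := by
        rw [lintegral_add_right _ measurable_const, lintegral_add_right _ measurable_const,
          lintegral_const, lintegral_const, lintegral_mul_const _ hβ, lintegral_mul_const _ hα, sq,
          add_comm (B * ν Set.univ)]

lemma ofReal_abs_sub_le_lintegral {f f' M : ℝ → ℝ} (hf : ∀ t, HasDerivAt f (f' t) t)
    (hf' : Continuous f') {a b : ℝ} (hM : ∀ t ∈ Set.Ioo a b, |f' t| ≤ M t) {x y : ℝ}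
    (hx : x ∈ Set.Ioo a b) (hy : y ∈ Set.Ioo a b) :
    ENNReal.ofReal |f x - f y| ≤ ∫⁻ t in Set.Ioo a b, ENNReal.ofReal (M t) := by
  have h1 : ∫ t in y..x, f' t = f x - f y :=
    intervalIntegral.integral_eq_sub_of_hasDerivAt (fun t _ => hf t) (hf'.intervalIntegrable _ _)
  rw [← h1, ← Real.norm_eq_abs, ofReal_norm, intervalIntegral.intervalIntegral_eq_integral_uIoc,
    enorm_smul]
  have h2 : ‖if y ≤ x then (1 : ℝ) else -1‖ₑ = 1 := by
    split_ifs <;> simp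
  rw [h2, one_mul]
  refine (enorm_integral_le_lintegral_enorm _).trans ?_
  have h3 : Set.uIoc y x ⊆ Set.Ioo a b := by
    intro t ht
    rw [Set.mem_uIoc] at ht
    rcases ht with ht | ht
    · exact ⟨hy.1.trans ht.1, ht.2.trans_lt hx.2⟩
    · exact ⟨hx.1.trans ht.1, ht.2.trans_lt hy.2⟩
  refine (lintegral_mono_set h3).trans (setLIntegral_mono_ae' measurableSet_Ioo
    (ae_of_all _ fun t ht => ?_))
  rw [Real.enorm_eq_ofReal_abs]
  exact ENNReal.ofReal_le_ofReal (hM t ht)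

/-- The constant in the Poincaré inequality on the shell of radii `a < b`. -/
def shellK (a b : ℝ) : ℝ := b * ((b - a) / a + 2 * Real.pi)

lemma hasDerivAt_polarPt_fst (q : E 2) (s t : ℝ) :
    HasDerivAt (fun s => polarPt q (s, t)) (!₂[Real.cos t, Real.sin t] : E 2) s := by
  unfold polarPt
  refine HasDerivAt.const_add _ ?_
  have h : HasDerivAt (fun s => ![s * Real.cos t, s * Real.sin t]) ![Real.cos t, Real.sin t] s := by
    refine hasDerivAt_pi.2 fun i => ?_
    fin_cases i
    · simpa using (hasDerivAt_id s).mul_const (Real.cos t)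
    · simpa using (hasDerivAt_id s).mul_const (Real.sin t)
  exact (PiLp.hasFDerivAt_toLp (𝕜 := ℝ) 2 _).comp_hasDerivAt s h

lemma hasDerivAt_polarPt_snd (q : E 2) (s t : ℝ) :
    HasDerivAt (fun t => polarPt q (s, t)) (!₂[s * (-Real.sin t), s * Real.cos t] : E 2) t := by
  unfold polarPt
  refine HasDerivAt.const_add _ ?_
  have h : HasDerivAt (fun t => ![s * Real.cos t, s * Real.sin t])
      ![s * (-Real.sin t), s * Real.cos t] t := by
    refine hasDerivAt_pi.2 fun i => ?_
    fin_cases i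
    · simpa using (Real.hasDerivAt_cos t).const_mul s
    · simpa using (Real.hasDerivAt_sin t).const_mul s
  exact (PiLp.hasFDerivAt_toLp (𝕜 := ℝ) 2 _).comp_hasDerivAt t h

lemma IsTestFun.hasDerivAt_comp {d : ℕ} {g : E d → ℝ} (hg : IsTestFun d g) {γ : ℝ → E d} {γ' : E d}
    {t : ℝ} (hγ : HasDerivAt γ γ' t) :
    HasDerivAt (fun t => g (γ t)) (fderiv ℝ g (γ t) γ') t :=
  ((hg.1.differentiable (by simp)) (γ t)).hasFDerivAt.comp_hasDerivAt t hγ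

lemma abs_fderiv_apply_le {d : ℕ} (g : E d → ℝ) (x v : E d) {m : ℝ} (hv : ‖v‖ ≤ m) :
    |fderiv ℝ g x v| ≤ m * ∑ i, |gradAt g x i| := by
  rw [← Real.norm_eq_abs]
  have h0 : 0 ≤ ∑ i, |gradAt g x i| := Finset.sum_nonneg fun i _ => abs_nonneg _
  calc _ ≤ ‖fderiv ℝ g x‖ * ‖v‖ := (fderiv ℝ g x).le_opNorm v
    _ ≤ (∑ i, |gradAt g x i|) * m :=
        mul_le_mul (enorm_fderiv_le_sum g x) hv (norm_nonneg _) h0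
    _ = _ := mul_comm _ _

lemma norm_cos_sin_eq_one (t : ℝ) : ‖(!₂[Real.cos t, Real.sin t] : E 2)‖ = 1 := by
  rw [EuclideanSpace.norm_eq, Real.sqrt_eq_one]
  simp

lemma norm_mul_sin_cos {s : ℝ} (hs : 0 ≤ s) (t : ℝ) :
    ‖(!₂[s * (-Real.sin t), s * Real.cos t] : E 2)‖ = s := by
  rw [EuclideanSpace.norm_eq, Real.sqrt_eq_iff_eq_sq (Finset.sum_nonneg fun i _ => sq_nonneg _) hs]
  simp only [Real.norm_eq_abs, sq_abs, Fin.sum_univ_two, Matrix.cons_val_zero, Matrix.cons_val_one]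
  linear_combination s ^ 2 * Real.sin_sq_add_cos_sq t

/-- The Poincaré inequality on planar shells for test functions. -/
lemma IsTestFun.poincare_shell {g : E 2 → ℝ} (hg : IsTestFun 2 g) (q : E 2) {a b : ℝ} (ha : 0 < a)
    (hab : a < b) :
    ∫⁻ x in shell q a b, ∫⁻ y in shell q a b, ENNReal.ofReal ((g x - g y) ^ 2) ≤
      ENNReal.ofReal (shellK a b ^ 2) *
        (∫⁻ x in shell q a b, ENNReal.ofReal (∑ i, |gradAt g x i|)) ^ 2 := by
  have hπ := Real.pi_pos
  set N : E 2 → ℝ := fun x => ∑ i, |gradAt g x i| with hN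
  have hNc : Continuous N := continuous_finsetSum _ fun i _ => (hg.gradAt_continuous i).abs
  have hN0 : ∀ x, 0 ≤ N x := fun x => Finset.sum_nonneg fun i _ => abs_nonneg _
  have hPc := continuous_polarPt q
  set I := Set.Ioo a b with hI
  set J := Set.Ioo (-Real.pi) Real.pi with hJ
  set h : ℝ × ℝ → ℝ := fun p => g (polarPt q p) with hh
  set α : ℝ → ℝ≥0∞ := fun t => ∫⁻ s in I, ENNReal.ofReal (N (polarPt q (s, t))) with hα
  set β : ℝ → ℝ≥0∞ := fun s => ∫⁻ t in J, ENNReal.ofReal (s * N (polarPt q (s, t))) with hβ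
  have hαm : Measurable α := by
    refine Measurable.lintegral_prod_left' (f := fun p : ℝ × ℝ => ENNReal.ofReal (N (polarPt q p))) ?_
    exact (hNc.comp hPc).measurable.ennreal_ofReal
  have hβm : Measurable β := by
    refine Measurable.lintegral_prod_right'
      (f := fun p : ℝ × ℝ => ENNReal.ofReal (p.1 * N (polarPt q p))) ?_
    exact (continuous_fst.mul (hNc.comp hPc)).measurable.ennreal_ofReal
  have hfc : Continuous (fderiv ℝ g) := hg.1.continuous_fderiv (by simp)
  have hrad : ∀ s ∈ I, ∀ s' ∈ I, ∀ t, ENNReal.ofReal |h (s, t) - h (s', t)| ≤ α t := by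
    intro s hs s' hs' t
    refine ofReal_abs_sub_le_lintegral (f := fun s => h (s, t))
      (fun s => hg.hasDerivAt_comp (hasDerivAt_polarPt_fst q s t)) ?_ (fun s _ => ?_) hs hs'
    · exact (hfc.comp (hPc.comp (by fun_prop))).clm_apply continuous_const
    · have := abs_fderiv_apply_le g (polarPt q (s, t)) _ (norm_cos_sin_eq_one t).le
      rwa [one_mul] at this
  have hang : ∀ s ∈ I, ∀ t ∈ J, ∀ t' ∈ J, ENNReal.ofReal |h (s, t) - h (s, t')| ≤ β s := by
    intro s hs t ht t' ht'
    refine ofReal_abs_sub_le_lintegral (f := fun t => h (s, t))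
      (fun t => hg.hasDerivAt_comp (hasDerivAt_polarPt_snd q s t)) ?_ (fun t _ => ?_) ht ht'
    · refine (hfc.comp (hPc.comp (by fun_prop))).clm_apply
        ((PiLp.continuous_toLp 2 _).comp (continuous_pi fun i => ?_))
      fin_cases i
      · simp only [Fin.zero_eta, Matrix.cons_val_zero]
        fun_prop
      · simp only [Fin.mk_one, Matrix.cons_val_one]
        fun_prop
    · exact abs_fderiv_apply_le g (polarPt q (s, t)) _
        (norm_mul_sin_cos (ha.le.trans hs.1.le) t).le
  have htri : ∀ x y z : ℝ, ENNReal.ofReal |x - z| ≤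
      ENNReal.ofReal |x - y| + ENNReal.ofReal |y - z| := fun x y z => by
    rw [← ENNReal.ofReal_add (abs_nonneg _) (abs_nonneg _)]
    exact ENNReal.ofReal_le_ofReal (abs_sub_le x y z)
  have hμν : (volume.restrict I).prod (volume.restrict J) =
      (volume : Measure (ℝ × ℝ)).restrict (I ×ˢ J) := by
    rw [Measure.prod_restrict]
    rfl
  have hIJ : MeasurableSet (I ×ˢ J) := measurableSet_Ioo.prod measurableSet_Ioo
  have hrect := lintegral_lintegral_sq_le (μ := volume.restrict I) (ν := volume.restrict J) (h := h)
    hαm hβm (S := I ×ˢ J) (by rw [hμν]; exact ae_restrict_mem hIJ)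
    (fun p hp p' hp' => (htri _ (h (p'.1, p.2)) _).trans
      (add_le_add (hrad p.1 hp.1 p'.1 hp'.1 p.2) (hang p'.1 hp'.1 p.2 hp.2 p'.2 hp'.2)))
    (fun p hp p' hp' => (htri _ (h (p.1, p'.2)) _).trans
      (add_le_add (hang p.1 hp.1 p.2 hp.2 p'.2 hp'.2) (hrad p.1 hp.1 p'.1 hp'.1 p'.2)))
  set X := ∫⁻ x in shell q a b, ENNReal.ofReal (N x) with hX
  have hXeq : X = ∫⁻ p in I ×ˢ J, ENNReal.ofReal (p.1 * N (polarPt q p)) := by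
    rw [hX, lintegral_shell_polarPt q ha.le]
    refine setLIntegral_congr_fun hIJ fun p hp => ?_
    exact (ENNReal.ofReal_mul (ha.le.trans hp.1.1.le)).symm
  have hB : ∫⁻ s in I, β s = X := by
    rw [hXeq, ← hμν, lintegral_prod]
    exact ((continuous_fst.mul (hNc.comp hPc)).measurable.ennreal_ofReal).aemeasurable
  have hA : ∫⁻ t in J, α t ≤ ENNReal.ofReal a⁻¹ * X := by
    have e1 : ∫⁻ t in J, α t = ∫⁻ p in I ×ˢ J, ENNReal.ofReal (N (polarPt q p)) := by
      rw [← hμν, lintegral_prod_symm]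
      exact ((hNc.comp hPc).measurable.ennreal_ofReal).aemeasurable
    rw [e1, hXeq, ← lintegral_const_mul' _ _ ENNReal.ofReal_ne_top]
    refine setLIntegral_mono_ae' hIJ (ae_of_all _ fun p hp => ?_)
    rw [← ENNReal.ofReal_mul (by positivity)]
    refine ENNReal.ofReal_le_ofReal ?_
    rw [← mul_assoc]
    refine le_mul_of_one_le_left (hN0 _) ?_
    rw [← div_eq_inv_mul, one_le_div ha]
    exact hp.1.1.le
  have hL : ∫⁻ x in shell q a b, ∫⁻ y in shell q a b, ENNReal.ofReal ((g x - g y) ^ 2) ≤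
      ENNReal.ofReal (b ^ 2) * ∫⁻ p in I ×ˢ J, ∫⁻ p' in I ×ˢ J, ENNReal.ofReal ((h p - h p') ^ 2) := by
    have hw : ∀ f : E 2 → ℝ≥0∞, ∫⁻ x in shell q a b, f x ≤
        ENNReal.ofReal b * ∫⁻ p in I ×ˢ J, f (polarPt q p) := fun f => by
      rw [lintegral_shell_polarPt q ha.le, ← lintegral_const_mul' _ _ ENNReal.ofReal_ne_top]
      refine setLIntegral_mono_ae' hIJ (ae_of_all _ fun p hp => ?_)
      exact mul_le_mul' (ENNReal.ofReal_le_ofReal hp.1.2.le) le_rfl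
    refine (hw _).trans ?_
    rw [pow_two, ENNReal.ofReal_mul (by linarith), mul_assoc]
    refine mul_le_mul' le_rfl ?_
    rw [← lintegral_const_mul' _ _ ENNReal.ofReal_ne_top]
    exact lintegral_mono fun p => hw _
  refine hL.trans ?_
  rw [hμν, hB, Measure.restrict_apply_univ, Measure.restrict_apply_univ, Real.volume_Ioo,
    Real.volume_Ioo] at hrect
  refine (mul_le_mul' le_rfl hrect).trans ?_
  rw [shellK, mul_pow, ENNReal.ofReal_mul (by positivity), mul_assoc]
  refine mul_le_mul' le_rfl ?_
  rw [ENNReal.ofReal_pow (by have : 0 < b - a := by linarith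
                             positivity), ← mul_pow]
  refine pow_le_pow_left' ?_ 2
  have hba : 0 < b - a := by linarith
  calc _ ≤ ENNReal.ofReal a⁻¹ * X * ENNReal.ofReal (b - a) + X * ENNReal.ofReal (Real.pi - -Real.pi) := by
        gcongr
    _ = _ := by
        rw [ENNReal.ofReal_add (by positivity) (by positivity), div_eq_inv_mul,
          ENNReal.ofReal_mul (by positivity), sub_neg_eq_add, ← two_mul]
        ring

lemma annCut_gradAt_eq_zero {d : ℕ} {p : E d} {a b c e : ℝ} (ha : 0 < a) (hab : a < b) (hbc : b ≤ c)
    (hce : c < e) {x : E d} (h1 : b ≤ dist x p) (h2 : dist x p ≤ c) :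
    gradAt (annCut p a b c e) x = 0 := by
  rw [annCut_gradAt ha hab hbc hce, cutoff_gradAt_eq_zero hce (Or.inl h2),
    cutoff_gradAt_eq_zero hab (Or.inr h1), sub_zero]

/-- The Poincaré inequality on planar shells. -/
lemma H1Off.poincare_shell {U : Set (E 2)} {v : E 2 → ℝ} {Dv : E 2 → Fin 2 → ℝ} (h : H1Off U v Dv)
    (q : E 2) {a' a b b' : ℝ} (ha' : 0 < a') (haa : a' < a) (hab : a < b) (hbb : b < b')
    (hU : {x | a' ≤ dist x q ∧ dist x q ≤ b'} ⊆ U) :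
    ∫⁻ x in shell q a b, ∫⁻ y in shell q a b, ENNReal.ofReal ((v x - v y) ^ 2) ≤
      ENNReal.ofReal (shellK a b ^ 2) *
        (∫⁻ x in shell q a b, ENNReal.ofReal (∑ i, |Dv x i|)) ^ 2 := by
  have ha : 0 < a := ha'.trans haa
  set S := shell q a b with hSdef
  have hSm : MeasurableSet S := measurableSet_shell q a b
  set η := annCut q a' a b b' with hη
  have hηt : IsTestFun 2 η := annCut_isTestFun ha' haa hab.le hbb
  have hηU : tsupport η ⊆ U := (annCut_tsupport haa hab.le hbb).trans hU
  have hη1 : ∀ x ∈ S, η x = 1 := fun x hx => annCut_eq_one haa hbb hx.1.le hx.2.le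
  have hη0 : ∀ x ∈ S, gradAt η x = 0 := fun x hx =>
    annCut_gradAt_eq_zero ha' haa hab.le hbb hx.1.le hx.2.le
  have hSK : S ⊆ tsupport η := fun x hx => subset_tsupport η (by
    rw [Function.mem_support, hη1 x hx]
    exact one_ne_zero)
  obtain ⟨χ, hχ, -, -, hχu, hχg⟩ := h.exists_testFun_approx hηt hηU (F := fun s => s) contDiff_id
  have hpt : ∀ x ∈ S, Tendsto (fun n => χ n x) atTop (𝓝 (v x)) := fun x hx => by
    have := hχu.tendsto_at (Set.mem_univ x)
    rwa [hη1 x hx, one_mul] at this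
  have hS : volume S ≠ ⊤ := ((volume_shell_le q a (by linarith)).trans_lt
    (ENNReal.mul_lt_top ENNReal.ofReal_lt_top measure_ball_lt_top)).ne
  have hDm : ∀ i, AEStronglyMeasurable (fun x => Dv x i) (volume.restrict S) := fun i =>
    (h.memLp _ hηU hηt.2 i).aestronglyMeasurable.mono_measure (Measure.restrict_mono hSK le_rfl)
  set δ : ℕ → ℝ≥0∞ := fun n => ∑ i, ∫⁻ x in S, ENNReal.ofReal |gradAt (χ n) x i - Dv x i| with hδ
  have hδ0 : Tendsto δ atTop (𝓝 0) := by
    have : Tendsto δ atTop (𝓝 (∑ i : Fin 2, 0)) := by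
      refine tendsto_finsetSum _ fun i _ => ?_
      have h3 := ENNReal.Tendsto.mul_const (b := volume S ^ (1 / (1 : ℝ≥0∞).toReal -
        1 / (2 : ℝ≥0∞).toReal)) (hχg i) (Or.inr (ENNReal.rpow_ne_top_of_nonneg (by norm_num) hS))
      rw [zero_mul] at h3
      refine tendsto_of_tendsto_of_tendsto_of_le_of_le tendsto_const_nhds h3
        (fun n => zero_le) (fun n => ?_)
      have e1 : ∫⁻ x in S, ENNReal.ofReal |gradAt (χ n) x i - Dv x i| =
          eLpNorm (fun x => gradAt (χ n) x i - Dv x i) 1 (volume.restrict S) := by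
        rw [eLpNorm_one_eq_lintegral_enorm]
        simp only [Real.enorm_eq_ofReal_abs]
      have e2 : eLpNorm (fun x => gradAt (χ n) x i - Dv x i) 2 (volume.restrict S) =
          eLpNorm (fun x => gradAt (χ n) x i - (gradAt η x i * v x + η x *
            (deriv (fun s : ℝ => s) (v x) * Dv x i))) 2 (volume.restrict S) := by
        refine eLpNorm_congr_ae ?_
        filter_upwards [ae_restrict_mem hSm] with x hx
        simp [hη1 x hx, hη0 x hx]
      change ∫⁻ x in S, ENNReal.ofReal |gradAt (χ n) x i - Dv x i| ≤ _
      rw [e1]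
      refine (eLpNorm_le_eLpNorm_mul_rpow_measure_univ
        (f := fun x => gradAt (χ n) x i - Dv x i) (q := 2) (by norm_num)
        (((hχ n).gradAt_continuous i).aestronglyMeasurable.sub (hDm i))).trans ?_
      rw [e2, Measure.restrict_apply_univ]
      exact mul_le_mul' (eLpNorm_mono_measure _ (Measure.restrict_mono hSK le_rfl)) le_rfl
    simpa using this
  set Y := ∫⁻ x in S, ENNReal.ofReal (∑ i, |Dv x i|) with hY
  have hYn : ∀ n, ∫⁻ x in S, ENNReal.ofReal (∑ i, |gradAt (χ n) x i|) ≤ Y + δ n := by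
    intro n
    have hm : ∀ i, AEMeasurable (fun x => ENNReal.ofReal |gradAt (χ n) x i - Dv x i|)
        (volume.restrict S) := fun i =>
      (((hχ n).gradAt_continuous i).aestronglyMeasurable.sub
        (hDm i)).aemeasurable.abs.ennreal_ofReal
    rw [hδ, hY]
    dsimp only
    rw [← lintegral_finsetSum' _ fun i _ => hm i,
      ← lintegral_add_right' _ (Finset.aemeasurable_fun_sum _ fun i _ => hm i)]
    refine lintegral_mono fun x => ?_
    rw [← ENNReal.ofReal_sum_of_nonneg fun i _ => abs_nonneg _,
      ← ENNReal.ofReal_add (Finset.sum_nonneg fun i _ => abs_nonneg _)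
        (Finset.sum_nonneg fun i _ => abs_nonneg _), ← Finset.sum_add_distrib]
    refine ENNReal.ofReal_le_ofReal (Finset.sum_le_sum fun i _ => ?_)
    have := abs_add_le (Dv x i) (gradAt (χ n) x i - Dv x i)
    rwa [add_sub_cancel] at this
  have hc : ∀ n, Continuous (χ n) := fun n => (hχ n).1.continuous
  have hF : ∀ n, Measurable fun p : E 2 × E 2 => ENNReal.ofReal ((χ n p.1 - χ n p.2) ^ 2) := fun n =>
    (((((hc n).comp continuous_fst).sub ((hc n).comp continuous_snd)).pow 2).measurable).ennreal_ofReal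
  have hinner : ∀ x ∈ S, ∫⁻ y in S, ENNReal.ofReal ((v x - v y) ^ 2) ≤
      liminf (fun n => ∫⁻ y in S, ENNReal.ofReal ((χ n x - χ n y) ^ 2)) atTop := by
    intro x hx
    refine le_trans (le_of_eq (setLIntegral_congr_fun hSm fun y hy => ?_))
      (lintegral_liminf_le fun n => (hF n).comp measurable_prodMk_left)
    exact (ENNReal.tendsto_ofReal (((hpt x hx).sub (hpt y hy)).pow 2)).liminf_eq.symm
  calc _ ≤ ∫⁻ x in S, liminf (fun n => ∫⁻ y in S, ENNReal.ofReal ((χ n x - χ n y) ^ 2)) atTop :=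
        setLIntegral_mono_ae' hSm (ae_of_all _ hinner)
    _ ≤ liminf (fun n => ∫⁻ x in S, ∫⁻ y in S, ENNReal.ofReal ((χ n x - χ n y) ^ 2)) atTop :=
        lintegral_liminf_le fun n => (hF n).lintegral_prod_right'
    _ ≤ liminf (fun n => ENNReal.ofReal (shellK a b ^ 2) * (Y + δ n) ^ 2) atTop := by
        refine liminf_le_liminf (Eventually.of_forall fun n => ?_)
        exact ((hχ n).poincare_shell q ha hab).trans
          (mul_le_mul' le_rfl (pow_le_pow_left' (hYn n) 2))
    _ = _ := by
        refine Tendsto.liminf_eq ?_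
        have h1 : Tendsto (fun n => Y + δ n) atTop (𝓝 (Y + 0)) := tendsto_const_nhds.add hδ0
        rw [add_zero] at h1
        exact ENNReal.Tendsto.const_mul (((ENNReal.continuous_pow 2).tendsto Y).comp h1)
          (Or.inr ENNReal.ofReal_ne_top)

/-- Double integral of squared differences over a set. -/
def VE {d : ℕ} (u : E d → ℝ) (S : Set (E d)) : ℝ≥0∞ :=
  ∫⁻ y in S, UE (fun x => u x - u y) S

lemma sum_abs_sq_le (ξ : Fin 2 → ℝ) : (∑ i, |ξ i|) ^ 2 ≤ 2 * (ξ ⬝ᵥ ξ) := by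
  simp only [Fin.sum_univ_two, dotProduct]
  nlinarith [sq_nonneg (|ξ 0| - |ξ 1|), sq_abs (ξ 0), sq_abs (ξ 1)]

section

variable {lam : ℝ} {W : CoeffField 2 lam} {T : ℝ} {p : E 2} {u : E 2 → ℝ} {Du : E 2 → Fin 2 → ℝ}

lemma IsFund.VE_le (hu : IsFund W T p u Du) (q : E 2) {a' a b b' : ℝ} (ha' : 0 < a') (haa : a' < a)
    (hab : a < b) (hbb : b < b') (hU : dist p q < a' ∨ b' < dist p q) :
    VE u (shell q a b) ≤ ENNReal.ofReal (shellK a b ^ 2) *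
      (∫⁻ x in shell q a b, ENNReal.ofReal (∑ i, |Du x i|)) ^ 2 := by
  refine le_trans (le_of_eq ?_) (hu.h1.poincare_shell q ha' haa hab hbb ?_)
  · unfold VE UE
    refine lintegral_congr fun y => lintegral_congr fun x => ?_
    congr 1
    ring
  · rintro x hx rfl
    rcases hU with h | h
    · exact absurd hx.1 (not_le.2 h)
    · exact absurd hx.2 (not_le.2 h)

lemma IsFund.aemeasurable_sum_abs (hu : IsFund W T p u Du) :
    AEMeasurable (fun x => ∑ i, |Du x i|) volume :=
  Finset.aemeasurable_fun_sum _ fun i _ => (hu.locInt i).aestronglyMeasurable.aemeasurable.abs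

lemma IsFund.lintegral_sum_abs_sq_le (hu : IsFund W T p u Du) (S : Set (E 2)) :
    (∫⁻ x in S, ENNReal.ofReal (∑ i, |Du x i|)) ^ 2 ≤ 2 * (volume S * DE Du S) := by
  have h := lintegral_mul_sq_le (μ := volume.restrict S) (f := fun _ => 1)
    (g := fun x => ENNReal.ofReal (∑ i, |Du x i|)) aemeasurable_const
    (hu.aemeasurable_sum_abs.restrict.ennreal_ofReal)
  simp only [one_mul, one_pow, lintegral_const, Measure.restrict_apply_univ] at h
  refine h.trans ?_
  rw [mul_left_comm]
  refine mul_le_mul' le_rfl ?_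
  unfold DE
  rw [← lintegral_const_mul' _ _ (by simp)]
  refine lintegral_mono fun x => ?_
  rw [← ENNReal.ofReal_pow (Finset.sum_nonneg fun i _ => abs_nonneg _),
    show (2 : ℝ≥0∞) = ENNReal.ofReal 2 by simp, ← ENNReal.ofReal_mul (by norm_num)]
  exact ENNReal.ofReal_le_ofReal (sum_abs_sq_le _)

end

lemma volume_shell_two (q : E 2) {a b : ℝ} (ha : 0 ≤ a) (hab : a < b) :
    volume (shell q a b) = ENNReal.ofReal (Real.pi * (b ^ 2 - a ^ 2)) := by
  have h1 : shell q a b = ball q b \ closedBall q a := by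
    ext x
    simp only [shell, Set.mem_ofPred_eq, Set.mem_sdiff, mem_ball, mem_closedBall, not_le]
    tauto
  rw [h1, measure_sdiff (closedBall_subset_ball hab) measurableSet_closedBall.nullMeasurableSet
    measure_closedBall_lt_top.ne, EuclideanSpace.volume_ball_fin_two,
    EuclideanSpace.volume_closedBall_fin_two, ← ENNReal.ofReal_pow (by linarith),
    ← ENNReal.ofReal_pow ha, ← ENNReal.ofReal_mul' Real.pi_pos.le,
    ← ENNReal.ofReal_mul' Real.pi_pos.le, ← ENNReal.ofReal_sub _ (by positivity)]
  congr 1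
  ring

lemma exists_eq_ofReal {A : ℝ≥0∞} (h : A ≠ ⊤) : ∃ x : ℝ, 0 ≤ x ∧ A = ENNReal.ofReal x :=
  ⟨A.toReal, ENNReal.toReal_nonneg, (ENNReal.ofReal_toReal h).symm⟩

lemma UE_sub_le {d : ℕ} {f g h : E d → ℝ} (hg : AEMeasurable g volume) (S : Set (E d))
    (hf : ∀ x, f x ^ 2 ≤ 2 * g x ^ 2 + 2 * h x ^ 2) :
    UE f S ≤ 2 * UE g S + 2 * UE h S := by
  unfold UE
  rw [← lintegral_const_mul' 2 _ (by norm_num), ← lintegral_const_mul' 2 _ (by norm_num),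
    ← lintegral_add_left' (((hg.pow_const 2).ennreal_ofReal.const_mul _).restrict)]
  refine lintegral_mono fun x => ?_
  rw [show (2 : ℝ≥0∞) = ENNReal.ofReal 2 by simp, ← ENNReal.ofReal_mul (by norm_num),
    ← ENNReal.ofReal_mul (by norm_num), ← ENNReal.ofReal_add (by positivity) (by positivity)]
  exact ENNReal.ofReal_le_ofReal (hf x)

section

variable {lam : ℝ} {W : CoeffField 2 lam} {T : ℝ} {p : E 2} {u : E 2 → ℝ} {Du : E 2 → Fin 2 → ℝ}

lemma IsFund.lintegral_sum_abs_sq_le_arc (hu : IsFund W T p u Du) (hlam : 0 < lam) (hT : 0 < T)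
    (S : Set (E 2)) (c : ℝ) {k : ℝ} (hk : 0 < k) :
    (∫⁻ x in S, ENNReal.ofReal (∑ i, |Du x i|)) ^ 2 ≤ ENNReal.ofReal (2 * k * Real.pi / lam) *
      (volume S + ENNReal.ofReal ((k⁻¹) ^ 2) * UE (fun x => u x - c) S) := by
  set w : E 2 → ℝ := fun x => 1 + ((u x - c) / k) ^ 2 with hw
  have hwp : ∀ x, 0 < w x := fun x => by positivity
  have hm : AEMeasurable w volume :=
    (((hu.aemeasurable.sub_const c).div_const k).pow_const 2).const_add 1
  have hf : AEMeasurable (fun x => ENNReal.ofReal (Real.sqrt ((w x)⁻¹ * (2 * (Du x ⬝ᵥ Du x)))))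
      (volume.restrict S) :=
    ((hm.inv.mul (hu.aemeasurable_dot.const_mul 2)).sqrt.ennreal_ofReal).restrict
  have hg : AEMeasurable (fun x => ENNReal.ofReal (Real.sqrt (w x))) (volume.restrict S) :=
    (hm.sqrt.ennreal_ofReal).restrict
  have h1 := lintegral_mul_sq_le hf hg
  refine le_trans (pow_le_pow_left' (lintegral_mono fun x => ?_) 2) (h1.trans ?_)
  · rw [← ENNReal.ofReal_mul (Real.sqrt_nonneg _),
      ← Real.sqrt_mul (mul_nonneg (inv_nonneg.2 (hwp x).le)
        (mul_nonneg zero_le_two (dot_self_nonneg _)))]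
    refine ENNReal.ofReal_le_ofReal (Real.le_sqrt_of_sq_le ?_)
    refine (sum_abs_sq_le (Du x)).trans (le_of_eq ?_)
    have := (hwp x).ne'
    field_simp
  · refine mul_le_mul' ?_ ?_
    · have h2 := hu.energy_arc le_rfl hlam hT (c := c) hk
      calc _ = ∫⁻ x in S, 2 * ENNReal.ofReal ((1 + ((u x - c) / k) ^ 2)⁻¹ * (Du x ⬝ᵥ Du x)) := by
            refine lintegral_congr fun x => ?_
            have h0 := dot_self_nonneg (Du x)
            have hi := inv_nonneg.2 (hwp x).le
            rw [← ENNReal.ofReal_pow (Real.sqrt_nonneg _), Real.sq_sqrt (by positivity),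
              show (2 : ℝ≥0∞) = ENNReal.ofReal 2 by simp, ← ENNReal.ofReal_mul (by norm_num)]
            congr 1
            simp only [hw]
            ring
        _ = 2 * ∫⁻ x in S, ENNReal.ofReal ((1 + ((u x - c) / k) ^ 2)⁻¹ * (Du x ⬝ᵥ Du x)) :=
            lintegral_const_mul' _ _ (by norm_num)
        _ ≤ 2 * ENNReal.ofReal (k * Real.pi / lam) :=
            mul_le_mul' le_rfl ((setLIntegral_le_lintegral _ _).trans h2)
        _ = _ := by
            rw [show (2 : ℝ≥0∞) = ENNReal.ofReal 2 by simp, ← ENNReal.ofReal_mul (by norm_num)]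
            congr 1
            ring
    · refine le_of_eq ?_
      unfold UE
      rw [← lintegral_const_mul' _ _ ENNReal.ofReal_ne_top, ← setLIntegral_one,
        ← lintegral_add_left' aemeasurable_const]
      refine lintegral_congr fun x => ?_
      rw [← ENNReal.ofReal_pow (Real.sqrt_nonneg _), Real.sq_sqrt (hwp x).le,
        ← ENNReal.ofReal_mul (by positivity), ← ENNReal.ofReal_one,
        ← ENNReal.ofReal_add zero_le_one (by positivity)]
      congr 1
      simp only [hw]
      ring

lemma IsFund.mul_lintegral_sum_abs_sq_le (hu : IsFund W T p u Du) (hlam : 0 < lam) (hT : 0 < T)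
    {S : Set (E 2)} {k : ℝ} (hk : 0 < k) :
    volume S * (∫⁻ x in S, ENNReal.ofReal (∑ i, |Du x i|)) ^ 2 ≤
      ENNReal.ofReal (2 * k * Real.pi / lam) *
      (volume S * volume S + ENNReal.ofReal ((k⁻¹) ^ 2) * VE u S) := by
  have h : ∫⁻ y in S, (∫⁻ x in S, ENNReal.ofReal (∑ i, |Du x i|)) ^ 2 ≤
      ∫⁻ y in S, ENNReal.ofReal (2 * k * Real.pi / lam) *
      (volume S + ENNReal.ofReal ((k⁻¹) ^ 2) * UE (fun x => u x - u y) S) :=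
    lintegral_mono fun y => hu.lintegral_sum_abs_sq_le_arc hlam hT S (u y) hk
  rw [lintegral_const_mul' _ _ ENNReal.ofReal_ne_top, lintegral_add_left' aemeasurable_const,
    lintegral_const_mul' _ _ ENNReal.ofReal_ne_top, setLIntegral_const, setLIntegral_const,
    mul_comm] at h
  exact h

lemma IsFund.VE_shell_ne_top (hu : IsFund W T p u Du) (hT : 0 < T) {a b : ℝ} (ha : 0 < a)
    (hab : a < b) {S : Set (E 2)} (hS : S ⊆ shell p a b) (hSm : MeasurableSet S) : VE u S ≠ ⊤ := by
  obtain ⟨B, k, hB, hk, h⟩ := hu.exists_ext_bound le_rfl hT ha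
  have hb : ∀ x ∈ S, u x ≤ B := fun x hx => by
    refine (h x (hS hx).1.le).trans ?_
    have : Real.exp (-(k * dist x p)) ≤ 1 := Real.exp_le_one_iff.2 (by
      have := mul_nonneg hk.le (dist_nonneg (x := x) (y := p))
      linarith)
    nlinarith
  have hv : volume S ≠ ⊤ := by
    refine ne_top_of_le_ne_top ?_ (measure_mono hS)
    rw [volume_shell_two p ha.le hab]
    exact ENNReal.ofReal_ne_top
  have h1 : VE u S ≤ ∫⁻ y in S, ENNReal.ofReal (B ^ 2) * volume S := by
    refine setLIntegral_mono_ae' hSm (ae_of_all _ fun y hy => UE_le_of_abs_le hSm fun x hx => ?_)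
    rw [abs_le]
    constructor <;> linarith [hu.nonneg x, hu.nonneg y, hb x hx, hb y hy]
  rw [setLIntegral_const] at h1
  exact ne_top_of_le_ne_top (ENNReal.mul_ne_top (ENNReal.mul_ne_top ENNReal.ofReal_ne_top hv) hv) h1

end

/-- Scale-invariant bound for the oscillation of fundamental solutions on dyadic shells. -/
lemma exists_VE_bound {lam : ℝ} (hlam : 0 < lam) : ∃ C : ℝ, 0 < C ∧
    ∀ (W : CoeffField 2 lam) (T : ℝ) (p : E 2) (u : E 2 → ℝ) (Du : E 2 → Fin 2 → ℝ), 0 < T →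
    IsFund W T p u Du → ∀ a : ℝ, 0 < a →
    VE u (shell p a (16 * a)) ≤ ENNReal.ofReal (C * a ^ 4) := by
  have hpi := Real.pi_pos
  set κ : ℝ := (16 * (15 + 2 * Real.pi)) ^ 2 with hκ
  have hκp : 0 < κ := by positivity
  set m : ℝ := 255 * Real.pi with hm
  have hmp : 0 < m := by positivity
  set k : ℝ := 4 * Real.pi * κ / (lam * m) with hk
  have hkp : 0 < k := by positivity
  refine ⟨2 * κ * (2 * k * Real.pi / lam) * m, by positivity, ?_⟩
  intro W T p u Du hT hu a ha
  have hv : volume (shell p a (16 * a)) = ENNReal.ofReal (m * a ^ 2) := by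
    rw [volume_shell_two p ha.le (by linarith), hm]
    congr 1
    ring
  have h1 := hu.VE_le p (a' := a / 2) (a := a) (b := 16 * a) (b' := 17 * a) (by linarith)
    (by linarith) (by linarith) (by linarith) (Or.inl (by rw [dist_self]; linarith))
  have h2 := hu.mul_lintegral_sum_abs_sq_le hlam hT (S := shell p a (16 * a)) hkp
  have hK : shellK a (16 * a) ^ 2 = κ * a ^ 2 := by
    rw [shellK, hκ, show (16 * a - a) / a = 15 by field_simp; norm_num]
    ring
  obtain ⟨V, hV0, hV⟩ := exists_eq_ofReal
    (hu.VE_shell_ne_top hT ha (b := 16 * a) (by linarith) subset_rfl (measurableSet_shell _ _ _))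
  have h3 : ENNReal.ofReal (m * a ^ 2) * VE u (shell p a (16 * a)) ≤
      ENNReal.ofReal (κ * a ^ 2) * (ENNReal.ofReal (2 * k * Real.pi / lam) *
      (ENNReal.ofReal (m * a ^ 2) * ENNReal.ofReal (m * a ^ 2) +
        ENNReal.ofReal ((k⁻¹) ^ 2) * VE u (shell p a (16 * a)))) := by
    rw [hv] at h2
    refine le_trans (mul_le_mul' le_rfl h1) ?_
    rw [hK, mul_left_comm]
    exact mul_le_mul' le_rfl h2
  rw [hV] at h3 ⊢
  rw [← ENNReal.ofReal_mul (by positivity), ← ENNReal.ofReal_mul (by positivity),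
    ← ENNReal.ofReal_mul (by positivity), ← ENNReal.ofReal_add (by positivity) (by positivity),
    ← ENNReal.ofReal_mul (by positivity), ← ENNReal.ofReal_mul (by positivity),
    ENNReal.ofReal_le_ofReal_iff (by positivity)] at h3
  refine ENNReal.ofReal_le_ofReal ?_
  have e1 : κ * a ^ 2 * (2 * k * Real.pi / lam * (m * a ^ 2 * (m * a ^ 2) + (k⁻¹) ^ 2 * V)) =
      m * a ^ 2 * (κ * (2 * k * Real.pi / lam) * m * a ^ 4 + V / 2) := by
    rw [hk]
    field_simp
    ring
  rw [e1] at h3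
  have := le_of_mul_le_mul_left h3 (by positivity)
  linarith

section

variable {d : ℕ} {lam : ℝ} {W : CoeffField d lam} {T : ℝ} {p : E d} {u : E d → ℝ}
  {Du : E d → Fin d → ℝ}

lemma VE_mono {S S' : Set (E d)} (h : S ⊆ S') : VE u S ≤ VE u S' :=
  (lintegral_mono fun _ => UE_mono h).trans (lintegral_mono_set h)

lemma IsFund.volume_mul_UE_le (hu : IsFund W T p u Du) {S S' A : Set (E d)} (hS : S ⊆ A)
    (hS' : S' ⊆ A) : volume S' * UE u S ≤ 2 * VE u A + 2 * (volume S * UE u S') := by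
  have h : ∫⁻ y in S', UE u S ≤
      ∫⁻ y in S', (2 * UE (fun x => u x - u y) A + 2 * (volume S * ENNReal.ofReal (u y ^ 2))) := by
    refine lintegral_mono fun y => ?_
    refine (UE_sub_le (g := fun x => u x - u y) (h := fun _ => u y) (hu.aemeasurable.sub_const _) S
      fun x => ?_).trans ?_
    · nlinarith [sq_nonneg (u x - 2 * u y)]
    · refine add_le_add (mul_le_mul' le_rfl (UE_mono hS)) (le_of_eq ?_)
      rw [UE, setLIntegral_const, mul_comm (volume S)]
  have hm : AEMeasurable (fun y => 2 * (volume S * ENNReal.ofReal (u y ^ 2)))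
      (volume.restrict S') :=
    ((((hu.aemeasurable.pow_const 2).ennreal_ofReal).const_mul _).const_mul _).restrict
  rw [lintegral_add_right' _ hm, lintegral_const_mul' _ _ (by norm_num),
    lintegral_const_mul' _ _ (by norm_num),
    lintegral_const_mul'' _ ((hu.aemeasurable.pow_const 2).ennreal_ofReal).restrict,
    setLIntegral_const, mul_comm] at h
  refine h.trans (add_le_add (mul_le_mul' le_rfl ?_) le_rfl)
  exact lintegral_mono_set hS'

lemma IsFund.volume_one_lt_le (hu : IsFund W T p u Du) (hd : 2 ≤ d) (hlam : 0 < lam) (hT : 0 < T)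
    (S : Set (E d)) : volume (S \ {x | u x ≤ 1}) ≤ ENNReal.ofReal (4 * T) := by
  have hpi := Real.pi_pos
  have h1 := hu.mass_arc hd hlam hT (k := 1) one_pos
  have hm : AEMeasurable (fun x => ENNReal.ofReal (u x * Real.arctan (u x / 1))) volume :=
    (hu.aemeasurable.mul
      (Real.measurable_arctan.comp_aemeasurable (hu.aemeasurable.div_const 1))).ennreal_ofReal
  have h2 := (mul_meas_ge_le_lintegral₀ hm (ENNReal.ofReal (Real.pi / 4))).trans h1
  have h3 : S \ {x | u x ≤ 1} ⊆
      {x | ENNReal.ofReal (Real.pi / 4) ≤ ENNReal.ofReal (u x * Real.arctan (u x / 1))} := by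
    rintro x ⟨-, hx⟩
    rw [Set.mem_ofPred_eq, not_le] at hx
    refine ENNReal.ofReal_le_ofReal ?_
    rw [div_one, ← Real.arctan_one]
    have h4 : Real.arctan 1 ≤ Real.arctan (u x) := Real.arctan_strictMono.monotone hx.le
    have h5 : 0 < Real.arctan 1 := by rw [Real.arctan_one]; positivity
    nlinarith
  refine (measure_mono h3).trans ((le_ofReal_inv_mul (by positivity) h2).trans (le_of_eq ?_))
  rw [← ENNReal.ofReal_mul (by positivity)]
  congr 1
  field_simp

end

lemma UE_shell_ne_top {d : ℕ} {lam : ℝ} {W : CoeffField d lam} {T : ℝ} {p : E d} {u : E d → ℝ}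
    {Du : E d → Fin d → ℝ} (hu : IsFund W T p u Du) (hd : 2 ≤ d) (hT : 0 < T) {a b : ℝ}
    (ha : 0 < a) : UE u (shell p a b) ≠ ⊤ :=
  ne_top_of_le_ne_top (hu.UE_ext_lt_top hd hT ha).ne (UE_mono fun _ hx => hx.1)

lemma exists_UE_shell_bound_base {lam : ℝ} (hlam : 0 < lam) : ∃ K : ℝ, 0 < K ∧
    ∀ (W : CoeffField 2 lam) (T : ℝ) (p : E 2) (u : E 2 → ℝ) (Du : E 2 → Fin 2 → ℝ), 0 < T →
    IsFund W T p u Du → ∀ ρ : ℝ, 0 < ρ → Real.sqrt T ≤ ρ → ρ ≤ 2 * Real.sqrt T →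
    UE u (shell p ρ (8 * ρ)) ≤ ENNReal.ofReal (K * T) := by
  obtain ⟨C, hC, hVE⟩ := exists_VE_bound hlam
  have hpi := Real.pi_gt_three
  refine ⟨4 * (C + 126 * Real.pi), by positivity, ?_⟩
  intro W T p u Du hT hu ρ hρ h1 h2
  have hT1 : T ≤ ρ ^ 2 := by
    have := pow_le_pow_left₀ (Real.sqrt_nonneg T) h1 2
    rwa [Real.sq_sqrt hT.le] at this
  have hT2 : ρ ^ 2 ≤ 4 * T := by
    have := pow_le_pow_left₀ hρ.le h2 2
    rw [mul_pow, Real.sq_sqrt hT.le] at this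
    linarith
  set S := shell p ρ (8 * ρ) with hS
  set S' := S ∩ {x | u x ≤ 1} with hS'
  have hv : volume S = ENNReal.ofReal (63 * Real.pi * ρ ^ 2) := by
    rw [hS, volume_shell_two p hρ.le (by linarith)]
    congr 1
    ring
  obtain ⟨s, hs0, hs⟩ := exists_eq_ofReal (A := volume S')
    (ne_top_of_le_ne_top (by rw [hv]; exact ENNReal.ofReal_ne_top)
      (measure_mono Set.inter_subset_left))
  have hsl : 30 * Real.pi * ρ ^ 2 ≤ s := by
    have h3 := (measure_le_inter_add_sdiff volume S {x | u x ≤ 1}).trans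
      (add_le_add le_rfl (hu.volume_one_lt_le le_rfl hlam hT S))
    rw [← hS', hs, hv, ← ENNReal.ofReal_add hs0 (by positivity),
      ENNReal.ofReal_le_ofReal_iff (by positivity)] at h3
    nlinarith [sq_nonneg ρ]
  have hnm : NullMeasurableSet S' volume := by
    rw [hS']
    exact (measurableSet_shell _ _ _).nullMeasurableSet.inter
      (nullMeasurableSet_le hu.aemeasurable aemeasurable_const)
  have hU' : UE u S' ≤ ENNReal.ofReal s := by
    rw [← hs, ← setLIntegral_one, UE]
    refine lintegral_mono_ae ?_
    filter_upwards [ae_restrict_mem₀ hnm] with x hx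
    rw [← ENNReal.ofReal_one]
    refine ENNReal.ofReal_le_ofReal ?_
    have h3 : u x ≤ 1 := hx.2
    nlinarith [hu.nonneg x]
  have h4 := hu.volume_mul_UE_le (S := S) (S' := S') (A := shell p ρ (16 * ρ))
    (fun x hx => ⟨hx.1, by linarith [hx.2]⟩) (fun x hx => ⟨hx.1.1, by linarith [hx.1.2]⟩)
  obtain ⟨w, hw0, hw⟩ := exists_eq_ofReal (UE_shell_ne_top hu le_rfl hT hρ (b := 8 * ρ))
  have h5 := h4.trans (add_le_add (mul_le_mul' le_rfl (hVE W T p u Du hT hu ρ hρ))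
    (mul_le_mul' le_rfl (mul_le_mul' le_rfl hU')))
  rw [hw, hs, hv, show (2 : ℝ≥0∞) = ENNReal.ofReal 2 by simp, ← ENNReal.ofReal_mul hs0,
    ← ENNReal.ofReal_mul (by positivity), ← ENNReal.ofReal_mul (by positivity),
    ← ENNReal.ofReal_mul (by positivity), ← ENNReal.ofReal_add (by positivity) (by positivity),
    ENNReal.ofReal_le_ofReal_iff (by positivity)] at h5
  rw [hw]
  refine ENNReal.ofReal_le_ofReal ?_
  have hsp : 0 < s := lt_of_lt_of_le (by positivity) hsl
  have h6 : 2 * (C * ρ ^ 4) ≤ s * (C * ρ ^ 2) := by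
    have : 2 * ρ ^ 2 ≤ s := by nlinarith [sq_nonneg ρ]
    calc 2 * (C * ρ ^ 4) = 2 * ρ ^ 2 * (C * ρ ^ 2) := by ring
      _ ≤ _ := by gcongr
  have h7 : s * w ≤ s * (C * ρ ^ 2 + 126 * Real.pi * ρ ^ 2) := by linarith
  have h8 := le_of_mul_le_mul_left h7 hsp
  nlinarith

lemma exists_UE_shell_bound_small {lam : ℝ} (hlam : 0 < lam) : ∃ K : ℝ, 0 < K ∧
    ∀ (W : CoeffField 2 lam) (T : ℝ) (p : E 2) (u : E 2 → ℝ) (Du : E 2 → Fin 2 → ℝ), 0 < T →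
    IsFund W T p u Du → ∀ ρ : ℝ, 0 < ρ → ρ ≤ 2 * Real.sqrt T →
    UE u (shell p ρ (8 * ρ)) ≤ ENNReal.ofReal (K * T) := by
  obtain ⟨C, hC, hVE⟩ := exists_VE_bound hlam
  obtain ⟨K, hK, hbase⟩ := exists_UE_shell_bound_base hlam
  have hpi := Real.pi_gt_three
  refine ⟨K + 2 * C, by positivity, ?_⟩
  intro W T p u Du hT hu
  have hsT : 0 < Real.sqrt T := Real.sqrt_pos.2 hT
  have hbase' : ∀ ρ : ℝ, 0 < ρ → Real.sqrt T ≤ ρ → ρ ≤ 2 * Real.sqrt T →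
      UE u (shell p ρ (8 * ρ)) ≤ ENNReal.ofReal ((K + 2 * C) * T) := fun ρ hρ h1 h2 =>
    (hbase W T p u Du hT hu ρ hρ h1 h2).trans (ENNReal.ofReal_le_ofReal (by nlinarith))
  have hind : ∀ n : ℕ, ∀ ρ : ℝ, 0 < ρ → ρ ≤ 2 * Real.sqrt T → Real.sqrt T ≤ 2 ^ n * ρ →
      UE u (shell p ρ (8 * ρ)) ≤ ENNReal.ofReal ((K + 2 * C) * T) := by
    intro n
    induction n with
    | zero => exact fun ρ hρ h1 h2 => hbase' ρ hρ (by simpa using h2) h1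
    | succ n ih =>
      intro ρ hρ h1 h2
      rcases le_total (Real.sqrt T) ρ with h3 | h3
      · exact hbase' ρ hρ h3 h1
      have h4 := ih (2 * ρ) (by linarith) (by linarith) (by rw [pow_succ] at h2; linarith)
      have h5 := hu.volume_mul_UE_le (S := shell p ρ (8 * ρ)) (S' := shell p (2 * ρ) (8 * (2 * ρ)))
        (A := shell p ρ (16 * ρ)) (fun x hx => ⟨hx.1, by linarith [hx.2]⟩)
        (fun x hx => ⟨by linarith [hx.1], by linarith [hx.2]⟩)
      have hT1 : ρ ^ 2 ≤ T := by
        have := pow_le_pow_left₀ hρ.le h3 2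
        rwa [Real.sq_sqrt hT.le] at this
      obtain ⟨w, hw0, hw⟩ := exists_eq_ofReal (UE_shell_ne_top hu le_rfl hT hρ (b := 8 * ρ))
      have h6 := h5.trans (add_le_add (mul_le_mul' le_rfl (hVE W T p u Du hT hu ρ hρ))
        (mul_le_mul' le_rfl (mul_le_mul' le_rfl h4)))
      have hv1 : 0 ≤ Real.pi * ((8 * ρ) ^ 2 - ρ ^ 2) := by
        have : 0 ≤ (8 * ρ) ^ 2 - ρ ^ 2 := by nlinarith
        positivity
      have hv2 : 0 ≤ Real.pi * ((8 * (2 * ρ)) ^ 2 - (2 * ρ) ^ 2) := by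
        have : 0 ≤ (8 * (2 * ρ)) ^ 2 - (2 * ρ) ^ 2 := by nlinarith
        positivity
      rw [volume_shell_two p hρ.le (by linarith), volume_shell_two p (by positivity) (by linarith),
        hw, show (2 : ℝ≥0∞) = ENNReal.ofReal 2 by simp, ← ENNReal.ofReal_mul hv2,
        ← ENNReal.ofReal_mul (by positivity), ← ENNReal.ofReal_mul hv1,
        ← ENNReal.ofReal_mul (by positivity), ← ENNReal.ofReal_add (by positivity) (by positivity),
        ENNReal.ofReal_le_ofReal_iff (by positivity)] at h6
      rw [hw]
      refine ENNReal.ofReal_le_ofReal ?_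
      have h7 : 2 * (C * ρ ^ 4) ≤ 252 * Real.pi * ρ ^ 2 * (C * ρ ^ 2) := by
        calc 2 * (C * ρ ^ 4) = 2 * (C * ρ ^ 4) * 1 := by ring
          _ ≤ 2 * (C * ρ ^ 4) * (126 * Real.pi) := by gcongr; linarith
          _ = _ := by ring
      have h8 : 252 * Real.pi * ρ ^ 2 * w ≤
          252 * Real.pi * ρ ^ 2 * (C * ρ ^ 2 + (K + 2 * C) * T / 2) := by nlinarith
      have h9 := le_of_mul_le_mul_left h8 (by positivity)
      nlinarith
  intro ρ hρ h1
  obtain ⟨n, hn⟩ := pow_unbounded_of_one_lt (Real.sqrt T / ρ) (one_lt_two)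
  exact hind n ρ hρ h1 (by rw [div_lt_iff₀ hρ] at hn; exact hn.le)

/-- Mean-square decay of fundamental solutions in dimension two. -/
lemma exists_UE_shell_bound {lam : ℝ} (hlam : 0 < lam) : ∃ K : ℝ, 0 < K ∧
    ∀ (W : CoeffField 2 lam) (T : ℝ) (p : E 2) (u : E 2 → ℝ) (Du : E 2 → Fin 2 → ℝ), 0 < T →
    IsFund W T p u Du → ∀ ρ : ℝ, 0 < ρ → UE u (shell p ρ (8 * ρ)) ≤
      ENNReal.ofReal (K * T * Real.exp (-(decRate lam * (ρ / Real.sqrt T)))) := by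
  obtain ⟨K, hK, hsmall⟩ := exists_UE_shell_bound_small hlam
  have hcK := cutK_pos
  have hκ := decRate_pos hlam
  set κ := decRate lam
  set D : ℝ := 128 * cutK ^ 2 / lam with hD
  have hDp : 0 < D := by positivity
  set K' : ℝ := K + D * K with hK'
  have hK'p : 0 < K' := by positivity
  refine ⟨K * Real.exp (2 * κ) + D * K', by positivity, ?_⟩
  intro W T p u Du hT hu ρ hρ
  have hsT : 0 < Real.sqrt T := Real.sqrt_pos.2 hT
  have hsq : Real.sqrt T ^ 2 = T := Real.sq_sqrt hT.le
  have hdec : ∀ t : ℝ, Real.sqrt T ≤ t → D * (T / t ^ 2) ≤ D := by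
    intro t ht
    have ht0 : 0 < t := hsT.trans_le ht
    have : T / t ^ 2 ≤ 1 := by
      rw [div_le_one (by positivity), ← hsq]
      exact pow_le_pow_left₀ hsT.le ht 2
    exact mul_le_of_le_one_right hDp.le this
  have hext : UE u (ext p (2 * Real.sqrt T)) ≤ ENNReal.ofReal (D * K * T) := by
    refine (hu.UE_ext_le le_rfl hlam hT (ρ := 2 * Real.sqrt T) (by positivity)).trans ?_
    have h1 := (UE_mono (u := u) (fun x hx => ⟨hx.1, by linarith [hx.2]⟩ :
      shell p (2 * Real.sqrt T / 4) (2 * Real.sqrt T / 2) ⊆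
        shell p (2 * Real.sqrt T / 4) (8 * (2 * Real.sqrt T / 4)))).trans
      (hsmall W T p u Du hT hu (2 * Real.sqrt T / 4) (by positivity) (by linarith))
    refine (mul_le_mul' le_rfl h1).trans ?_
    rw [← ENNReal.ofReal_mul (by positivity)]
    refine ENNReal.ofReal_le_ofReal ?_
    have h2 : Real.exp (-(κ * (2 * Real.sqrt T / Real.sqrt T))) ≤ 1 :=
      Real.exp_le_one_iff.2 (by rw [neg_nonpos]; positivity)
    have h3 := hdec (2 * Real.sqrt T) (by linarith)
    calc _ ≤ D * 1 * (K * T) := by gcongr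
      _ = _ := by ring
  have hall : ∀ t : ℝ, 0 < t → UE u (shell p t (8 * t)) ≤ ENNReal.ofReal (K' * T) := by
    intro t ht
    rcases le_total t (2 * Real.sqrt T) with h | h
    · refine (hsmall W T p u Du hT hu t ht h).trans (ENNReal.ofReal_le_ofReal ?_)
      rw [hK']
      nlinarith [mul_pos hDp hK, mul_pos (mul_pos hDp hK) hT]
    · refine (UE_mono (fun x hx => lt_of_le_of_lt h hx.1)).trans (hext.trans
        (ENNReal.ofReal_le_ofReal ?_))
      rw [hK']
      nlinarith [mul_pos hK hT]
  have hE := Real.exp_pos (-(κ * (ρ / Real.sqrt T)))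
  rcases le_total ρ (2 * Real.sqrt T) with h | h
  · refine (hsmall W T p u Du hT hu ρ hρ h).trans (ENNReal.ofReal_le_ofReal ?_)
    have h1 : 1 ≤ Real.exp (2 * κ) * Real.exp (-(κ * (ρ / Real.sqrt T))) := by
      rw [← Real.exp_add, Real.one_le_exp_iff]
      have : ρ / Real.sqrt T ≤ 2 := (div_le_iff₀ hsT).2 h
      nlinarith
    have h2 : K * T * 1 ≤ K * T * (Real.exp (2 * κ) * Real.exp (-(κ * (ρ / Real.sqrt T)))) := by
      gcongr
    have h3 : 0 ≤ D * K' * T * Real.exp (-(κ * (ρ / Real.sqrt T))) := by positivity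
    linarith
  · have h1 : UE u (shell p ρ (8 * ρ)) ≤ UE u (ext p ρ) := UE_mono fun x hx => hx.1
    refine h1.trans ((hu.UE_ext_le le_rfl hlam hT hρ).trans ?_)
    have h2 := (UE_mono (u := u) (fun x hx => ⟨hx.1, by linarith [hx.2]⟩ :
      shell p (ρ / 4) (ρ / 2) ⊆ shell p (ρ / 4) (8 * (ρ / 4)))).trans (hall (ρ / 4) (by positivity))
    refine (mul_le_mul' le_rfl h2).trans ?_
    rw [← ENNReal.ofReal_mul (by positivity)]
    refine ENNReal.ofReal_le_ofReal ?_
    have h3 := hdec ρ (by linarith)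
    calc _ ≤ D * Real.exp (-(κ * (ρ / Real.sqrt T))) * (K' * T) := by gcongr
      _ ≤ _ := by
        have : 0 ≤ K * Real.exp (2 * κ) * T * Real.exp (-(κ * (ρ / Real.sqrt T))) := by positivity
        linarith

/-- Energy with the massive term, weighted as in the Caccioppoli inequality. -/
def ME {d : ℕ} (lam T : ℝ) (u : E d → ℝ) (Du : E d → Fin d → ℝ) (S : Set (E d)) : ℝ≥0∞ :=
  ENNReal.ofReal (lam / 2) * DE Du S + ENNReal.ofReal (T⁻¹ / 2) * UE u S

lemma ME_mono {d : ℕ} {lam T : ℝ} {u : E d → ℝ} {Du : E d → Fin d → ℝ} {S S' : Set (E d)}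
    (h : S ⊆ S') : ME lam T u Du S ≤ ME lam T u Du S' :=
  add_le_add (mul_le_mul' le_rfl (DE_mono h)) (mul_le_mul' le_rfl (UE_mono h))

lemma ME_add_le {d : ℕ} {lam T : ℝ} {u : E d → ℝ} {Du : E d → Fin d → ℝ} {S S' A : Set (E d)}
    (hS' : MeasurableSet S') (hd : Disjoint S S') (h : S ⊆ A) (h' : S' ⊆ A) :
    ME lam T u Du S + ME lam T u Du S' ≤ ME lam T u Du A := by
  have hD : DE Du S + DE Du S' = DE Du (S ∪ S') := (lintegral_union hS' hd).symm
  have hU : UE u S + UE u S' = UE u (S ∪ S') := (lintegral_union hS' hd).symm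
  refine le_trans (le_of_eq ?_) (ME_mono (Set.union_subset h h'))
  unfold ME
  rw [← hD, ← hU]
  ring

lemma IsFund.cacc_average {d : ℕ} {lam : ℝ} {W : CoeffField d lam} {T : ℝ} {p : E d} {u : E d → ℝ}
    {Du : E d → Fin d → ℝ} (hu : IsFund W T p u Du) (hlam : 0 < lam) (hT : 0 < T) {z : E d}
    {a b : ℝ} (ha : 0 < a) (hab : a < b) (hb : b < dist z p) {S : Set (E d)}
    (hS : shell z a b ⊆ S) :
    volume S * ME lam T u Du (closedBall z a) ≤
      ENNReal.ofReal (T⁻¹ / 2) * (volume (closedBall z b) * UE u S) +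
      ENNReal.ofReal (2 / lam * (cutK / (b - a)) ^ 2) * VE u S := by
  have hT' : 0 < T⁻¹ := inv_pos.2 hT
  have h : ∫⁻ y in S, ME lam T u Du (closedBall z a) ≤
      ∫⁻ y in S, (ENNReal.ofReal (T⁻¹ / 2) *
        (volume (closedBall z b) * ENNReal.ofReal (u y ^ 2)) +
        ENNReal.ofReal (2 / lam * (cutK / (b - a)) ^ 2) * UE (fun x => u x - u y) S) := by
    refine lintegral_mono fun y => ?_
    refine (hu.cacc_ball hlam hT ha hab hb (u y)).trans (add_le_add (le_of_eq ?_)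
      (mul_le_mul' le_rfl (UE_mono hS)))
    rw [show T⁻¹ * u y ^ 2 / 2 = T⁻¹ / 2 * u y ^ 2 by ring, ENNReal.ofReal_mul (by positivity)]
    ring
  have hm : AEMeasurable (fun y => ENNReal.ofReal (u y ^ 2)) (volume.restrict S) :=
    ((hu.aemeasurable.pow_const 2).ennreal_ofReal).restrict
  rw [lintegral_add_left' ((hm.const_mul _).const_mul _),
    lintegral_const_mul' _ _ ENNReal.ofReal_ne_top,
    lintegral_const_mul' _ _ ENNReal.ofReal_ne_top, lintegral_const_mul'' _ hm,
    setLIntegral_const, mul_comm] at h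
  exact h

lemma volume_closedBall_two (z : E 2) {r : ℝ} (hr : 0 ≤ r) :
    volume (closedBall z r) = ENNReal.ofReal (Real.pi * r ^ 2) := by
  rw [EuclideanSpace.volume_closedBall_fin_two, ← ENNReal.ofReal_pow hr,
    ← ENNReal.ofReal_mul (by positivity), mul_comm]

/-- Uniform energy bound on balls away from the pole. -/
lemma exists_ME_bound {lam : ℝ} (hlam : 0 < lam) : ∃ K : ℝ, 0 < K ∧
    ∀ (W : CoeffField 2 lam) (T : ℝ) (p : E 2) (u : E 2 → ℝ) (Du : E 2 → Fin 2 → ℝ), 0 < T →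
    IsFund W T p u Du → ∀ (z : E 2) (ρ : ℝ), 2 * ρ < dist z p → 0 < dist z p →
    ME lam T u Du (closedBall z ρ) ≤
      ENNReal.ofReal (K * Real.exp (-(decRate lam / 4 * (dist z p / Real.sqrt T)))) := by
  obtain ⟨C, hC, hVE⟩ := exists_VE_bound hlam
  obtain ⟨K, hK, hUE⟩ := exists_UE_shell_bound hlam
  have hcK := cutK_pos
  have hκ := decRate_pos hlam
  have hpi := Real.pi_gt_three
  set κ := decRate lam
  set D : ℝ := 2 / lam * (16 * cutK ^ 2) with hD
  have hDp : 0 < D := by positivity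
  refine ⟨(K + D * C) * Real.exp (κ / 4) + D * K, by positivity, ?_⟩
  intro W T p u Du hT hu z ρ hρ hr0
  set r := dist z p with hr
  have hsT : 0 < Real.sqrt T := Real.sqrt_pos.2 hT
  have hsq : Real.sqrt T ^ 2 = T := Real.sq_sqrt hT.le
  have hU := hUE W T p u Du hT hu (r / 4) (by positivity)
  have hE := Real.exp_pos (-(κ / 4 * (r / Real.sqrt T)))
  rcases le_total r (Real.sqrt T) with h | h
  · have hsub : shell z (r / 2) (3 / 4 * r) ⊆ shell p (r / 4) (8 * (r / 4)) := by
      intro x hx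
      have h1 := dist_triangle z x p
      have h2 := dist_triangle x z p
      rw [dist_comm z x] at h1
      have h3 := hx.2
      constructor <;> linarith
    have h1 := hu.cacc_average hlam hT (z := z) (a := r / 2) (b := 3 / 4 * r) (by positivity)
      (by linarith) (by linarith) hsub
    have h2 : UE u (shell p (r / 4) (8 * (r / 4))) ≤ ENNReal.ofReal (K * T) := by
      refine hU.trans (ENNReal.ofReal_le_ofReal (mul_le_of_le_one_right (by positivity) ?_))
      exact Real.exp_le_one_iff.2 (by rw [neg_nonpos]; positivity)
    have h3 : VE u (shell p (r / 4) (8 * (r / 4))) ≤ ENNReal.ofReal (C * (r / 4) ^ 4) :=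
      (VE_mono (S' := shell p (r / 4) (16 * (r / 4)))
        fun x hx => ⟨hx.1, by linarith [hx.2]⟩).trans
        (hVE W T p u Du hT hu (r / 4) (by positivity))
    have h4 : volume (shell p (r / 4) (8 * (r / 4))) =
        ENNReal.ofReal (63 / 16 * Real.pi * r ^ 2) := by
      rw [volume_shell_two p (by positivity) (by linarith)]
      congr 1
      ring
    have h5 := h1.trans (add_le_add (mul_le_mul' le_rfl (mul_le_mul' le_rfl h2))
      (mul_le_mul' le_rfl h3))
    have hT' : 0 < T⁻¹ := inv_pos.2 hT
    rw [h4, volume_closedBall_two z (by positivity), ← ENNReal.ofReal_mul (by positivity),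
      ← ENNReal.ofReal_mul (by positivity), ← ENNReal.ofReal_mul (by positivity),
      ← ENNReal.ofReal_add (by positivity) (by positivity)] at h5
    refine (ME_mono (closedBall_subset_closedBall (by linarith))).trans
      ((le_ofReal_inv_mul (by positivity) h5).trans ?_)
    rw [← ENNReal.ofReal_mul (by positivity)]
    refine ENNReal.ofReal_le_ofReal ?_
    have e1 : (63 / 16 * Real.pi * r ^ 2)⁻¹ * (T⁻¹ / 2 * (Real.pi * (3 / 4 * r) ^ 2 * (K * T)) +
        2 / lam * (cutK / (3 / 4 * r - r / 2)) ^ 2 * (C * (r / 4) ^ 4)) =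
        K / 14 + D * C / (1008 * Real.pi) := by
      rw [hD, show 3 / 4 * r - r / 2 = r / 4 by ring]
      field_simp
      ring
    rw [e1]
    have h6 : 1 ≤ Real.exp (κ / 4) * Real.exp (-(κ / 4 * (r / Real.sqrt T))) := by
      rw [← Real.exp_add, Real.one_le_exp_iff]
      have : r / Real.sqrt T ≤ 1 := (div_le_one hsT).2 h
      nlinarith
    have h7 : D * C / (1008 * Real.pi) ≤ D * C := div_le_self (by positivity) (by linarith)
    have h8 : (K + D * C) * 1 ≤
        (K + D * C) * (Real.exp (κ / 4) * Real.exp (-(κ / 4 * (r / Real.sqrt T)))) := by gcongr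
    have h9 : 0 ≤ D * K * Real.exp (-(κ / 4 * (r / Real.sqrt T))) := by positivity
    linarith
  · have hsub : closedBall z ρ ⊆ ext p (r / 2) := by
      intro x hx
      have h1 := dist_triangle z x p
      rw [dist_comm z x] at h1
      rw [mem_closedBall] at hx
      have : r / 2 < dist x p := by linarith
      exact this
    have h1 := hu.cacc_ext le_rfl hlam hT (a := r / 4) (b := r / 2) (by positivity) (by linarith)
    have h2 := (UE_mono (u := u) (fun x hx => ⟨hx.1, by linarith [hx.2]⟩ :
      shell p (r / 4) (r / 2) ⊆ shell p (r / 4) (8 * (r / 4)))).trans hU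
    refine (ME_mono hsub).trans (h1.trans ((mul_le_mul' le_rfl h2).trans ?_))
    rw [← ENNReal.ofReal_mul (by positivity)]
    refine ENNReal.ofReal_le_ofReal ?_
    have h3 : T / r ^ 2 ≤ 1 := by
      rw [div_le_one (by positivity), ← hsq]
      exact pow_le_pow_left₀ hsT.le h 2
    have e1 : -(κ * (r / 4 / Real.sqrt T)) = -(κ / 4 * (r / Real.sqrt T)) := by ring
    calc _ = D * K * (T / r ^ 2) * Real.exp (-(κ / 4 * (r / Real.sqrt T))) := by
          rw [hD, e1, show r / 2 - r / 4 = r / 4 by ring]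
          field_simp
          ring
      _ ≤ D * K * 1 * Real.exp (-(κ / 4 * (r / Real.sqrt T))) := by gcongr
      _ ≤ _ := by
        have : 0 ≤ (K + D * C) * Real.exp (κ / 4) * Real.exp (-(κ / 4 * (r / Real.sqrt T))) := by
          positivity
        linarith

/-- Hole filling: the energy on a ball is a fixed fraction of the energy on the doubled ball. -/
lemma exists_hole_filling {lam : ℝ} (hlam : 0 < lam) : ∃ θ : ℝ, 0 < θ ∧ θ < 1 ∧
    ∀ (W : CoeffField 2 lam) (T : ℝ) (p : E 2) (u : E 2 → ℝ) (Du : E 2 → Fin 2 → ℝ), 0 < T →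
    IsFund W T p u Du → ∀ (z : E 2) (ρ : ℝ), 0 < ρ → 4 * ρ < dist z p →
    ME lam T u Du (closedBall z ρ) ≤ ENNReal.ofReal θ * ME lam T u Du (closedBall z (2 * ρ)) := by
  obtain ⟨K, hK, hME⟩ := exists_ME_bound hlam
  have hcK := cutK_pos
  have hpi := Real.pi_pos
  set D : ℝ := 2 / lam * cutK ^ 2 * ((2 * (1 + 2 * Real.pi)) ^ 2 * 2 * (2 / lam)) with hD
  have hDp : 0 < D := by positivity
  set B : ℝ := 2 + D with hB
  refine ⟨B / (1 + B), by positivity, (div_lt_one (by positivity)).2 (by linarith), ?_⟩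
  intro W T p u Du hT hu z ρ hρ hr
  have hT' : 0 < T⁻¹ := inv_pos.2 hT
  set S := shell z ρ (2 * ρ) with hS
  have hb : closedBall z (2 * ρ) ⊆ ext p ρ := by
    intro x hx
    have h1 := dist_triangle z x p
    rw [dist_comm z x] at h1
    rw [mem_closedBall] at hx
    have : ρ < dist x p := by linarith
    exact this
  have h1 := hu.cacc_average hlam hT (z := z) (a := ρ) (b := 2 * ρ) hρ (by linarith) (by linarith)
    (subset_rfl : S ⊆ S)
  have h2 := (hu.VE_le z (a' := ρ / 2) (a := ρ) (b := 2 * ρ) (b' := 3 * ρ) (by linarith)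
    (by linarith) (by linarith) (by linarith) (Or.inr (by rw [dist_comm]; linarith))).trans
    (mul_le_mul' le_rfl (hu.lintegral_sum_abs_sq_le S))
  have hv : volume S = ENNReal.ofReal (3 * Real.pi * ρ ^ 2) := by
    rw [hS, volume_shell_two z hρ.le (by linarith)]
    congr 1
    ring
  have hfin := ne_top_of_le_ne_top ENNReal.ofReal_ne_top
    (hME W T p u Du hT hu z (2 * ρ) (by linarith) (by linarith))
  have hSsub : S ⊆ closedBall z (2 * ρ) := fun x hx => mem_closedBall.2 hx.2.le
  have hadd := ME_add_le (lam := lam) (T := T) (u := u) (Du := Du) (S := closedBall z ρ) (S' := S)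
    (A := closedBall z (2 * ρ)) (measurableSet_shell _ _ _)
    (Set.disjoint_left.2 fun x hx hx' => absurd hx'.1 (not_lt.2 (mem_closedBall.1 hx)))
    (closedBall_subset_closedBall (by linarith)) hSsub
  obtain ⟨m, hm0, hm⟩ := exists_eq_ofReal hfin
  obtain ⟨m₁, hm₁0, hm₁⟩ := exists_eq_ofReal (ne_top_of_le_ne_top hfin
    (ME_mono (closedBall_subset_closedBall (by linarith : ρ ≤ 2 * ρ))))
  have hSfin := ne_top_of_le_ne_top hfin (ME_mono hSsub)
  obtain ⟨e, he0, he⟩ := exists_eq_ofReal (A := DE Du S) (by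
    intro h
    unfold ME at hSfin
    rw [h, ENNReal.mul_top (by simpa using hlam), top_add] at hSfin
    exact hSfin rfl)
  obtain ⟨g, hg0, hg⟩ := exists_eq_ofReal (A := UE u S)
    (ne_top_of_le_ne_top (hu.UE_ext_lt_top le_rfl hT hρ).ne (UE_mono (hSsub.trans hb)))
  have h3 := h1.trans (add_le_add le_rfl (mul_le_mul' le_rfl h2))
  have hK2 : shellK ρ (2 * ρ) ^ 2 = (2 * (1 + 2 * Real.pi)) ^ 2 * ρ ^ 2 := by
    rw [shellK, show (2 * ρ - ρ) / ρ = 1 by field_simp; norm_num]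
    ring
  have hMS : ME lam T u Du S = ENNReal.ofReal (lam / 2 * e + T⁻¹ / 2 * g) := by
    rw [ME, he, hg, ← ENNReal.ofReal_mul (by positivity), ← ENNReal.ofReal_mul (by positivity),
      ← ENNReal.ofReal_add (by positivity) (by positivity)]
  rw [hm, hm₁, hMS, ← ENNReal.ofReal_add hm₁0 (by positivity),
    ENNReal.ofReal_le_ofReal_iff hm0] at hadd
  rw [hv, hm₁, hg, he, hK2, show 2 * ρ - ρ = ρ by ring, volume_closedBall_two z (by positivity),
    show (2 : ℝ≥0∞) = ENNReal.ofReal 2 by simp, ← ENNReal.ofReal_mul (by positivity),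
    ← ENNReal.ofReal_mul (by positivity), ← ENNReal.ofReal_mul (by positivity),
    ← ENNReal.ofReal_mul (by positivity), ← ENNReal.ofReal_mul (by positivity),
    ← ENNReal.ofReal_mul (by positivity), ← ENNReal.ofReal_mul (by positivity),
    ← ENNReal.ofReal_add (by positivity) (by positivity),
    ENNReal.ofReal_le_ofReal_iff (by positivity)] at h3
  rw [hm, hm₁, ← ENNReal.ofReal_mul (by positivity)]
  refine ENNReal.ofReal_le_ofReal ?_
  have e1 : T⁻¹ / 2 * (Real.pi * (2 * ρ) ^ 2 * g) + 2 / lam * (cutK / ρ) ^ 2 *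
      ((2 * (1 + 2 * Real.pi)) ^ 2 * ρ ^ 2 * (2 * (3 * Real.pi * ρ ^ 2 * e))) =
      3 * Real.pi * ρ ^ 2 * (4 / 3 * (T⁻¹ / 2 * g) + D * (lam / 2 * e)) := by
    rw [hD]
    field_simp
    ring
  rw [e1] at h3
  have h4 := le_of_mul_le_mul_left h3 (by positivity)
  have h5 : 4 / 3 * (T⁻¹ / 2 * g) + D * (lam / 2 * e) ≤ B * (lam / 2 * e + T⁻¹ / 2 * g) := by
    have q1 : 0 ≤ T⁻¹ / 2 * g := by positivity
    have q2 : 0 ≤ lam / 2 * e := by positivity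
    rw [hB]
    nlinarith [mul_nonneg hDp.le q1]
  have h6 : B * (lam / 2 * e + T⁻¹ / 2 * g) ≤ B * (m - m₁) :=
    mul_le_mul_of_nonneg_left (by linarith) (by positivity)
  rw [div_mul_eq_mul_div, le_div_iff₀ (by positivity)]
  linarith

/-- Hölder-type energy decay for fundamental solutions in dimension two. -/
lemma exists_ME_decay {lam : ℝ} (hlam : 0 < lam) : ∃ β K : ℝ, 0 < β ∧ 0 < K ∧
    ∀ (W : CoeffField 2 lam) (T : ℝ) (p : E 2) (u : E 2 → ℝ) (Du : E 2 → Fin 2 → ℝ), 0 < T →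
    IsFund W T p u Du → ∀ (z : E 2) (R : ℝ), 0 < R → 2 * R < dist z p →
    ME lam T u Du (closedBall z R) ≤ ENNReal.ofReal (K * (dist z p / R) ^ (-β) *
      Real.exp (-(decRate lam / 4 * (dist z p / Real.sqrt T)))) := by
  obtain ⟨K, hK, hME⟩ := exists_ME_bound hlam
  obtain ⟨θ, hθ0, hθ1, hfill⟩ := exists_hole_filling hlam
  refine ⟨-Real.logb 2 θ, (θ ^ 2)⁻¹ * K, neg_pos.2 (Real.logb_neg one_lt_two hθ0 hθ1),
    by positivity, ?_⟩
  intro W T p u Du hT hu z R hR hr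
  set r := dist z p with hrdef
  have hr0 : 0 < r := by linarith
  have hiter : ∀ n : ℕ, ∀ ρ : ℝ, 0 < ρ → 2 ^ (n + 1) * ρ < r → ME lam T u Du (closedBall z ρ) ≤
      ENNReal.ofReal (θ ^ n) * ME lam T u Du (closedBall z (2 ^ n * ρ)) := by
    intro n
    induction n with
    | zero => intro ρ _ _; simp
    | succ n ih =>
      intro ρ hρ h
      have h4 : 4 * ρ ≤ 2 ^ (n + 1 + 1) * ρ := by
        have : (1 : ℝ) ≤ 2 ^ n := one_le_pow₀ one_le_two
        have e : (2 : ℝ) ^ (n + 1 + 1) = 4 * 2 ^ n := by ring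
        rw [e]
        nlinarith
      refine (hfill W T p u Du hT hu z ρ hρ (lt_of_le_of_lt h4 h)).trans
        ((mul_le_mul' le_rfl (ih (2 * ρ) (by positivity) ?_)).trans (le_of_eq ?_))
      · calc _ = 2 ^ (n + 1 + 1) * ρ := by ring
          _ < r := h
      · rw [← mul_assoc, ← ENNReal.ofReal_mul hθ0.le, ← pow_succ',
          show 2 ^ n * (2 * ρ) = 2 ^ (n + 1) * ρ by ring]
  have hex : ∃ n : ℕ, r ≤ 2 ^ (n + 2) * R := by
    obtain ⟨n, hn⟩ := pow_unbounded_of_one_lt (r / R) (one_lt_two)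
    rw [div_lt_iff₀ hR] at hn
    refine ⟨n, hn.le.trans ?_⟩
    gcongr
    · exact one_le_two
    · omega
  classical
  set n := Nat.find hex with hn
  have hn2 : r ≤ 2 ^ (n + 2) * R := Nat.find_spec hex
  have hn1 : 2 ^ (n + 1) * R < r := by
    rcases Nat.eq_zero_or_pos n with h | h
    · rw [h]
      simpa using hr
    · have := Nat.find_min hex (m := n - 1) (by omega)
      rw [not_le, show n - 1 + 2 = n + 1 by omega] at this
      exact this
  have hb := hME W T p u Du hT hu z (2 ^ n * R)
    (by rw [← mul_assoc, ← pow_succ']; exact hn1) hr0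
  refine (hiter n R hR hn1).trans ((mul_le_mul' le_rfl hb).trans ?_)
  rw [← ENNReal.ofReal_mul (by positivity)]
  refine ENNReal.ofReal_le_ofReal ?_
  have hθ : θ ^ (n + 2) ≤ (r / R) ^ Real.logb 2 θ := by
    have h1 : θ ^ (n + 2) = ((2 : ℝ) ^ (n + 2)) ^ Real.logb 2 θ := by
      rw [← Real.rpow_natCast 2, ← Real.rpow_mul zero_le_two, mul_comm, Real.rpow_mul zero_le_two,
        Real.rpow_logb zero_lt_two (by norm_num) hθ0, Real.rpow_natCast]
    rw [h1]
    exact Real.rpow_le_rpow_of_nonpos (by positivity) ((div_le_iff₀ hR).2 hn2)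
      (Real.logb_neg one_lt_two hθ0 hθ1).le
  have hθ' : θ ^ n ≤ (θ ^ 2)⁻¹ * (r / R) ^ Real.logb 2 θ := by
    rw [inv_mul_eq_div, le_div_iff₀ (by positivity), ← pow_add]
    exact hθ
  rw [neg_neg]
  calc _ ≤ (θ ^ 2)⁻¹ * (r / R) ^ Real.logb 2 θ *
        (K * Real.exp (-(decRate lam / 4 * (r / Real.sqrt T)))) := by gcongr
    _ = _ := by ring

/-- The gradient estimate in dimension two. -/
lemma exists_gradient_bound_of_two {lam : ℝ} (hlam : 0 < lam) : ∃ α : ℝ, 0 < α ∧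
    ∀ R : ℝ, 1 ≤ R → ∃ c C : ℝ, 0 < c ∧ 0 < C ∧
      ∀ (W : CoeffField 2 lam) (T : ℝ), 0 < T →
      ∀ (G : E 2 → E 2 → ℝ) (DxG DyG : E 2 → E 2 → Fin 2 → ℝ),
        IsGreenFunction W T G DxG DyG →
      ∀ z : E 2, 2*R < dist z 0 →
        (∫⁻ y in ball z R, ENNReal.ofReal (DxG y 0 ⬝ᵥ DxG y 0)) ^ ((1:ℝ)/2) ≤
          ENNReal.ofReal (C * Real.exp (-(c * dist z 0) / Real.sqrt T) *
            dist z 0 ^ (-α)) := by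
  obtain ⟨β, K, hβ, hK, hdec⟩ := exists_ME_decay hlam
  have hκ := decRate_pos hlam
  set κ := decRate lam
  refine ⟨β / 2, by positivity, fun R hR => ?_⟩
  have hR0 : 0 < R := by linarith
  set D : ℝ := (lam / 2)⁻¹ * (K * R ^ β) with hD
  have hDpos : 0 < D := by positivity
  refine ⟨κ / 8, Real.sqrt D, by positivity, by positivity, ?_⟩
  intro W T hT G DxG DyG hG z hz
  obtain ⟨c, C', hc, hC', hprops⟩ := hG
  have hu := hprops.isFund_left hc hC' 0
  set r := dist z 0 with hr
  have hr0 : 0 < r := by linarith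
  set Y : ℝ := Real.sqrt D * Real.exp (-(κ / 8 * r) / Real.sqrt T) * r ^ (-(β / 2)) with hY
  have hYpos : 0 < Y := by positivity
  have hE : DE (fun x => DxG x 0) (ball z R) ≤ ENNReal.ofReal (Y ^ 2) := by
    refine (DE_mono ball_subset_closedBall).trans ((le_ofReal_inv_mul (by positivity)
      (le_self_add.trans (hdec W T 0 _ _ hT hu z R hR0 hz))).trans (le_of_eq ?_))
    rw [← ENNReal.ofReal_mul (by positivity)]
    congr 1
    have e1 : (r / R) ^ (-β) = R ^ β * (r ^ (-(β / 2))) ^ 2 := by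
      rw [Real.div_rpow hr0.le hR0.le, Real.rpow_neg hR0.le, div_inv_eq_mul, mul_comm,
        ← Real.rpow_natCast, ← Real.rpow_mul hr0.le]
      congr 2
      push_cast
      ring
    have e2 : Real.exp (-(κ / 4 * (r / Real.sqrt T))) =
        Real.exp (-(κ / 8 * r) / Real.sqrt T) ^ 2 := by
      rw [← Real.exp_nat_mul]
      congr 1
      push_cast
      ring
    rw [← hr, e1, e2, hY, mul_pow, mul_pow, Real.sq_sqrt hDpos.le, hD]
    ring
  calc _ ≤ (ENNReal.ofReal (Y ^ 2)) ^ ((1 : ℝ) / 2) := ENNReal.rpow_le_rpow hE (by norm_num)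
    _ = ENNReal.ofReal Y := by
        rw [ENNReal.ofReal_rpow_of_nonneg (by positivity) (by norm_num), ← Real.sqrt_eq_rpow,
          Real.sqrt_sq hYpos.le]

/-- Lemma: suboptimal quenched pointwise estimates on the Green function
gradient. There is `α = α(d,λ) > 0` such that for every `R ≥ 1`, every coefficient field,
`T > 0` and `|z| > 2R`,
`(∫_{B_R(z)} |∇_{z'}G_T(z',0)|²)^{1/2} ≤ C |z|^{−α} exp(−c|z|/√T)` for `d = 2` and
`≤ C |z|^{2−d} exp(−c|z|/√T)` for `d > 2`. -/
theorem statement14 (d : ℕ) (hd : 2 ≤ d) (lam : ℝ) (hlam : 0 < lam) (hlam' : lam ≤ 1) :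
    ∃ α : ℝ, 0 < α ∧ ∀ R : ℝ, 1 ≤ R → ∃ c C : ℝ, 0 < c ∧ 0 < C ∧
      ∀ (W : CoeffField d lam) (T : ℝ), 0 < T →
      ∀ (G : E d → E d → ℝ) (DxG DyG : E d → E d → Fin d → ℝ),
        IsGreenFunction W T G DxG DyG →
      ∀ z : E d, 2*R < dist z 0 →
        (∫⁻ y in ball z R, ENNReal.ofReal (DxG y 0 ⬝ᵥ DxG y 0)) ^ ((1:ℝ)/2) ≤
          ENNReal.ofReal (C * Real.exp (-(c * dist z 0) / Real.sqrt T) *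
            (if d = 2 then dist z 0 ^ (-α) else dist z 0 ^ ((2:ℝ) - (d:ℝ)))) := by
  rcases hd.eq_or_lt with rfl | hd3
  · obtain ⟨α, hα, h⟩ := exists_gradient_bound_of_two hlam
    refine ⟨α, hα, fun R hR => ?_⟩
    obtain ⟨c, C, hc, hC, hb⟩ := h R hR
    refine ⟨c, C, hc, hC, fun W T hT G DxG DyG hG z hz => ?_⟩
    rw [if_pos rfl]
    exact hb W T hT G DxG DyG hG z hz
  · refine ⟨1, one_pos, fun R hR => ?_⟩
    obtain ⟨c, C, hc, hC, hb⟩ := exists_gradient_bound_of_three_le hd3 hlam hR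
    refine ⟨c, C, hc, hC, fun W T hT G DxG DyG hG z hz => ?_⟩
    rw [if_neg (by omega)]
    exact hb W T hT G DxG DyG hG z hz


end GO
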